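/- For any integer p ≥ 1, any real ν ∈ [1, 2], and any real r > 1, there exists a solution for the parameters (ν, r, p). -/

import Mathlib

open Complex Set

noncomputable section

/-- The open upper half-plane. -/
def UpperHalf : Set ℂ := {z | 0 < z.im}

/-- The open lower half-plane. -/
def LowerHalf : Set ℂ := {z | z.im < 0}

/-- `Omega s t = C₊ ∪ C₋ ∪ (s,t)`. -/
def Omega (s t : ℝ) : Set ℂ := UpperHalf ∪ LowerHalf ∪ (Complex.ofReal '' Set.Ioo s t)

/-- A Herglotz (Pick) function on `Omega s t`. -/
def Herglotzian (s t : ℝ) (f : ℂ → ℂ) : Prop :=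
  DifferentiableOn ℂ f (Omega s t) ∧
  (∀ z ∈ Omega s t, f (starRingEnd ℂ z) = starRingEnd ℂ (f z)) ∧
  (∀ z ∈ Omega s t, 0 < z.im → 0 ≤ (f z).im)

/-- An anti-Herglotz function on `Omega s t`. -/
def AntiHerglotzian (s t : ℝ) (f : ℂ → ℂ) : Prop :=
  DifferentiableOn ℂ f (Omega s t) ∧
  (∀ z ∈ Omega s t, f (starRingEnd ℂ z) = starRingEnd ℂ (f z)) ∧
  (∀ z ∈ Omega s t, 0 < z.im → (f z).im ≤ 0)

/-- A solution for parameters `(ν, r, p)`. -/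
def IsSolution (ν r : ℝ) (p : ℕ) (ψ u : ℂ → ℂ) (lam z₁ : ℝ) : Prop :=
  lam ∈ Set.Ioo (0:ℝ) 1 ∧ z₁ ∈ Set.Ioo (0:ℝ) 1 ∧
  (∃ a ∈ Set.Ioo (0:ℝ) 1,
    AntiHerglotzian (-1/lam) (1/a) ψ ∧ ψ 1 = 0 ∧ ψ 0 = 1 ∧
    ∀ z ∈ Omega (-1/lam) (1/a),
      ψ z = ((lam ^ (r * ν) : ℝ) : ℂ)⁻¹ *
        ψ (((lam ^ (ν - 1) : ℝ) : ℂ) * (fun w => u (-w))^[p] ((lam : ℂ) * z))) ∧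
  AntiHerglotzian (-1/lam) 1 u ∧
  (∀ x ∈ Set.Ioo (-1/lam) (1:ℝ), (ψ (x:ℂ)).im = 0 ∧ 0 < (ψ (x:ℂ)).re) ∧
  ∀ z ∈ Omega (-1/lam) 1,
    u z = ((z₁ / lam ^ (ν - 1) : ℝ) : ℂ) * ψ z ^ ((1 / r : ℝ) : ℂ)


section NoRetraction

variable {E : Type*} [NormedAddCommGroup E] [InnerProductSpace ℝ E] [FiniteDimensional ℝ E]

theorem exists_polynomial_det_one_add_smul (A : E →L[ℝ] E) :
    ∃ P : Polynomial ℝ, P.degree < ((Module.finrank ℝ E + 1 : ℕ) : WithBot ℕ) ∧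
      ∀ t : ℝ, P.eval t = (ContinuousLinearMap.id ℝ E + t • A).det := by
  classical
  let b := Module.finBasis ℝ E
  let M := LinearMap.toMatrix b b (A : E →ₗ[ℝ] E)
  refine ⟨((Polynomial.X : Polynomial ℝ) • M.map Polynomial.C +
    (1 : Matrix _ _ ℝ).map Polynomial.C).det, ?_, fun t => ?_⟩
  · refine lt_of_le_of_lt Polynomial.degree_le_natDegree ?_
    have := Polynomial.natDegree_det_X_add_C_le M 1
    rw [Fintype.card_fin] at this
    exact_mod_cast Nat.lt_succ_of_le this
  · have h1 : (ContinuousLinearMap.id ℝ E + t • A).det =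
        (LinearMap.toMatrix b b ((ContinuousLinearMap.id ℝ E + t • A : E →L[ℝ] E) :
          E →ₗ[ℝ] E)).det := (LinearMap.det_toMatrix b _).symm
    rw [h1, ← Polynomial.coe_evalRingHom, RingHom.map_det]
    congr 1
    have h2 : ((ContinuousLinearMap.id ℝ E + t • A : E →L[ℝ] E) : E →ₗ[ℝ] E) =
      LinearMap.id + t • (A : E →ₗ[ℝ] E) := by ext; simp
    rw [h2, LinearEquiv.map_add, LinearEquiv.map_smul, LinearMap.toMatrix_id]
    ext i j
    by_cases hij : i = j <;>
      simp [hij, M, add_comm] <;> ring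

theorem det_one_add_pos {A : E →L[ℝ] E} (hA : ‖A‖ < 1) :
    0 < (ContinuousLinearMap.id ℝ E + A).det := by
  have key : ∀ s ∈ Icc (0 : ℝ) 1, (ContinuousLinearMap.id ℝ E + s • A).det ≠ 0 := by
    intro s hs h
    obtain ⟨x, hx0, hx⟩ : ∃ x : E, x ≠ 0 ∧ x + s • A x = 0 := by
      have h' : ¬ LinearMap.ker ((ContinuousLinearMap.id ℝ E + s • A : E →L[ℝ] E) :
          E →ₗ[ℝ] E) = ⊥ := by
        intro hk
        have := LinearMap.bot_lt_ker_of_det_eq_zero (f := ((ContinuousLinearMap.id ℝ E + s • A :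
          E →L[ℝ] E) : E →ₗ[ℝ] E)) h
        rw [hk] at this
        exact lt_irrefl _ this
      obtain ⟨x, hx, hx0⟩ := Submodule.exists_mem_ne_zero_of_ne_bot h'
      exact ⟨x, hx0, by simpa using hx⟩
    have h1 : x = -(s • A x) := eq_neg_of_add_eq_zero_left hx
    have h2 : ‖x‖ ≤ ‖A‖ * ‖x‖ := by
      calc ‖x‖ = ‖s • A x‖ := by rw [← norm_neg (s • A x), ← h1]
        _ = |s| * ‖A x‖ := norm_smul _ _
        _ ≤ 1 * ‖A x‖ := by
          gcongr; rw [abs_of_nonneg hs.1]; exact hs.2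
        _ ≤ ‖A‖ * ‖x‖ := by rw [one_mul]; exact A.le_opNorm x
    have := norm_pos_iff.2 hx0
    nlinarith
  by_contra hneg
  push Not at hneg
  have hc : ContinuousOn (fun s : ℝ => (ContinuousLinearMap.id ℝ E + s • A).det) (Icc 0 1) :=
    (ContinuousLinearMap.continuous_det.comp (by fun_prop)).continuousOn
  have h0 : (ContinuousLinearMap.id ℝ E + (0 : ℝ) • A).det = 1 := by
    simp [ContinuousLinearMap.det]
  have := intermediate_value_Icc' (zero_le_one (α := ℝ)) hc
  obtain ⟨s, hs, hs0⟩ := this (show (0 : ℝ) ∈ Icc _ _ by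
    constructor
    · simpa using hneg
    · show (0:ℝ) ≤ (ContinuousLinearMap.id ℝ E + (0 : ℝ) • A).det
      rw [h0]; exact zero_le_one)
  exact key s hs hs0

theorem sum_lagrange_det {A : E →L[ℝ] E} {v : Fin (Module.finrank ℝ E + 1) → ℝ}
    (hv : Function.Injective v) :
    (ContinuousLinearMap.id ℝ E + A).det =
      ∑ i, (ContinuousLinearMap.id ℝ E + v i • A).det *
        (Lagrange.basis Finset.univ v i).eval 1 := by
  obtain ⟨P, hP, hPe⟩ := exists_polynomial_det_one_add_smul A
  have h := Lagrange.eq_interpolate (s := Finset.univ) (v := v) (f := P) hv.injOn (by simpa using hP)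
  have h1 := hPe 1
  rw [one_smul] at h1
  rw [← h1, h, Lagrange.interpolate_apply, Polynomial.eval_finsetSum]
  refine Finset.sum_congr rfl fun i _ => ?_
  rw [Polynomial.eval_mul, Polynomial.eval_C, hPe]

variable [MeasurableSpace E] [BorelSpace E]

theorem setIntegral_det_eq_volume_of_small {g : E → E}
    (hg : ∀ x ∈ Metric.closedBall (0 : E) 1, ContDiffAt ℝ 1 g x) {L t : ℝ}
    (hL : ∀ x ∈ Metric.closedBall (0 : E) 1, ‖fderiv ℝ g x‖ ≤ L)
    (hs : ∀ x ∈ Metric.sphere (0 : E) 1, g x = 0)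
    (hn : ∀ x ∈ Metric.closedBall (0 : E) 1, ‖x + g x‖ ≤ 1)
    (ht0 : 0 ≤ t) (ht1 : t < 1) (htL : t * L < 1) :
    ∫ x in Metric.ball (0 : E) 1, (ContinuousLinearMap.id ℝ E + t • fderiv ℝ g x).det =
      MeasureTheory.volume.real (Metric.ball (0 : E) 1) := by
  set D := Metric.closedBall (0 : E) 1
  set B := Metric.ball (0 : E) 1
  have hBD : B ⊆ D := Metric.ball_subset_closedBall
  let G : E → E := fun x => x + t • g x
  have hstrict : ∀ x ∈ D, HasStrictFDerivAt G (ContinuousLinearMap.id ℝ E + t • fderiv ℝ g x) x := by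
    intro x hx
    exact (hasStrictFDerivAt_id x).add (((hg x hx).hasStrictFDerivAt (by norm_num)).const_smul t)
  have hdet : ∀ x ∈ D, 0 < (ContinuousLinearMap.id ℝ E + t • fderiv ℝ g x).det := by
    intro x hx
    apply det_one_add_pos
    rw [norm_smul, Real.norm_of_nonneg ht0]
    exact lt_of_le_of_lt (mul_le_mul_of_nonneg_left (hL x hx) ht0) htL
  have hinj : InjOn G D := by
    intro x hx y hy hxy
    have h1 : ‖g y - g x‖ ≤ L * ‖y - x‖ :=
      (convex_closedBall (0 : E) 1).norm_image_sub_le_of_norm_fderiv_le (𝕜 := ℝ)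
        (fun z hz => (hg z hz).differentiableAt (by norm_num)) hL hx hy
    have h2 : y - x = -(t • (g y - g x)) := by
      have : x + t • g x = y + t • g y := hxy
      rw [smul_sub]
      rw [eq_neg_iff_add_eq_zero]
      have h3 : y - x + (t • g y - t • g x) = (y + t • g y) - (x + t • g x) := by abel
      rw [h3, this, sub_self]
    have h4 : ‖y - x‖ ≤ t * L * ‖y - x‖ := by
      calc ‖y - x‖ = t * ‖g y - g x‖ := by
            rw [h2, norm_neg, norm_smul, Real.norm_of_nonneg ht0]
        _ ≤ t * (L * ‖y - x‖) := by gcongr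
        _ = _ := by ring
    have h5 : ‖y - x‖ = 0 := by
      by_contra hne
      have : 0 < ‖y - x‖ := lt_of_le_of_ne (norm_nonneg _) (Ne.symm hne)
      nlinarith
    exact (sub_eq_zero.1 (norm_eq_zero.1 h5)).symm
  have hGeq : ∀ x, G x = (1 - t) • x + t • (x + g x) := by
    intro x; simp only [G, sub_smul, smul_add, one_smul]; abel
  have hGB : G '' B ⊆ B := by
    rintro _ ⟨x, hx, rfl⟩
    have hx' : ‖x‖ < 1 := by simpa [B] using hx
    have := hn x (hBD hx)
    have : ‖G x‖ < 1 := by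
      rw [hGeq]
      calc _ ≤ ‖(1 - t) • x‖ + ‖t • (x + g x)‖ := norm_add_le _ _
        _ = (1 - t) * ‖x‖ + t * ‖x + g x‖ := by
          rw [norm_smul, norm_smul, Real.norm_of_nonneg ht0, Real.norm_of_nonneg (by linarith)]
        _ < 1 := by nlinarith [norm_nonneg x]
    simpa [B] using this
  have hopen : IsOpen (G '' B) := by
    rw [isOpen_iff_mem_nhds]
    rintro _ ⟨x, hx, rfl⟩
    have hsurj : LinearMap.range (((ContinuousLinearMap.id ℝ E + t • fderiv ℝ g x) : E →L[ℝ] E) :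
        E →ₗ[ℝ] E) = ⊤ := by
      have := LinearMap.range_eq_top.2 (LinearMap.equivOfDetNeZero (((ContinuousLinearMap.id ℝ E
        + t • fderiv ℝ g x) : E →L[ℝ] E) : E →ₗ[ℝ] E) (hdet x (hBD hx)).ne').surjective
      exact this
    rw [← (hstrict x (hBD hx)).map_nhds_eq_of_surj hsurj]
    exact Filter.image_mem_map (Metric.isOpen_ball.mem_nhds hx)
  have hcont : ContinuousOn G D := fun x hx => (hstrict x hx).continuousAt.continuousWithinAt
  have himg : G '' B = B := by
    apply Subset.antisymm hGB
    apply IsPreconnected.subset_of_closure_inter_subset (convex_ball (0:E) 1).isPreconnected hopen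
    · exact ⟨G 0, hGB ⟨0, by simp [B], rfl⟩, ⟨0, by simp [B], rfl⟩⟩
    · rintro y ⟨hy1, hy2⟩
      have hcl : closure (G '' B) ⊆ G '' D :=
        closure_minimal (image_mono hBD) ((isCompact_closedBall (0:E) 1).image_of_continuousOn
          hcont).isClosed
      obtain ⟨x, hx, rfl⟩ := hcl hy1
      have hx1 : ‖x‖ ≤ 1 := by simpa [D] using hx
      rcases hx1.lt_or_eq with h | h
      · exact ⟨x, by simpa [B] using h, rfl⟩
      · exfalso
        have : G x = x := by simp [G, hs x (by simpa using h)]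
        rw [this] at hy2
        have : ‖x‖ < 1 := by simpa using hy2
        linarith
  have hmain := MeasureTheory.integral_image_eq_integral_abs_det_fderiv_smul
    (MeasureTheory.volume : MeasureTheory.Measure E) (s := B) (f := G) Metric.isOpen_ball.measurableSet
    (fun x hx => (hstrict x (hBD hx)).hasFDerivAt.hasFDerivWithinAt) (hinj.mono hBD)
    (fun _ => (1 : ℝ))
  rw [himg] at hmain
  simp only [smul_eq_mul, mul_one, MeasureTheory.integral_const, MeasureTheory.measureReal_restrict_apply_univ] at hmain
  rw [hmain]
  refine MeasureTheory.setIntegral_congr_fun Metric.isOpen_ball.measurableSet fun x hx => ?_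
  exact (abs_of_pos (hdet x (hBD hx))).symm

theorem no_contDiff_retraction {f : E → E}
    (hf : ∀ x ∈ Metric.closedBall (0 : E) 1, ContDiffAt ℝ 1 f x)
    (hn : ∀ x ∈ Metric.closedBall (0 : E) 1, ‖f x‖ = 1)
    (hs : ∀ x ∈ Metric.sphere (0 : E) 1, f x = x) : False := by
  set D := Metric.closedBall (0 : E) 1
  set B := Metric.ball (0 : E) 1
  have hBD : B ⊆ D := Metric.ball_subset_closedBall
  let g : E → E := fun x => f x - x
  have hg : ∀ x ∈ D, ContDiffAt ℝ 1 g x := fun x hx => (hf x hx).sub contDiffAt_id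
  have hgc : ContinuousOn (fderiv ℝ g) D := fun x hx =>
    ((hg x hx).continuousAt_fderiv (by norm_num)).continuousWithinAt
  obtain ⟨L, hL⟩ := (isCompact_closedBall (0 : E) 1).exists_bound_of_continuousOn hgc
  let M := max L 1
  have hM : 0 < M := lt_of_lt_of_le one_pos (le_max_right _ _)
  let N := Module.finrank ℝ E + 1
  let v : Fin N → ℝ := fun i => 1 / ((M + 1) * ((i : ℝ) + 2))
  have hden : ∀ i : Fin N, 0 < (M + 1) * ((i : ℝ) + 2) := fun i => by positivity
  have hv : Function.Injective v := by
    intro i j hij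
    have h1 : (M + 1) * ((i : ℝ) + 2) = (M + 1) * ((j : ℝ) + 2) := by
      have : 1 / ((M + 1) * ((i : ℝ) + 2)) = 1 / ((M + 1) * ((j : ℝ) + 2)) := hij
      simpa using this
    have h2 : (i : ℝ) = j := by
      have := mul_left_cancel₀ (by positivity : M + 1 ≠ 0) h1
      linarith
    exact Fin.ext (by exact_mod_cast h2)
  have hv0 : ∀ i, 0 ≤ v i := fun i => by positivity
  have hvi : ∀ i, v i < 1 / (M + 1) := by
    intro i
    apply one_div_lt_one_div_of_lt (by positivity)
    have : (0:ℝ) ≤ i := by positivity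
    nlinarith
  have hv1 : ∀ i, v i < 1 := fun i => (hvi i).trans_le (by
    rw [div_le_one (by positivity)]; linarith)
  have hvM : ∀ i, v i * M < 1 := fun i => by
    have := hvi i
    rw [lt_div_iff₀ (by positivity)] at this
    nlinarith [hv0 i]
  have hdet : ∀ i, ∫ x in B, (ContinuousLinearMap.id ℝ E + v i • fderiv ℝ g x).det =
      MeasureTheory.volume.real B := fun i =>
    setIntegral_det_eq_volume_of_small hg (L := M) (fun x hx => (hL x hx).trans (le_max_left _ _))
      (fun x hx => by simp [g, hs x hx]) (fun x hx => by simp [g, hn x hx]) (hv0 i) (hv1 i) (hvM i)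
  have hdetInt : ∀ i, MeasureTheory.IntegrableOn
      (fun x => (ContinuousLinearMap.id ℝ E + v i • fderiv ℝ g x).det) B := by
    intro i
    have hc : ContinuousOn (fun x => (ContinuousLinearMap.id ℝ E + v i • fderiv ℝ g x).det) D :=
      ContinuousLinearMap.continuous_det.comp_continuousOn (by fun_prop)
    exact (hc.integrableOn_compact (isCompact_closedBall (0 : E) 1)).mono_set hBD
  have hzero : ∀ x ∈ B, (ContinuousLinearMap.id ℝ E + fderiv ℝ g x).det = 0 := by
    intro x hx
    have hfx := (hf x (hBD hx)).differentiableAt (by norm_num)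
    have hDg : ContinuousLinearMap.id ℝ E + fderiv ℝ g x = fderiv ℝ f x := by
      have : fderiv ℝ g x = fderiv ℝ f x - ContinuousLinearMap.id ℝ E := by
        rw [show g = fun x => f x - x from rfl, fderiv_fun_sub hfx differentiableAt_fun_id,
          fderiv_fun_id]
      rw [this]; abel
    rw [hDg]
    have hconst : (fun y => inner ℝ (f y) (f y)) =ᶠ[nhds x] fun _ => (1 : ℝ) := by
      filter_upwards [Metric.isOpen_ball.mem_nhds hx] with y hy
      rw [real_inner_self_eq_norm_sq, hn y (hBD hy)]; norm_num
    have hd : ∀ w, inner ℝ (f x) (fderiv ℝ f x w) = 0 := by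
      intro w
      have h1 := (hfx.hasFDerivAt.inner ℝ hfx.hasFDerivAt).unique
        ((hasFDerivAt_const (1:ℝ) x).congr_of_eventuallyEq hconst)
      have h2 := congrArg (fun T => T w) h1
      simp [fderivInnerCLM_apply] at h2
      rw [real_inner_comm (f x)] at h2
      linarith
    by_contra hne
    obtain ⟨w, hw⟩ := (LinearMap.equivOfDetNeZero ((fderiv ℝ f x : E →L[ℝ] E) : E →ₗ[ℝ] E)
      hne).surjective (f x)
    have hw' : fderiv ℝ f x w = f x := hw
    have := hd w
    rw [hw', real_inner_self_eq_norm_sq, hn x (hBD hx)] at this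
    norm_num at this
  have h0 : ∫ x in B, (ContinuousLinearMap.id ℝ E + fderiv ℝ g x).det = 0 := by
    rw [MeasureTheory.setIntegral_congr_fun Metric.isOpen_ball.measurableSet hzero]
    simp
  have h1 : ∫ x in B, (ContinuousLinearMap.id ℝ E + fderiv ℝ g x).det =
      MeasureTheory.volume.real B := by
    simp_rw [fun x => sum_lagrange_det (A := fderiv ℝ g x) hv]
    rw [MeasureTheory.integral_finsetSum _ fun i _ => (hdetInt i).mul_const _]
    simp_rw [MeasureTheory.integral_mul_const, hdet]
    rw [← Finset.mul_sum, ← Polynomial.eval_finsetSum,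
      Lagrange.sum_basis hv.injOn Finset.univ_nonempty]
    simp
  have hpos : 0 < MeasureTheory.volume.real B := by
    rw [MeasureTheory.measureReal_def]
    exact ENNReal.toReal_pos (Metric.measure_ball_pos _ _ one_pos).ne'
      MeasureTheory.measure_ball_lt_top.ne
  linarith

end NoRetraction

section Brouwer

theorem brouwer_closedBall {E : Type*} [NormedAddCommGroup E] [InnerProductSpace ℝ E]
    [FiniteDimensional ℝ E] {f : E → E}
    (hf : ContinuousOn f (Metric.closedBall 0 1))
    (hm : MapsTo f (Metric.closedBall 0 1) (Metric.closedBall 0 1)) :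
    ∃ x ∈ Metric.closedBall (0 : E) 1, f x = x := by
  borelize E
  by_contra! hne
  set D := Metric.closedBall (0 : E) 1
  let P : E → E := fun x => (max 1 ‖x‖)⁻¹ • x
  have hPc : Continuous P := by
    refine Continuous.smul (Continuous.inv₀ (by fun_prop) fun x => ?_) continuous_id
    positivity
  have hPD : ∀ x, P x ∈ D := by
    intro x
    have : ‖P x‖ ≤ 1 := by
      rw [norm_smul, norm_inv, Real.norm_of_nonneg (by positivity), inv_mul_le_iff₀ (by positivity),
        mul_one]
      exact le_max_right _ _
    simpa [D] using this
  have hPid : ∀ x ∈ D, P x = x := by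
    intro x hx
    have : ‖x‖ ≤ 1 := by simpa [D] using hx
    simp [P, max_eq_left this]
  let F : E → E := fun x => f (P x)
  have hF : Continuous F := hf.comp_continuous hPc hPD
  have hF1 : ∀ x, ‖F x‖ ≤ 1 := fun x => by simpa [D] using hm (hPD x)
  obtain ⟨x₀, hx₀, hmin⟩ := (isCompact_closedBall (0 : E) 1).exists_isMinOn
    ⟨0, by simp⟩ (f := fun x => ‖F x - x‖) (by fun_prop)
  set δ := ‖F x₀ - x₀‖ with hδ
  have hδ0 : 0 < δ := by
    rw [hδ, norm_pos_iff, sub_ne_zero]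
    simpa [F, hPid x₀ hx₀] using hne x₀ hx₀
  obtain ⟨g₁, hg₁, hgF⟩ := hF.exists_contDiff_approx 1 (ε := fun _ => δ / 4) continuous_const
    (fun _ => by positivity)
  let ε := δ / 4
  have hε : 0 < ε := by positivity
  let g : E → E := fun x => (1 + ε)⁻¹ • g₁ x
  have hgF' : ∀ x, ‖g₁ x - F x‖ < ε := fun x => by
    rw [← dist_eq_norm]; exact hgF.1 x
  have hg1 : ∀ x, ‖g₁ x‖ < 1 + ε := fun x => by
    calc ‖g₁ x‖ = ‖F x + (g₁ x - F x)‖ := by congr 1; abel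
      _ ≤ ‖F x‖ + ‖g₁ x - F x‖ := norm_add_le _ _
      _ < 1 + ε := add_lt_add_of_le_of_lt (hF1 x) (hgF' x)
  have hg : ∀ x, ‖g x‖ < 1 := fun x => by
    rw [norm_smul, norm_inv, Real.norm_of_nonneg (by positivity), inv_mul_lt_iff₀ (by positivity),
      mul_one]
    exact hg1 x
  have hgg : ∀ x, ‖g₁ x - g x‖ < ε := fun x => by
    have : g₁ x - g x = ε • g x := by
      have h1 : g₁ x = (1 + ε) • g x := by
        simp only [g, smul_smul]
        rw [mul_inv_cancel₀ (by positivity), one_smul]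
      rw [h1, add_smul, one_smul]; abel
    rw [this, norm_smul, Real.norm_of_nonneg hε.le]
    nlinarith [hg x]
  have hgne : ∀ x ∈ D, x - g x ≠ 0 := by
    intro x hx h0
    have h1 : δ ≤ ‖F x - x‖ := hmin hx
    have h2 : F x - x = (g₁ x - g x) - (g₁ x - F x) - (x - g x) := by abel
    rw [h2, h0, sub_zero] at h1
    have h3 := norm_sub_le (g₁ x - g x) (g₁ x - F x)
    have := hgg x
    have := hgF' x
    simp only [ε] at *
    linarith
  have hgs : ContDiff ℝ 1 g := hg₁.const_smul _
  let u : E → E := fun x => x - g x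
  have hu : ContDiff ℝ 1 u := contDiff_id.sub hgs
  let d : E → ℝ := fun x => (inner ℝ x (u x)) ^ 2 + ‖u x‖ ^ 2 * (1 - ‖x‖ ^ 2)
  have hinner : ContDiff ℝ 1 fun x => inner ℝ x (u x) := contDiff_id.inner ℝ hu
  have hd : ContDiff ℝ 1 d :=
    (hinner.pow 2).add ((hu.norm_sq ℝ).mul (contDiff_const.sub (contDiff_id.norm_sq ℝ)))
  have hsph : ∀ x, ‖x‖ = 1 → 0 < inner ℝ x (u x) := by
    intro x hx
    have h1 : inner ℝ x (u x) = 1 - inner ℝ x (g x) := by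
      simp [u, inner_sub_right, hx]
    have h2 := real_inner_le_norm x (g x)
    rw [hx, one_mul] at h2
    rw [h1]; linarith [hg x]
  have hu0 : ∀ x ∈ D, 0 < ‖u x‖ ^ 2 := fun x hx => by
    have := norm_pos_iff.2 (hgne x hx); positivity
  have hdpos : ∀ x ∈ D, 0 < d x := by
    intro x hx
    have hx1 : ‖x‖ ≤ 1 := by simpa [D] using hx
    rcases hx1.lt_or_eq with h | h
    · have : 0 < 1 - ‖x‖ ^ 2 := by nlinarith [norm_nonneg x]
      have := mul_pos (hu0 x hx) this
      simp only [d]; positivity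
    · have := hsph x h
      simp only [d, h]; norm_num; positivity
  let τ : E → ℝ := fun x => (-inner ℝ x (u x) + √(d x)) / ‖u x‖ ^ 2
  refine no_contDiff_retraction (f := fun x => x + τ x • u x) ?_ ?_ ?_
  · intro x hx
    have hτ : ContDiffAt ℝ 1 τ x :=
      ((hinner.contDiffAt.neg).add (hd.contDiffAt.sqrt (hdpos x hx).ne')).div
        (hu.norm_sq ℝ).contDiffAt (hu0 x hx).ne'
    exact contDiffAt_id.add (hτ.smul hu.contDiffAt)
  · intro x hx
    have h1 : ‖x + τ x • u x‖ ^ 2 = 1 := by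
      rw [norm_add_sq_real, norm_smul, inner_smul_right, mul_pow, Real.norm_eq_abs, sq_abs]
      have hq : √(d x) ^ 2 = d x := Real.sq_sqrt (hdpos x hx).le
      have hτ : τ x * ‖u x‖ ^ 2 = -inner ℝ x (u x) + √(d x) :=
        div_mul_cancel₀ _ (hu0 x hx).ne'
      have h3 : ‖u x‖ ^ 2 * (‖x‖ ^ 2 + 2 * (τ x * inner ℝ x (u x)) + τ x ^ 2 * ‖u x‖ ^ 2 - 1) = 0 := by
        calc _ = (τ x * ‖u x‖ ^ 2 + inner ℝ x (u x)) ^ 2 - d x := by simp only [d]; ring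
          _ = 0 := by rw [hτ]; linear_combination hq
      have := (mul_eq_zero.1 h3).resolve_left (hu0 x hx).ne'
      linarith
    have h2 : 0 ≤ ‖x + τ x • u x‖ := norm_nonneg _
    nlinarith
  · intro x hx
    have hx1 : ‖x‖ = 1 := by simpa using hx
    have h1 : τ x = 0 := by
      simp [τ, d, hx1, Real.sqrt_sq (hsph x hx1).le]
    simp [h1]

variable {ι : Type*} [Fintype ι]

theorem exists_continuous_retraction_stdSimplex [Nonempty ι] :
    ∃ r : (ι → ℝ) → (ι → ℝ), Continuous r ∧ (∀ x, r x ∈ stdSimplex ℝ ι) ∧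
      ∀ x ∈ stdSimplex ℝ ι, r x = x := by
  let S : (ι → ℝ) → ℝ := fun x => ∑ i, max 0 (x i)
  have hS : Continuous S := by fun_prop
  refine ⟨fun x i => (max 0 (x i) + max 0 (1 - S x) / Fintype.card ι) / max 1 (S x), ?_, ?_, ?_⟩
  · refine continuous_pi fun i => Continuous.div (by fun_prop) (by fun_prop) fun x => ?_
    positivity
  · intro x
    refine ⟨fun i => by positivity, ?_⟩
    rw [← Finset.sum_div, Finset.sum_add_distrib, div_eq_one_iff_eq (by positivity)]
    have : ∑ _i : ι, max 0 (1 - S x) / Fintype.card ι = max 0 (1 - S x) := by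
      simp [mul_div_cancel₀]
    rw [this]
    change S x + _ = _
    rcases le_total (S x) 1 with h | h
    · rw [max_eq_right (by linarith), max_eq_left h]; ring
    · rw [max_eq_left (by linarith), max_eq_right h]; ring
  · intro x hx
    have h1 : S x = 1 := by
      rw [← hx.2]; exact Finset.sum_congr rfl fun i _ => max_eq_right (hx.1 i)
    ext i
    simp [h1, hx.1 i]

theorem brouwer_stdSimplex [Nonempty ι] {f : (ι → ℝ) → (ι → ℝ)}
    (hf : ContinuousOn f (stdSimplex ℝ ι)) (hm : MapsTo f (stdSimplex ℝ ι) (stdSimplex ℝ ι)) :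
    ∃ x ∈ stdSimplex ℝ ι, f x = x := by
  obtain ⟨r, hr, hrm, hrid⟩ := exists_continuous_retraction_stdSimplex (ι := ι)
  let F : EuclideanSpace ℝ ι → EuclideanSpace ℝ ι := fun x => WithLp.toLp 2 (f (r x.ofLp))
  have hF : Continuous F := (PiLp.continuous_toLp 2 _).comp
    (hf.comp_continuous (hr.comp (PiLp.continuous_ofLp 2 _)) fun x => hrm _)
  obtain ⟨x, -, hx⟩ := brouwer_closedBall (f := F) hF.continuousOn (by
    intro x _
    have h := hm (hrm x.ofLp)
    have h1 : ‖F x‖ ^ 2 ≤ 1 := by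
      rw [EuclideanSpace.norm_sq_eq, ← h.2]
      refine Finset.sum_le_sum fun i _ => ?_
      have h0 := h.1 i
      have h1 : f (r x.ofLp) i ≤ 1 := by
        rw [← h.2]; exact Finset.single_le_sum (fun j _ => h.1 j) (Finset.mem_univ i)
      rw [Real.norm_eq_abs, sq_abs]
      change f (r x.ofLp) i ^ 2 ≤ f (r x.ofLp) i
      nlinarith
    have : ‖F x‖ ≤ 1 := by nlinarith [norm_nonneg (F x)]
    simpa using this)
  have hx' : f (r x.ofLp) = x.ofLp := congrArg WithLp.ofLp hx
  have hxs : x.ofLp ∈ stdSimplex ℝ ι := hx' ▸ hm (hrm x.ofLp)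
  exact ⟨x.ofLp, hxs, by rwa [hrid _ hxs] at hx'⟩

end Brouwer

section Schauder

variable {E : Type*} [AddCommGroup E] [Module ℝ E] [TopologicalSpace E] [IsTopologicalAddGroup E]
  [ContinuousSMul ℝ E] {S : Set E} {f : E → E}

theorem exists_approx_fixed_point (hS : IsCompact S) (hconv : Convex ℝ S) (hne : S.Nonempty)
    (hf : ContinuousOn f S) (hm : MapsTo f S S) (F : Finset (E →L[ℝ] ℝ)) :
    ∃ x ∈ S, ∀ l ∈ F, |l (f x - x)| ≤ 1 := by
  classical
  let p : E → ℝ := fun v => ∑ l ∈ F, |l v|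
  have hp : Continuous p := by fun_prop
  have hp0 : p 0 = 0 := by simp [p]
  obtain ⟨t, htS, hcov⟩ := hS.elim_nhds_subcover (fun c => {x | p (x - c) < 1}) (fun c _ => by
    have : IsOpen {x | p (x - c) < 1} := isOpen_lt (by fun_prop) continuous_const
    exact this.mem_nhds (by simp [hp0]))
  obtain ⟨x₀, hx₀⟩ := hne
  have : Nonempty t := by
    have := hcov hx₀
    simp only [mem_iUnion] at this
    obtain ⟨c, hc, -⟩ := this
    exact ⟨⟨c, hc⟩⟩
  let φ : t → E → ℝ := fun c x => max 0 (1 - p (x - c))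
  have hφc : ∀ c, Continuous (φ c) := fun c => by simp only [φ]; fun_prop
  have hφ0 : ∀ c x, 0 ≤ φ c x := fun c x => le_max_left _ _
  let Φ : E → ℝ := fun x => ∑ c, φ c x
  have hΦ : ∀ x ∈ S, 0 < Φ x := by
    intro x hx
    have := hcov hx
    simp only [mem_iUnion] at this
    obtain ⟨c, hc, hxc⟩ := this
    refine Finset.sum_pos' (fun c _ => hφ0 c x) ⟨⟨c, hc⟩, Finset.mem_univ _, ?_⟩
    have : p (x - c) < 1 := hxc
    simp only [φ]
    exact lt_max_of_lt_right (by linarith)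
  let L : (t → ℝ) → E := fun w => ∑ c, w c • (c : E)
  have hLc : Continuous L := by fun_prop
  have hLS : ∀ w ∈ stdSimplex ℝ t, L w ∈ S := fun w hw =>
    hconv.sum_mem (fun c _ => hw.1 c) hw.2 fun c _ => htS c c.2
  let G : (t → ℝ) → (t → ℝ) := fun w c => φ c (f (L w)) / Φ (f (L w))
  obtain ⟨w, hw, hGw⟩ := brouwer_stdSimplex (f := G) (by
    refine continuousOn_pi.2 fun c => ?_
    have h1 : ContinuousOn (fun w => f (L w)) (stdSimplex ℝ t) :=
      hf.comp hLc.continuousOn hLS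
    have hΦc : Continuous Φ := by fun_prop
    exact ((hφc c).comp_continuousOn h1).div (hΦc.comp_continuousOn h1)
      fun w hw => (hΦ _ (hm (hLS w hw))).ne') (by
    intro w hw
    refine ⟨fun c => div_nonneg (hφ0 _ _) (hΦ _ (hm (hLS w hw))).le, ?_⟩
    change ∑ c, φ c (f (L w)) / Φ (f (L w)) = 1
    rw [← Finset.sum_div]
    exact div_self (hΦ _ (hm (hLS w hw))).ne')
  refine ⟨L w, hLS w hw, fun l hl => ?_⟩
  set y := f (L w) with hy
  have hyS : y ∈ S := hm (hLS w hw)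
  have h1 : y - L w = ∑ c, w c • (y - (c : E)) := by
    simp only [smul_sub, Finset.sum_sub_distrib, ← Finset.sum_smul, hw.2, one_smul, L]
  have h2 : ∀ c, w c * |l (y - (c : E))| ≤ w c * 1 := by
    intro c
    have hwc : w c = φ c y / Φ y := (congrFun hGw c).symm
    rcases (hφ0 c y).eq_or_lt with h | h
    · rw [hwc, ← h]; simp
    · have h3 : p (y - c) < 1 := by
        by_contra hge
        push Not at hge
        simp only [φ] at h
        rw [max_eq_left (by linarith)] at h
        exact lt_irrefl _ h
      have h4 : |l (y - (c : E))| ≤ p (y - c) :=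
        Finset.single_le_sum (f := fun l : E →L[ℝ] ℝ => |l (y - (c : E))|)
          (fun _ _ => abs_nonneg _) hl
      exact mul_le_mul_of_nonneg_left (h4.trans h3.le) (hw.1 c)
  rw [h1, map_sum]
  calc |∑ c, l (w c • (y - (c : E)))| ≤ ∑ c, |l (w c • (y - (c : E)))| :=
        Finset.abs_sum_le_sum_abs _ _
    _ = ∑ c, w c * |l (y - (c : E))| := by
        refine Finset.sum_congr rfl fun c _ => ?_
        rw [map_smul, smul_eq_mul, abs_mul, abs_of_nonneg (hw.1 c)]
    _ ≤ ∑ c, w c * 1 := Finset.sum_le_sum fun c _ => h2 c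
    _ = 1 := by simp only [mul_one]; exact hw.2

theorem schauder_tychonoff [LocallyConvexSpace ℝ E] [T2Space E]
    (hS : IsCompact S) (hconv : Convex ℝ S) (hne : S.Nonempty)
    (hf : ContinuousOn f S) (hm : MapsTo f S S) : ∃ x ∈ S, f x = x := by
  obtain ⟨x, hxS, hx⟩ := hS.inter_iInter_nonempty
    (fun l : E →L[ℝ] ℝ => S ∩ {x | |l (f x - x)| ≤ 1}) (fun l => by
      have hc : ContinuousOn (fun x => |l (f x - x)|) S := by fun_prop
      exact hc.preimage_isClosed_of_isClosed hS.isClosed isClosed_Iic) (fun F => by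
      obtain ⟨x, hx, h⟩ := exists_approx_fixed_point hS hconv hne hf hm F
      exact ⟨x, hx, mem_iInter₂.2 fun l hl => ⟨hx, h l hl⟩⟩)
  refine ⟨x, hxS, ?_⟩
  by_contra hne'
  obtain ⟨l, hl⟩ := SeparatingDual.exists_ne_zero (R := ℝ) (sub_ne_zero.2 hne')
  have h1 := (mem_iInter.1 hx ((2 / l (f x - x)) • l)).2
  simp [abs_div] at h1
  have h2 : l (f x) - l x ≠ 0 := by rwa [← map_sub]
  rw [div_mul_cancel₀ _ (abs_ne_zero.2 h2)] at h1
  norm_num at h1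

end Schauder

section Pick

open Filter Topology

theorem normSq_sub_conj (z w : ℂ) :
    ‖z - (starRingEnd ℂ) w‖ ^ 2 = ‖z - w‖ ^ 2 + 4 * z.im * w.im := by
  rw [← Complex.normSq_eq_norm_sq, ← Complex.normSq_eq_norm_sq, Complex.normSq_apply,
    Complex.normSq_apply]
  simp; ring

theorem schwarz_pick_of_pos {f : ℂ → ℂ} (hf : DifferentiableOn ℂ f UpperHalf)
    (him : ∀ z ∈ UpperHalf, 0 < (f z).im) {z w : ℂ} (hz : z ∈ UpperHalf) (hw : w ∈ UpperHalf) :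
    ‖f z - f w‖ ^ 2 * (z.im * w.im) ≤ ‖z - w‖ ^ 2 * ((f z).im * (f w).im) := by
  have hz0 : 0 < z.im := hz
  have hw0 : 0 < w.im := hw
  have hfz := him z hz
  have hfw := him w hw
  have hne1 : ∀ ζ ∈ Metric.ball (0 : ℂ) 1, (1 - ζ) ≠ 0 := by
    intro ζ hζ h
    have : ζ = 1 := (sub_eq_zero.1 h).symm
    simp [this] at hζ
  let C : ℂ → ℂ := fun ζ => (w - (starRingEnd ℂ) w * ζ) / (1 - ζ)
  have hCm : MapsTo C (Metric.ball 0 1) UpperHalf := by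
    intro ζ hζ
    have h1 : ‖ζ‖ < 1 := by simpa using hζ
    have h2 : (C ζ).im = w.im * (1 - normSq ζ) / normSq (1 - ζ) := by
      simp only [C, Complex.div_im]
      simp [Complex.normSq_apply]
      ring
    have h3 : normSq ζ < 1 := by
      rw [Complex.normSq_eq_norm_sq]; nlinarith [norm_nonneg ζ]
    have h4 : 0 < normSq (1 - ζ) := normSq_pos.2 (hne1 ζ hζ)
    change 0 < (C ζ).im
    rw [h2]
    exact div_pos (mul_pos hw0 (by linarith)) h4
  have hCd : DifferentiableOn ℂ C (Metric.ball 0 1) :=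
    DifferentiableOn.div (by fun_prop) (by fun_prop) hne1
  have hden : ∀ u ∈ UpperHalf, f u - (starRingEnd ℂ) (f w) ≠ 0 := by
    intro u hu h
    have := congrArg Complex.im h
    simp at this
    linarith [him u hu]
  let g : ℂ → ℂ := fun ζ => (f (C ζ) - f w) / (f (C ζ) - (starRingEnd ℂ) (f w))
  have hfC : DifferentiableOn ℂ (fun ζ => f (C ζ)) (Metric.ball 0 1) := hf.comp hCd hCm
  have hgd : DifferentiableOn ℂ g (Metric.ball 0 1) :=
    (hfC.sub_const _).div (hfC.sub_const _) fun ζ hζ => hden _ (hCm hζ)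
  have hgm : MapsTo g (Metric.ball 0 1) (Metric.closedBall 0 1) := by
    intro ζ hζ
    have h1 := him _ (hCm hζ)
    have h2 := normSq_sub_conj (f (C ζ)) (f w)
    have h3 : ‖f (C ζ) - f w‖ ≤ ‖f (C ζ) - (starRingEnd ℂ) (f w)‖ := by
      apply le_of_sq_le_sq _ (norm_nonneg _)
      rw [h2]; nlinarith [mul_pos h1 hfw]
    have : ‖g ζ‖ ≤ 1 := by
      rw [norm_div]; exact div_le_one_of_le₀ h3 (norm_nonneg _)
    simpa using this
  have hg0 : g 0 = 0 := by simp [g, C]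
  have hzw : z - (starRingEnd ℂ) w ≠ 0 := by
    intro h
    have := congrArg Complex.im h
    simp at this
    linarith
  let ζ := (z - w) / (z - (starRingEnd ℂ) w)
  have hA := normSq_sub_conj z w
  have hB := normSq_sub_conj (f z) (f w)
  have hζ : ‖ζ‖ < 1 := by
    rw [norm_div, div_lt_one (norm_pos_iff.2 hzw)]
    apply lt_of_pow_lt_pow_left₀ 2 (norm_nonneg _)
    rw [hA]; nlinarith [mul_pos hz0 hw0]
  have hCζ : C ζ = z := by
    have hww : w - (starRingEnd ℂ) w ≠ 0 := by
      intro h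
      have := congrArg Complex.im h
      simp at this
      linarith
    have h1 : 1 - ζ = (w - (starRingEnd ℂ) w) / (z - (starRingEnd ℂ) w) := by
      simp only [ζ]; field_simp; ring
    have h2 : w - (starRingEnd ℂ) w * ζ =
        z * (w - (starRingEnd ℂ) w) / (z - (starRingEnd ℂ) w) := by
      simp only [ζ]; field_simp; ring
    simp only [C]
    rw [h1, h2]; field_simp
  have key := Complex.norm_le_norm_of_mapsTo_ball hgd hgm hg0 hζ
  simp only [g, hCζ] at key
  simp only [ζ, norm_div] at key
  have hpos1 := norm_pos_iff.2 (hden z hz)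
  have hpos2 := norm_pos_iff.2 hzw
  rw [div_le_div_iff₀ hpos1 hpos2] at key
  have hsq := pow_le_pow_left₀ (by positivity) key 2
  rw [mul_pow, mul_pow, hA, hB] at hsq
  nlinarith

theorem schwarz_pick {f : ℂ → ℂ} (hf : DifferentiableOn ℂ f UpperHalf)
    (him : ∀ z ∈ UpperHalf, 0 ≤ (f z).im) {z w : ℂ} (hz : z ∈ UpperHalf) (hw : w ∈ UpperHalf) :
    ‖f z - f w‖ ^ 2 * (z.im * w.im) ≤ ‖z - w‖ ^ 2 * ((f z).im * (f w).im) := by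
  have h1 : ∀ δ > (0 : ℝ), ‖f z - f w‖ ^ 2 * (z.im * w.im) ≤
      ‖z - w‖ ^ 2 * (((f z).im + δ) * ((f w).im + δ)) := by
    intro δ hδ
    have := schwarz_pick_of_pos (f := fun z => f z + δ * I) (hf.add_const _) (fun u hu => by
      have := him u hu
      simp; linarith) hz hw
    simpa using this
  have h2 : Tendsto (fun δ : ℝ => ‖z - w‖ ^ 2 * (((f z).im + δ) * ((f w).im + δ))) (𝓝[>] 0)
      (𝓝 (‖z - w‖ ^ 2 * (((f z).im + 0) * ((f w).im + 0)))) :=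
    (Continuous.tendsto (by fun_prop) 0).mono_left nhdsWithin_le_nhds
  simp only [add_zero] at h2
  exact ge_of_tendsto h2 (eventually_nhdsWithin_of_forall h1)

theorem isOpen_Omega (s t : ℝ) : IsOpen (Omega s t) := by
  have : Omega s t = {z | z.im ≠ 0} ∪ {z | s < z.re ∧ z.re < t} := by
    ext z
    simp only [Omega, UpperHalf, LowerHalf, mem_union, mem_ofPred_eq, mem_image, mem_Ioo]
    constructor
    · rintro ((h | h) | ⟨x, hx, rfl⟩)
      · exact Or.inl h.ne'
      · exact Or.inl h.ne
      · exact Or.inr (by simpa using hx)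
    · rintro (h | h)
      · exact Or.inl (h.lt_or_gt.symm)
      · rcases lt_trichotomy z.im 0 with h0 | h0 | h0
        · exact Or.inl (Or.inr h0)
        · exact Or.inr ⟨z.re, h, Complex.ext rfl (by simp [h0])⟩
        · exact Or.inl (Or.inl h0)
  rw [this]
  refine IsOpen.union (isOpen_ne_fun Complex.continuous_im continuous_const) ?_
  exact (isOpen_lt continuous_const Complex.continuous_re).inter
    (isOpen_lt Complex.continuous_re continuous_const)

theorem ofReal_mem_Omega {s t x : ℝ} : (x : ℂ) ∈ Omega s t ↔ x ∈ Ioo s t := by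
  simp [Omega, UpperHalf, LowerHalf]

theorem mem_Omega_of_im_ne {s t : ℝ} {z : ℂ} (h : z.im ≠ 0) : z ∈ Omega s t :=
  Or.inl (h.lt_or_gt.symm)

theorem mem_Omega_iff {s t : ℝ} {z : ℂ} : z ∈ Omega s t ↔ z.im ≠ 0 ∨ z.re ∈ Ioo s t := by
  by_cases h : z.im = 0
  · have : z = (z.re : ℂ) := Complex.ext rfl (by simp [h])
    rw [this, ofReal_mem_Omega]; simp
  · simp [h, mem_Omega_of_im_ne h]

theorem conj_mem_Omega {s t : ℝ} {z : ℂ} (hz : z ∈ Omega s t) :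
    (starRingEnd ℂ) z ∈ Omega s t := by
  rw [mem_Omega_iff] at *; simpa using hz

theorem Omega_mono {s t s' t' : ℝ} (hs : s' ≤ s) (ht : t ≤ t') : Omega s t ⊆ Omega s' t' := by
  intro z hz
  rw [mem_Omega_iff] at *
  exact hz.imp_right fun h => ⟨hs.trans_lt h.1, h.2.trans_le ht⟩

theorem Herglotzian.im_ofReal {s t : ℝ} {f : ℂ → ℂ} (hf : Herglotzian s t f) {x : ℝ}
    (hx : x ∈ Ioo s t) : (f x).im = 0 := by
  have := hf.2.1 x (ofReal_mem_Omega.2 hx)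
  rw [Complex.conj_ofReal] at this
  exact Complex.conj_eq_iff_im.1 this.symm

theorem Herglotzian.eq_ofReal {s t : ℝ} {f : ℂ → ℂ} (hf : Herglotzian s t f) {x : ℝ}
    (hx : x ∈ Ioo s t) : f x = ((f x).re : ℂ) :=
  Complex.ext rfl (by simp [hf.im_ofReal hx])

theorem Herglotzian.differentiableAt {s t : ℝ} {f : ℂ → ℂ} (hf : Herglotzian s t f) {z : ℂ}
    (hz : z ∈ Omega s t) : DifferentiableAt ℂ f z :=
  hf.1.differentiableAt ((isOpen_Omega s t).mem_nhds hz)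

theorem AntiHerglotzian.neg {s t : ℝ} {f : ℂ → ℂ} (hf : AntiHerglotzian s t f) :
    Herglotzian s t (fun z => -f z) :=
  ⟨hf.1.neg, fun z hz => by simp [hf.2.1 z hz], fun z hz h => by simpa using hf.2.2 z hz h⟩

theorem Herglotzian.neg {s t : ℝ} {f : ℂ → ℂ} (hf : Herglotzian s t f) :
    AntiHerglotzian s t (fun z => -f z) :=
  ⟨hf.1.neg, fun z hz => by simp [hf.2.1 z hz], fun z hz h => by simpa using hf.2.2 z hz h⟩

theorem upperHalf_subset_Omega (s t : ℝ) : UpperHalf ⊆ Omega s t :=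
  fun _ hz => Or.inl (Or.inl hz)

theorem Herglotzian.schwarz_pick {s t : ℝ} {f : ℂ → ℂ} (hf : Herglotzian s t f) {z w : ℂ}
    (hz : z ∈ UpperHalf) (hw : w ∈ UpperHalf) :
    ‖f z - f w‖ ^ 2 * (z.im * w.im) ≤ ‖z - w‖ ^ 2 * ((f z).im * (f w).im) :=
  _root_.schwarz_pick (hf.1.mono (upperHalf_subset_Omega s t))
    (fun u hu => hf.2.2 u (upperHalf_subset_Omega s t hu) hu) hz hw

theorem Herglotzian.tendsto_im_div {s t : ℝ} {f : ℂ → ℂ} (hf : Herglotzian s t f) {x : ℝ}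
    (hx : x ∈ Ioo s t) :
    Tendsto (fun ε : ℝ => (f (x + ε * I)).im / ε) (𝓝[>] 0) (𝓝 (deriv f x).re) := by
  have h1 := (hf.differentiableAt (ofReal_mem_Omega.2 hx)).hasDerivAt
  have h2 : HasDerivAt (fun ε : ℂ => x + ε * I) I ((0 : ℝ) : ℂ) := by
    simpa using ((hasDerivAt_id ((0:ℝ):ℂ)).mul_const I).const_add (x : ℂ)
  have h3 : HasDerivAt (fun ε : ℂ => f (x + ε * I)) (deriv f x * I) ((0 : ℝ) : ℂ) :=
    HasDerivAt.comp (h₂ := f) ((0:ℝ):ℂ) (by simpa using h1) h2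
  have h4 : HasDerivAt (fun ε : ℂ => -(I * f (x + ε * I))) (deriv f x) ((0 : ℝ) : ℂ) := by
    refine (h3.const_mul I).neg.congr_deriv ?_
    linear_combination (-deriv f x) * Complex.I_sq
  have h5 := h4.real_of_complex.hasDerivWithinAt (s := Ioi 0)
  rw [hasDerivWithinAt_iff_tendsto_slope' (by simp)] at h5
  refine h5.congr' ?_
  filter_upwards [self_mem_nhdsWithin] with ε hε
  simp [slope_def_field, hf.im_ofReal hx]

theorem tendsto_add_mul_I (x : ℝ) : Tendsto (fun ε : ℝ => (x : ℂ) + ε * I) (𝓝[>] 0) (𝓝 x) := by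
  have : Tendsto (fun ε : ℝ => (x : ℂ) + ε * I) (𝓝[>] 0) (𝓝 ((x : ℂ) + (0 : ℝ) * I)) :=
    (Continuous.tendsto (by fun_prop) 0).mono_left nhdsWithin_le_nhds
  simpa using this

theorem Herglotzian.tendsto_ofReal {s t : ℝ} {f : ℂ → ℂ} (hf : Herglotzian s t f) {x : ℝ}
    (hx : x ∈ Ioo s t) :
    Tendsto (fun ε : ℝ => f (x + ε * I)) (𝓝[>] 0) (𝓝 (f x)) :=
  ((hf.differentiableAt (ofReal_mem_Omega.2 hx)).continuousAt.tendsto).comp (tendsto_add_mul_I x)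

theorem Herglotzian.schwarz_pick_boundary {s t : ℝ} {f : ℂ → ℂ} (hf : Herglotzian s t f) {z : ℂ}
    (hz : z ∈ UpperHalf) {x : ℝ} (hx : x ∈ Ioo s t) :
    ‖f z - f x‖ ^ 2 * z.im ≤ ‖z - x‖ ^ 2 * ((f z).im * (deriv f x).re) := by
  have h1 : Tendsto (fun ε : ℝ => ‖f z - f (x + ε * I)‖ ^ 2 * z.im) (𝓝[>] 0)
      (𝓝 (‖f z - f x‖ ^ 2 * z.im)) :=
    (((tendsto_const_nhds.sub (hf.tendsto_ofReal hx)).norm).pow 2).mul_const _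
  have h2 : Tendsto (fun ε : ℝ => ‖z - (x + ε * I)‖ ^ 2 *
      ((f z).im * ((f (x + ε * I)).im / ε))) (𝓝[>] 0)
      (𝓝 (‖z - x‖ ^ 2 * ((f z).im * (deriv f x).re))) :=
    (((tendsto_const_nhds.sub (tendsto_add_mul_I x)).norm).pow 2).mul
      (tendsto_const_nhds.mul (hf.tendsto_im_div hx))
  refine le_of_tendsto_of_tendsto h1 h2 ?_
  filter_upwards [self_mem_nhdsWithin] with ε hε
  have hε0 : (0 : ℝ) < ε := hε
  have h := hf.schwarz_pick hz (w := x + ε * I) (by simpa [UpperHalf] using hε0)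
  simp only [add_im, ofReal_im, mul_im, ofReal_re, I_im, mul_one, I_re, mul_zero, add_zero,
    zero_add] at h
  have : ‖z - (x + ε * I)‖ ^ 2 * ((f z).im * ((f (x + ε * I)).im / ε)) =
      ‖z - (x + ε * I)‖ ^ 2 * ((f z).im * (f (x + ε * I)).im) / ε := by ring
  rw [this, le_div_iff₀ hε0]
  linarith

/-- The real-variable consequences of the Schwarz-Pick inequality on an interval of reality. -/
def PickOn (s t : ℝ) (F F' : ℝ → ℝ) : Prop :=
  (∀ x ∈ Ioo s t, HasDerivAt F (F' x) x) ∧ (∀ x ∈ Ioo s t, 0 ≤ F' x) ∧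
    ∀ x ∈ Ioo s t, ∀ y ∈ Ioo s t, (F x - F y) ^ 2 ≤ (x - y) ^ 2 * (F' x * F' y)

theorem Herglotzian.pickOn {s t : ℝ} {f : ℂ → ℂ} (hf : Herglotzian s t f) :
    PickOn s t (fun x => (f x).re) (fun x => (deriv f x).re) := by
  refine ⟨fun x hx =>
    (hf.differentiableAt (ofReal_mem_Omega.2 hx)).hasDerivAt.real_of_complex, fun x hx => ?_,
    fun x hx y hy => ?_⟩
  · refine ge_of_tendsto (hf.tendsto_im_div hx) ?_
    filter_upwards [self_mem_nhdsWithin] with ε hε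
    have hε0 : (0 : ℝ) < ε := hε
    have : (x + ε * I : ℂ) ∈ UpperHalf := by simpa [UpperHalf] using hε0
    exact div_nonneg (hf.2.2 _ (upperHalf_subset_Omega s t this) this) hε0.le
  · have h1 : Tendsto (fun ε : ℝ => ‖f (x + ε * I) - f y‖ ^ 2) (𝓝[>] 0)
        (𝓝 (‖f x - f y‖ ^ 2)) :=
      (((hf.tendsto_ofReal hx).sub_const _).norm).pow 2
    have h2 : Tendsto (fun ε : ℝ => ‖(x + ε * I) - (y : ℂ)‖ ^ 2 *
        (((f (x + ε * I)).im / ε) * (deriv f y).re)) (𝓝[>] 0)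
        (𝓝 (‖(x : ℂ) - y‖ ^ 2 * ((deriv f x).re * (deriv f y).re))) :=
      ((((tendsto_add_mul_I x).sub_const _).norm).pow 2).mul
        ((hf.tendsto_im_div hx).mul_const _)
    have h3 := le_of_tendsto_of_tendsto h1 h2 (by
      filter_upwards [self_mem_nhdsWithin] with ε hε
      have hε0 : (0 : ℝ) < ε := hε
      have h := hf.schwarz_pick_boundary (z := x + ε * I) (by simpa [UpperHalf] using hε0) hy
      simp only [add_im, ofReal_im, mul_im, ofReal_re, I_im, mul_one, I_re, mul_zero, add_zero,
        zero_add] at h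
      have : ‖(x + ε * I) - (y : ℂ)‖ ^ 2 * (((f (x + ε * I)).im / ε) * (deriv f y).re) =
        ‖(x + ε * I) - (y : ℂ)‖ ^ 2 * ((f (x + ε * I)).im * (deriv f y).re) / ε := by ring
      rw [this, le_div_iff₀ hε0]
      exact h)
    rw [hf.eq_ofReal hx, hf.eq_ofReal hy, ← ofReal_sub, ← ofReal_sub, Complex.norm_real,
      Complex.norm_real, Real.norm_eq_abs, Real.norm_eq_abs, sq_abs, sq_abs] at h3
    simpa using h3

end Pick

section PickReal

open Filter Topology

variable {s t : ℝ} {F F' : ℝ → ℝ}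

theorem PickOn.pos_or_const (h : PickOn s t F F') :
    (∀ x ∈ Ioo s t, 0 < F' x) ∨ ∀ x ∈ Ioo s t, ∀ y ∈ Ioo s t, F x = F y := by
  by_cases hp : ∀ x ∈ Ioo s t, 0 < F' x
  · exact Or.inl hp
  · push Not at hp
    obtain ⟨a, ha, ha0⟩ := hp
    have h0 : F' a = 0 := le_antisymm ha0 (h.2.1 a ha)
    have : ∀ x ∈ Ioo s t, F x = F a := by
      intro x hx
      have := h.2.2 x hx a ha
      rw [h0] at this
      nlinarith [sq_nonneg (F x - F a)]
    exact Or.inr fun x hx y hy => (this x hx).trans (this y hy).symm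

theorem PickOn.continuousOn (h : PickOn s t F F') : ContinuousOn F (Ioo s t) :=
  fun x hx => (h.1 x hx).continuousAt.continuousWithinAt

theorem PickOn.strictMonoOn (h : PickOn s t F F') (hp : ∀ x ∈ Ioo s t, 0 < F' x) :
    StrictMonoOn F (Ioo s t) := by
  refine strictMonoOn_of_deriv_pos (convex_Ioo s t) h.continuousOn ?_
  rw [interior_Ioo]
  intro x hx
  rw [(h.1 x hx).deriv]; exact hp x hx

theorem PickOn.strictMonoOn_of_ne (h : PickOn s t F F') {x y : ℝ} (hx : x ∈ Ioo s t)
    (hy : y ∈ Ioo s t) (hxy : F x ≠ F y) : StrictMonoOn F (Ioo s t) := by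
  rcases h.pos_or_const with hp | hc
  · exact h.strictMonoOn hp
  · exact absurd (hc x hx y hy) hxy

theorem PickOn.antitoneOn_aux (h : PickOn s t F F') (hs : StrictMonoOn F (Ioo s t)) {x : ℝ}
    (hx : x ∈ Ioo s t) :
    AntitoneOn (fun y => F' x / (F y - F x) - 1 / (y - x)) (Ioo x t) := by
  have hsub : ∀ y ∈ Ioo x t, y ∈ Ioo s t := fun y hy => ⟨hx.1.trans hy.1, hy.2⟩
  have hd : ∀ y ∈ Ioo x t, HasDerivAt (fun y => F' x / (F y - F x) - 1 / (y - x))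
      (-(F' x * F' y) / (F y - F x) ^ 2 + 1 / (y - x) ^ 2) y := by
    intro y hy
    have h1 : F y - F x ≠ 0 := (sub_pos.2 (hs hx (hsub y hy) hy.1)).ne'
    have h2 : y - x ≠ 0 := (sub_pos.2 hy.1).ne'
    have h3 := ((hasDerivAt_const y (F' x)).fun_div ((h.1 y (hsub y hy)).sub_const (F x)) h1).fun_sub
      ((hasDerivAt_const y (1:ℝ)).fun_div ((hasDerivAt_id y).sub_const x) h2)
    refine h3.congr_deriv ?_
    simp; ring
  refine antitoneOn_of_deriv_nonpos (convex_Ioo x t)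
    (fun y hy => (hd y hy).continuousAt.continuousWithinAt) ?_ ?_
  · rw [interior_Ioo]
    exact fun y hy => (hd y hy).differentiableAt.differentiableWithinAt
  · rw [interior_Ioo]
    intro y hy
    rw [(hd y hy).deriv]
    have h1 : 0 < F y - F x := (sub_pos.2 (hs hx (hsub y hy) hy.1))
    have h2 : 0 < y - x := (sub_pos.2 hy.1)
    have h3 := h.2.2 y (hsub y hy) x hx
    rw [neg_div, neg_add_nonpos_iff, div_le_div_iff₀ (by positivity) (by positivity)]
    linarith

theorem PickOn.cross_ratio (h : PickOn s t F F') {a b c d : ℝ} (ha : s < a) (hab : a < b)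
    (hbc : b < c) (hcd : c < d) (hd : d < t) :
    (d - b) * (c - a) * (F c - F b) * (F d - F a) ≤
      (F d - F b) * (F c - F a) * (c - b) * (d - a) := by
  have hmem : ∀ x, a ≤ x → x ≤ d → x ∈ Ioo s t := fun x h1 h2 =>
    ⟨ha.trans_le h1, h2.trans_lt hd⟩
  rcases h.pos_or_const with hp | hc
  swap
  · rw [hc c (hmem c (by linarith) hcd.le) b (hmem b hab.le (by linarith)),
      hc d (hmem d (by linarith) le_rfl) b (hmem b hab.le (by linarith))]
    simp
  have hs := h.strictMonoOn hp
  let G : ℝ → ℝ := fun x => Real.log (F d - F x) - Real.log (F c - F x) + Real.log (c - x) -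
    Real.log (d - x)
  have hpos : ∀ x, a ≤ x → x < c → 0 < F d - F x ∧ 0 < F c - F x ∧ 0 < c - x ∧ 0 < d - x := by
    intro x hax hxc
    have hx := hmem x hax (by linarith)
    exact ⟨sub_pos.2 (hs hx (hmem d (by linarith) le_rfl) (by linarith)),
      sub_pos.2 (hs hx (hmem c (by linarith) hcd.le) hxc), by linarith, by linarith⟩
  have hG : ∀ x, a ≤ x → x < c → HasDerivAt G
      (-F' x / (F d - F x) + F' x / (F c - F x) - 1 / (c - x) + 1 / (d - x)) x := by
    intro x hax hxc
    obtain ⟨h1, h2, h3, h4⟩ := hpos x hax hxc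
    have hFx := h.1 x (hmem x hax (by linarith))
    have := ((((hFx.const_sub (F d)).log h1.ne').fun_sub ((hFx.const_sub (F c)).log h2.ne')).fun_add
      (((hasDerivAt_id x).const_sub c).log h3.ne')).fun_sub
      (((hasDerivAt_id x).const_sub d).log h4.ne')
    refine this.congr_deriv ?_
    simp only [id]; ring
  have hmono : G a ≤ G b := by
    refine monotoneOn_of_deriv_nonneg (D := Icc a b) (convex_Icc a b)
      (fun x hx => (hG x hx.1 (by linarith [hx.2])).continuousAt.continuousWithinAt) ?_ ?_
      (left_mem_Icc.2 hab.le) (right_mem_Icc.2 hab.le) hab.le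
    · rw [interior_Icc]
      exact fun x hx => (hG x hx.1.le (by linarith [hx.2])).differentiableAt.differentiableWithinAt
    · rw [interior_Icc]
      intro x hx
      rw [(hG x hx.1.le (by linarith [hx.2])).deriv]
      have := h.antitoneOn_aux hs (hmem x hx.1.le (by linarith [hx.2])) (a := c) (b := d)
        ⟨by linarith [hx.2], by linarith⟩ ⟨by linarith [hx.2], hd⟩ hcd.le
      simp only at this
      rw [neg_div]
      linarith
  obtain ⟨a1, a2, a3, a4⟩ := hpos a le_rfl (by linarith)
  obtain ⟨b1, b2, b3, b4⟩ := hpos b hab.le hbc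
  have hL : ∀ {u v w z : ℝ}, 0 < u → 0 < v → 0 < w → 0 < z →
      Real.log u - Real.log v + Real.log w - Real.log z = Real.log (u * w / (v * z)) := by
    intro u v w z hu hv hw hz
    rw [Real.log_div (by positivity) (by positivity), Real.log_mul hu.ne' hw.ne',
      Real.log_mul hv.ne' hz.ne']
    ring
  simp only [G] at hmono
  rw [hL a1 a2 a3 a4, hL b1 b2 b3 b4, Real.log_le_log_iff (by positivity) (by positivity),
    div_le_div_iff₀ (by positivity) (by positivity)] at hmono
  linarith

theorem PickOn.cross_ratio_right (h : PickOn s t F F') {a b c : ℝ} (ha : s < a) (hab : a < b)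
    (hbc : b < c) (hct : c < t) :
    (F c - F b) * (t - b) * (c - a) ≤ (F c - F a) * (c - b) * (t - a) := by
  have hmem : ∀ x, a ≤ x → x < t → x ∈ Ioo s t := fun x h1 h2 => ⟨ha.trans_le h1, h2⟩
  rcases h.pos_or_const with hp | hc
  swap
  · rw [hc c (hmem c (by linarith) hct) b (hmem b hab.le (by linarith)),
      hc b (hmem b hab.le (by linarith)) a (hmem a le_rfl (by linarith))]
    simp
  have hs := h.strictMonoOn hp
  have key : ∀ d ∈ Ioo c t, (F c - F b) * (d - b) * (c - a) ≤ (F c - F a) * (c - b) * (d - a) := by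
    intro d hd
    have hcr := h.cross_ratio ha hab hbc hd.1 hd.2
    have hda : F b < F d := hs (hmem b hab.le (by linarith)) (hmem d (by linarith [hd.1]) hd.2)
      (by linarith [hd.1])
    have hba : F a < F b := hs (hmem a le_rfl (by linarith)) (hmem b hab.le (by linarith)) hab
    have hbc' : F b < F c := hs (hmem b hab.le (by linarith)) (hmem c (by linarith) hct) hbc
    have h0 : 0 ≤ (d - b) * (c - a) * (F c - F b) :=
      mul_nonneg (mul_nonneg (by linarith [hd.1]) (by linarith)) (by linarith)
    have h1 : (d - b) * (c - a) * (F c - F b) * (F d - F b) ≤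
        ((F c - F a) * (c - b) * (d - a)) * (F d - F b) := by
      nlinarith
    have := le_of_mul_le_mul_right h1 (by linarith)
    linarith
  have hnb : (𝓝[<] t).NeBot := inferInstance
  refine le_of_tendsto_of_tendsto (b := 𝓝[<] t)
    (f := fun d => (F c - F b) * (d - b) * (c - a))
    (g := fun d => (F c - F a) * (c - b) * (d - a)) ?_ ?_ ?_
  · exact (Continuous.tendsto (by fun_prop) t).mono_left nhdsWithin_le_nhds
  · exact (Continuous.tendsto (by fun_prop) t).mono_left nhdsWithin_le_nhds
  · filter_upwards [Ioo_mem_nhdsLT hct] with d hd using key d hd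

theorem PickOn.cross_ratio_left (h : PickOn s t F F') {a b c : ℝ} (ha : s < a) (hab : a < b)
    (hbc : b < c) (hct : c < t) :
    (F b - F a) * (b - s) * (c - a) ≤ (F c - F a) * (b - a) * (c - s) := by
  have hmem : ∀ x, s < x → x ≤ c → x ∈ Ioo s t := fun x h1 h2 => ⟨h1, h2.trans_lt hct⟩
  rcases h.pos_or_const with hp | hc
  swap
  · rw [hc c (hmem c (by linarith) le_rfl) a (hmem a ha (by linarith)),
      hc b (hmem b (by linarith) (by linarith)) a (hmem a ha (by linarith))]
    simp
  have hs := h.strictMonoOn hp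
  have key : ∀ d ∈ Ioo s a, (F b - F a) * (b - d) * (c - a) ≤ (F c - F a) * (b - a) * (c - d) := by
    intro d hd
    have hcr := h.cross_ratio hd.1 hd.2 hab hbc hct
    have hda : F d < F a := hs (hmem d hd.1 (by linarith [hd.2])) (hmem a ha (by linarith)) hd.2
    have hab' : F a < F b := hs (hmem a ha (by linarith)) (hmem b (by linarith) hbc.le) hab
    have hbc' : F b < F c := hs (hmem b (by linarith) hbc.le) (hmem c (by linarith) le_rfl) hbc
    have h0 : 0 ≤ (c - a) * (b - d) * (F b - F a) :=
      mul_nonneg (mul_nonneg (by linarith) (by linarith [hd.2])) (by linarith)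
    have h1 : (c - a) * (b - d) * (F b - F a) * (F b - F d) ≤
        ((F c - F a) * (b - a) * (c - d)) * (F b - F d) := by
      nlinarith
    have := le_of_mul_le_mul_right h1 (by linarith)
    linarith
  refine le_of_tendsto_of_tendsto (b := 𝓝[>] s)
    (f := fun d => (F b - F a) * (b - d) * (c - a))
    (g := fun d => (F c - F a) * (b - a) * (c - d)) ?_ ?_ ?_
  · exact (Continuous.tendsto (by fun_prop) s).mono_left nhdsWithin_le_nhds
  · exact (Continuous.tendsto (by fun_prop) s).mono_left nhdsWithin_le_nhds
  · filter_upwards [Ioo_mem_nhdsGT ha] with d hd using key d hd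

theorem PickOn.cross_ratio_right_of_le (h : PickOn s t F F') {K : ℝ}
    (hK : ∀ x ∈ Ioo s t, F x ≤ K) {a b c : ℝ} (ha : s < a) (hab : a < b)
    (hbc : b < c) (hct : c < t) :
    (t - b) * (c - a) * (F c - F b) * (K - F a) ≤ (K - F b) * (F c - F a) * (c - b) * (t - a) := by
  have hmem : ∀ x, a ≤ x → x < t → x ∈ Ioo s t := fun x h1 h2 => ⟨ha.trans_le h1, h2⟩
  rcases h.pos_or_const with hp | hc
  swap
  · rw [hc c (hmem c (by linarith) hct) b (hmem b hab.le (by linarith)),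
      hc b (hmem b hab.le (by linarith)) a (hmem a le_rfl (by linarith))]
    simp
  have hs := h.strictMonoOn hp
  have key : ∀ d ∈ Ioo c t, (d - b) * (c - a) * (F c - F b) * (K - F a) ≤
      (K - F b) * (F c - F a) * (c - b) * (d - a) := by
    intro d hd
    have hcr := h.cross_ratio ha hab hbc hd.1 hd.2
    have hdb : F b < F d := hs (hmem b hab.le (by linarith)) (hmem d (by linarith [hd.1]) hd.2)
      (by linarith [hd.1])
    have hba : F a < F b := hs (hmem a le_rfl (by linarith)) (hmem b hab.le (by linarith)) hab
    have hbc' : F b < F c := hs (hmem b hab.le (by linarith)) (hmem c (by linarith) hct) hbc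
    have hdK := hK d (hmem d (by linarith [hd.1]) hd.2)
    have h0 : 0 ≤ (d - b) * (c - a) * (F c - F b) :=
      mul_nonneg (mul_nonneg (by linarith [hd.1]) (by linarith)) (by linarith)
    have h2 : (K - F a) * (F d - F b) ≤ (K - F b) * (F d - F a) := by nlinarith
    have h1 : ((d - b) * (c - a) * (F c - F b) * (K - F a)) * (F d - F b) ≤
        ((K - F b) * (F c - F a) * (c - b) * (d - a)) * (F d - F b) := by
      calc ((d - b) * (c - a) * (F c - F b) * (K - F a)) * (F d - F b) =
          (d - b) * (c - a) * (F c - F b) * ((K - F a) * (F d - F b)) := by ring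
        _ ≤ (d - b) * (c - a) * (F c - F b) * ((K - F b) * (F d - F a)) := by gcongr
        _ = ((d - b) * (c - a) * (F c - F b) * (F d - F a)) * (K - F b) := by ring
        _ ≤ ((F d - F b) * (F c - F a) * (c - b) * (d - a)) * (K - F b) :=
          mul_le_mul_of_nonneg_right hcr (by linarith)
        _ = _ := by ring
    exact le_of_mul_le_mul_right h1 (by linarith)
  refine le_of_tendsto_of_tendsto (b := 𝓝[<] t)
    (f := fun d => (d - b) * (c - a) * (F c - F b) * (K - F a))
    (g := fun d => (K - F b) * (F c - F a) * (c - b) * (d - a)) ?_ ?_ ?_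
  · exact (Continuous.tendsto (by fun_prop) t).mono_left nhdsWithin_le_nhds
  · exact (Continuous.tendsto (by fun_prop) t).mono_left nhdsWithin_le_nhds
  · filter_upwards [Ioo_mem_nhdsLT hct] with d hd using key d hd

theorem Herglotzian.im_pos {f : ℂ → ℂ} (hf : Herglotzian s t f) {x y : ℝ} (hx : x ∈ Ioo s t)
    (hy : y ∈ Ioo s t) (hxy : f x ≠ f y) {z : ℂ} (hz : 0 < z.im) : 0 < (f z).im := by
  refine lt_of_le_of_ne (hf.2.2 z (upperHalf_subset_Omega s t hz) hz) fun h0 => hxy ?_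
  have key : ∀ x ∈ Ioo s t, f z = f x := by
    intro x hx
    have := hf.schwarz_pick_boundary hz hx
    rw [← h0, zero_mul, mul_zero] at this
    have h1 : ‖f z - f x‖ ^ 2 = 0 := by
      by_contra hne
      have : 0 < ‖f z - f x‖ ^ 2 := lt_of_le_of_ne (by positivity) (Ne.symm hne)
      nlinarith
    exact sub_eq_zero.1 (norm_eq_zero.1 (pow_eq_zero_iff two_ne_zero |>.1 h1))
  exact (key x hx).symm.trans (key y hy)

theorem Herglotzian.norm_sub_le {f : ℂ → ℂ} (hf : Herglotzian s t f) {x : ℝ} (hx : x ∈ Ioo s t)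
    {z : ℂ} (hz : z.im ≠ 0) : ‖f z - f x‖ * |z.im| ≤ (deriv f x).re * ‖z - x‖ ^ 2 := by
  wlog h : 0 < z.im generalizing z
  · have hz' : z.im < 0 := lt_of_le_of_ne (not_lt.1 h) hz
    have h1 := this (z := (starRingEnd ℂ) z) (by simpa using hz) (by simpa using hz')
    rw [hf.2.1 z (mem_Omega_of_im_ne hz), hf.eq_ofReal hx, ← Complex.conj_ofReal (f x).re,
      ← map_sub, Complex.norm_conj, ← hf.eq_ofReal hx, ← Complex.conj_ofReal x, ← map_sub,
      Complex.norm_conj, Complex.conj_ofReal] at h1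
    simpa using h1
  have h1 := hf.schwarz_pick_boundary h hx
  have h2 : (f z).im ≤ ‖f z - f x‖ := by
    have := Complex.abs_im_le_norm (f z - f x)
    rw [sub_im, hf.im_ofReal hx, sub_zero] at this
    exact (le_abs_self _).trans this
  have h3 := hf.pickOn.2.1 x hx
  rw [abs_of_pos h]
  rcases (norm_nonneg (f z - f x)).eq_or_lt with h0 | h0
  · rw [← h0, zero_mul]; exact mul_nonneg h3 (sq_nonneg _)
  · refine le_of_mul_le_mul_right ?_ h0
    calc ‖f z - f x‖ * z.im * ‖f z - f x‖ = ‖f z - f x‖ ^ 2 * z.im := by ring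
      _ ≤ _ := h1
      _ ≤ ‖z - x‖ ^ 2 * (‖f z - f x‖ * (deriv f x).re) := by
        simp only at h3; gcongr
      _ = _ := by ring

end PickReal

section Compactness

open Filter Topology

/-- Anti-Herglotz functions normalised by `ψ 0 = 1`, `ψ 1 = 0`, and extended by zero. -/
def NormClass (s t : ℝ) : Set (ℂ → ℂ) :=
  {ψ | AntiHerglotzian s t ψ ∧ ψ 0 = 1 ∧ ψ 1 = 0 ∧ ∀ z ∉ Omega s t, ψ z = 0}

variable {s t : ℝ}

theorem Herglotzian.deriv_zero_le {f : ℂ → ℂ} (hs : s < 0) (ht : 1 < t) (hf : Herglotzian s t f)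
    (h0 : f 0 = -1) (h1 : f 1 = 0) : (deriv f 0).re ≤ (1 - s) / (-s) := by
  have hd := hf.pickOn.1 0 ⟨hs, by linarith⟩
  have h2 := hd.hasDerivWithinAt (s := Ioi 0)
  rw [hasDerivWithinAt_iff_tendsto_slope' (by simp)] at h2
  have h3 : Tendsto (fun b : ℝ => (1 - s) / (b - s)) (𝓝[>] 0) (𝓝 ((1 - s) / (0 - s))) := by
    refine Tendsto.mono_left (ContinuousAt.tendsto ?_) nhdsWithin_le_nhds
    exact continuousAt_const.div (by fun_prop) (by linarith)
  rw [zero_sub] at h3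
  simp only [ofReal_zero] at h2
  refine le_of_tendsto_of_tendsto h2 h3 ?_
  filter_upwards [Ioo_mem_nhdsGT (zero_lt_one (α := ℝ))] with b hb
  have := hf.pickOn.cross_ratio_left hs hb.1 hb.2 ht
  simp only [ofReal_zero, ofReal_one, h0, h1] at this
  rw [slope_def_field, div_le_div_iff₀ (by linarith [hb.1]) (by linarith [hb.1])]
  simp [h0] at *
  linarith

theorem NormClass.norm_sub_one_le {ψ : ℂ → ℂ} (hs : s < 0) (ht : 1 < t) (hψ : ψ ∈ NormClass s t)
    (z : ℂ) : ‖ψ z - 1‖ * |z.im| ≤ (1 - s) / (-s) * ‖z‖ ^ 2 := by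
  have hM : 0 ≤ (1 - s) / (-s) := div_nonneg (by linarith) (by linarith)
  by_cases him : z.im = 0
  · rw [him, abs_zero, mul_zero]; positivity
  have hf := hψ.1.neg
  have h0 : (0 : ℝ) ∈ Ioo s t := ⟨hs, by linarith⟩
  have h1 := hf.norm_sub_le h0 him
  have h2 := hf.deriv_zero_le hs ht (by simp [hψ.2.1]) (by simp [hψ.2.2.1])
  simp only [ofReal_zero, hψ.2.1, sub_zero] at h1
  have h3 : ‖-ψ z - -1‖ = ‖ψ z - 1‖ := by rw [← norm_neg]; congr 1; ring
  rw [h3] at h1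
  exact h1.trans (mul_le_mul_of_nonneg_right h2 (by positivity))

theorem NormClass.exists_local_bound (hs : s < 0) (ht : 1 < t) {z₀ : ℂ} (hz₀ : z₀ ∈ Omega s t) :
    ∃ ρ > 0, ∃ C, Metric.ball z₀ ρ ⊆ Omega s t ∧
      ∀ ψ ∈ NormClass s t, ∀ z ∈ Metric.ball z₀ ρ, ‖ψ z‖ ≤ C := by
  obtain ⟨R, hR, hRb⟩ := Metric.isOpen_iff.1 (isOpen_Omega s t) z₀ hz₀
  set M := (1 - s) / (-s)
  have hM : 0 ≤ M := div_nonneg (by linarith) (by linarith)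
  by_cases him : z₀.im = 0
  · set ρ := R / 2 with hρ
    have hρ0 : 0 < ρ := by positivity
    have hcl : Metric.closedBall z₀ ρ ⊆ Omega s t :=
      (Metric.closedBall_subset_ball (by linarith)).trans hRb
    have hsub : Metric.ball z₀ (ρ / 2) ⊆ Metric.closedBall z₀ ρ :=
      Metric.ball_subset_closedBall.trans (Metric.closedBall_subset_closedBall (by linarith))
    set B := 2 * ρ * (M * (‖z₀‖ + ρ) ^ 2)
    refine ⟨ρ / 2, by positivity, 1 + B / (3 / 4 * ρ ^ 2), hsub.trans hcl, fun ψ hψ z hz => ?_⟩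
    let G : ℂ → ℂ := fun z => ((z - z₀) ^ 2 - ρ ^ 2) * (ψ z - 1)
    have hψd : DifferentiableOn ℂ ψ (Metric.closedBall z₀ ρ) := hψ.1.1.mono hcl
    have hG : DiffContOnCl ℂ G (Metric.ball z₀ ρ) := by
      apply DifferentiableOn.diffContOnCl
      rw [closure_ball z₀ hρ0.ne']
      exact DifferentiableOn.mul (by fun_prop) (hψd.sub_const 1)
    have hfr : ∀ w ∈ frontier (Metric.ball z₀ ρ), ‖G w‖ ≤ B := by
      rw [frontier_ball z₀ hρ0.ne']
      intro w hw
      have hwn : ‖w - z₀‖ = ρ := by simpa [dist_eq_norm] using hw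
      have hwΩ : w ∈ Omega s t := hcl (Metric.sphere_subset_closedBall hw)
      have h1 : (w - z₀) ^ 2 - (ρ : ℂ) ^ 2 = (w - z₀) * (2 * (w.im : ℂ) * I) := by
        have h2 : (ρ : ℂ) ^ 2 = (w - z₀) * (starRingEnd ℂ) (w - z₀) := by
          rw [Complex.mul_conj, Complex.normSq_eq_norm_sq, hwn]; push_cast; ring
        have h3 := Complex.sub_conj (w - z₀)
        simp only [sub_im, him, sub_zero] at h3
        rw [h2, pow_two, ← mul_sub, h3]; push_cast; ring
      have h2 : ‖(w - z₀) ^ 2 - (ρ : ℂ) ^ 2‖ = 2 * ρ * |w.im| := by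
        rw [h1, norm_mul, norm_mul, norm_mul, hwn, Complex.norm_I, Complex.norm_real,
          Real.norm_eq_abs]; norm_num; ring
      have h3 := NormClass.norm_sub_one_le hs ht hψ w
      have h4 : ‖w‖ ≤ ‖z₀‖ + ρ := by
        calc ‖w‖ = ‖z₀ + (w - z₀)‖ := by congr 1; ring
          _ ≤ _ := norm_add_le _ _
          _ = _ := by rw [hwn]
      calc ‖G w‖ = 2 * ρ * (‖ψ w - 1‖ * |w.im|) := by simp only [G]; rw [norm_mul, h2]; ring
        _ ≤ 2 * ρ * (M * ‖w‖ ^ 2) := by gcongr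
        _ ≤ B := by simp only [B]; gcongr
    have hzG := Complex.norm_le_of_forall_mem_frontier_norm_le Metric.isBounded_ball hG hfr
      (subset_closure (Metric.ball_subset_ball (by linarith) hz))
    have hzn : ‖z - z₀‖ < ρ / 2 := by simpa [dist_eq_norm] using hz
    have h5 : 3 / 4 * ρ ^ 2 ≤ ‖(z - z₀) ^ 2 - (ρ : ℂ) ^ 2‖ := by
      have h6 := norm_sub_norm_le ((ρ : ℂ) ^ 2) ((z - z₀) ^ 2)
      rw [norm_sub_rev, norm_pow, norm_pow, Complex.norm_real, Real.norm_of_nonneg hρ0.le] at h6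
      nlinarith [norm_nonneg (z - z₀)]
    have h7 : ‖ψ z - 1‖ ≤ B / (3 / 4 * ρ ^ 2) := by
      rw [le_div_iff₀ (by positivity)]
      calc _ ≤ ‖ψ z - 1‖ * ‖(z - z₀) ^ 2 - (ρ : ℂ) ^ 2‖ := by gcongr
        _ = ‖G z‖ := by simp only [G]; rw [norm_mul]; ring
        _ ≤ B := hzG
    calc ‖ψ z‖ = ‖1 + (ψ z - 1)‖ := by congr 1; ring
      _ ≤ ‖(1 : ℂ)‖ + ‖ψ z - 1‖ := norm_add_le _ _
      _ ≤ _ := by rw [norm_one]; gcongr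
  · have hi : 0 < |z₀.im| := abs_pos.2 him
    set ρ := min R (|z₀.im| / 2)
    have hρ0 : 0 < ρ := lt_min hR (by positivity)
    have hsub : Metric.ball z₀ ρ ⊆ Omega s t :=
      (Metric.ball_subset_ball (min_le_left _ _)).trans hRb
    refine ⟨ρ, hρ0, 1 + M * (‖z₀‖ + ρ) ^ 2 / (|z₀.im| / 2), hsub, fun ψ hψ z hz => ?_⟩
    have hzn : ‖z - z₀‖ < ρ := by simpa [dist_eq_norm] using hz
    have h1 : |z₀.im| / 2 ≤ |z.im| := by
      have h2 := Complex.abs_im_le_norm (z₀ - z)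
      rw [norm_sub_rev, sub_im] at h2
      have h3 := abs_sub_abs_le_abs_sub z₀.im z.im
      have h4 : ρ ≤ |z₀.im| / 2 := min_le_right _ _
      linarith
    have h4 : ‖z‖ ≤ ‖z₀‖ + ρ := by
      calc ‖z‖ = ‖z₀ + (z - z₀)‖ := by congr 1; ring
        _ ≤ _ := norm_add_le _ _
        _ ≤ _ := by gcongr
    have h5 := NormClass.norm_sub_one_le hs ht hψ z
    have h7 : ‖ψ z - 1‖ ≤ M * (‖z₀‖ + ρ) ^ 2 / (|z₀.im| / 2) := by
      rw [le_div_iff₀ (by positivity)]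
      calc _ ≤ ‖ψ z - 1‖ * |z.im| := by gcongr
        _ ≤ M * ‖z‖ ^ 2 := h5
        _ ≤ _ := by gcongr
    calc ‖ψ z‖ = ‖1 + (ψ z - 1)‖ := by congr 1; ring
      _ ≤ ‖(1 : ℂ)‖ + ‖ψ z - 1‖ := norm_add_le _ _
      _ ≤ _ := by rw [norm_one]; gcongr

theorem NormClass.exists_local_lipschitz (hs : s < 0) (ht : 1 < t) {z₀ : ℂ}
    (hz₀ : z₀ ∈ Omega s t) :
    ∃ ρ > 0, ∃ L ≥ 0, Metric.ball z₀ ρ ⊆ Omega s t ∧ ∀ ψ ∈ NormClass s t,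
      ∀ z ∈ Metric.ball z₀ ρ, ∀ w ∈ Metric.ball z₀ ρ, ‖ψ z - ψ w‖ ≤ L * ‖z - w‖ := by
  obtain ⟨ρ, hρ, C, hsub, hC⟩ := NormClass.exists_local_bound hs ht hz₀
  refine ⟨ρ / 4, by positivity, (2 * |C|) / (ρ / 2), by positivity,
    (Metric.ball_subset_ball (by linarith)).trans hsub, fun ψ hψ z hz w hw => ?_⟩
  have hb : Metric.ball w (ρ / 2) ⊆ Metric.ball z₀ ρ := by
    refine Metric.ball_subset_ball' ?_
    have : dist w z₀ < ρ / 4 := hw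
    linarith
  have hz' : z ∈ Metric.ball w (ρ / 2) := by
    have h1 : dist w z₀ < ρ / 4 := hw
    have h2 : dist z z₀ < ρ / 4 := hz
    have := dist_triangle_right z w z₀
    rw [Metric.mem_ball]; linarith
  have := Complex.dist_le_div_mul_dist_of_mapsTo_ball (f := ψ) (c := w) (R₁ := ρ / 2)
    (R₂ := 2 * |C|) (z := z) (hψ.1.1.mono (hb.trans hsub)) (by
      intro u hu
      have h1 := hC ψ hψ u (hb hu)
      have h2 := hC ψ hψ w (Metric.ball_subset_ball (by linarith) hw)
      have h3 := norm_sub_le (ψ u) (ψ w)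
      have := le_abs_self C
      rw [Metric.mem_closedBall, dist_eq_norm]; linarith) hz'
  rwa [dist_eq_norm, dist_eq_norm] at this

theorem NormClass.tendsto_eval (hs : s < 0) (ht : 1 < t) {ι : Type*} {l : Filter ι}
    {Ψ : ι → ℂ → ℂ} {Z : ι → ℂ} {z a : ℂ} (hz : z ∈ Omega s t) (hΨ : ∀ᶠ i in l, Ψ i ∈ NormClass s t)
    (ha : Tendsto (fun i => Ψ i z) l (𝓝 a)) (hZ : Tendsto Z l (𝓝 z)) :
    Tendsto (fun i => Ψ i (Z i)) l (𝓝 a) := by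
  obtain ⟨ρ, hρ, L, hL, hsub, hLip⟩ := NormClass.exists_local_lipschitz hs ht hz
  have h1 : Tendsto (fun i => Ψ i (Z i) - Ψ i z) l (𝓝 0) := by
    have h2 : Tendsto (fun i => L * ‖Z i - z‖) l (𝓝 0) := by
      have : Tendsto (fun i => L * ‖Z i - z‖) l (𝓝 (L * ‖z - z‖)) :=
        tendsto_const_nhds.mul (hZ.sub_const z).norm
      simpa using this
    refine squeeze_zero_norm' ?_ h2
    filter_upwards [hΨ, hZ.eventually_mem (Metric.ball_mem_nhds z hρ)] with i h1 h2
    exact hLip _ h1 _ h2 _ (Metric.mem_ball_self hρ)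
  simpa using h1.add ha

theorem NormClass.isClosed (hs : s < 0) (ht : 1 < t) : IsClosed (NormClass s t) := by
  rw [← closure_subset_iff_isClosed]
  intro ψ hψ
  have hne : (𝓝[NormClass s t] ψ).NeBot := mem_closure_iff_nhdsWithin_neBot.1 hψ
  have hmem : ∀ᶠ φ in 𝓝[NormClass s t] ψ, φ ∈ NormClass s t := self_mem_nhdsWithin
  have hev : ∀ z, Tendsto (fun φ : ℂ → ℂ => φ z) (𝓝[NormClass s t] ψ) (𝓝 (ψ z)) := fun z =>
    ((continuous_apply z).tendsto ψ).mono_left nhdsWithin_le_nhds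
  have hcont : ∀ z ∈ Omega s t, ContinuousAt ψ z := by
    intro z hz
    obtain ⟨ρ, hρ, L, hL, hsub, hLip⟩ := NormClass.exists_local_lipschitz hs ht hz
    have hl : ∀ w ∈ Metric.ball z ρ, ‖ψ w - ψ z‖ ≤ L * ‖w - z‖ := fun w hw =>
      le_of_tendsto ((hev w).sub (hev z)).norm (hmem.mono fun φ hφ =>
        hLip φ hφ w hw z (Metric.mem_ball_self hρ))
    rw [ContinuousAt, tendsto_iff_norm_sub_tendsto_zero]
    have h2 : Tendsto (fun w => L * ‖w - z‖) (𝓝 z) (𝓝 0) := by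
      have : Tendsto (fun w => L * ‖w - z‖) (𝓝 z) (𝓝 (L * ‖z - z‖)) :=
        Continuous.tendsto (by fun_prop) z
      simpa using this
    refine squeeze_zero' (Eventually.of_forall fun _ => norm_nonneg _) ?_ h2
    filter_upwards [Metric.ball_mem_nhds z hρ] with w hw using hl w hw
  have hconv : TendstoLocallyUniformlyOn (fun (φ : ℂ → ℂ) => φ) ψ (𝓝[NormClass s t] ψ)
      (Omega s t) := by
    rw [tendstoLocallyUniformlyOn_iff_forall_tendsto]
    intro z hz
    refine Tendsto.mono_right ?_ (nhds_le_uniformity (ψ z))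
    rw [nhds_prod_eq]
    refine Tendsto.prodMk ?_ ?_
    · exact ((hcont z hz).tendsto.mono_left nhdsWithin_le_nhds).comp tendsto_snd
    · exact NormClass.tendsto_eval hs ht hz (tendsto_fst.eventually hmem)
        ((hev z).comp tendsto_fst) (tendsto_snd.mono_right nhdsWithin_le_nhds)
  refine ⟨⟨?_, ?_, ?_⟩, ?_, ?_, ?_⟩
  · exact hconv.differentiableOn (hmem.mono fun φ hφ => hφ.1.1) (isOpen_Omega s t)
  · intro z hz
    refine tendsto_nhds_unique (hev _) ?_
    refine Tendsto.congr' (hmem.mono fun φ hφ => (hφ.1.2.1 z hz).symm) ?_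
    exact (Complex.continuous_conj.tendsto _).comp (hev z)
  · intro z hz him
    exact le_of_tendsto ((Complex.continuous_im.tendsto _).comp (hev z))
      (hmem.mono fun φ hφ => hφ.1.2.2 z hz him)
  · exact tendsto_nhds_unique (hev 0) (tendsto_const_nhds.congr' (hmem.mono fun φ hφ => hφ.2.1.symm))
  · exact tendsto_nhds_unique (hev 1)
      (tendsto_const_nhds.congr' (hmem.mono fun φ hφ => hφ.2.2.1.symm))
  · intro z hz
    exact tendsto_nhds_unique (hev z)
      (tendsto_const_nhds.congr' (hmem.mono fun φ hφ => (hφ.2.2.2 z hz).symm))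

theorem NormClass.isCompact (hs : s < 0) (ht : 1 < t) : IsCompact (NormClass s t) := by
  have hC : ∀ z, ∃ C, ∀ ψ ∈ NormClass s t, ‖ψ z‖ ≤ C := by
    intro z
    by_cases hz : z ∈ Omega s t
    · obtain ⟨ρ, hρ, C, -, hC⟩ := NormClass.exists_local_bound hs ht hz
      exact ⟨C, fun ψ hψ => hC ψ hψ z (Metric.mem_ball_self hρ)⟩
    · exact ⟨0, fun ψ hψ => by rw [hψ.2.2.2 z hz, norm_zero]⟩
  choose C hC using hC
  refine (isCompact_univ_pi fun z => isCompact_closedBall (0 : ℂ) (C z)).of_isClosed_subset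
    (NormClass.isClosed hs ht) fun ψ hψ z _ => ?_
  simpa using hC z ψ hψ

theorem NormClass.convex : Convex ℝ (NormClass s t) := by
  intro φ hφ ψ hψ a b ha hb hab
  have hab' : (a : ℂ) + b = 1 := by exact_mod_cast hab
  refine ⟨⟨?_, ?_, ?_⟩, ?_, ?_, ?_⟩
  · exact (hφ.1.1.const_smul a).add (hψ.1.1.const_smul b)
  · intro z hz
    simp [hφ.1.2.1 z hz, hψ.1.2.1 z hz]
  · intro z hz him
    have h1 := hφ.1.2.2 z hz him
    have h2 := hψ.1.2.2 z hz him
    simp; nlinarith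
  · simp [hφ.2.1, hψ.2.1, hab']
  · simp [hφ.2.2.1, hψ.2.2.1]
  · intro z hz
    simp [hφ.2.2.2 z hz, hψ.2.2.2 z hz]

end Compactness

section PickNorm

/-- Real increasing Pick functions on `(-1/a, 1/lam)` normalised by `-1 ↦ 0`, `0 ↦ 1`. -/
structure PickNorm (lam a : ℝ) (φ : ℝ → ℝ) : Prop where
  lam_mem : lam ∈ Ioo (0 : ℝ) 1
  a_mem : a ∈ Ioo (0 : ℝ) 1
  exists_pickOn : ∃ φ', PickOn (-(1 / a)) (1 / lam) φ φ'
  neg_one : φ (-1) = 0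
  zero : φ 0 = 1

namespace PickNorm

variable {lam a : ℝ} {φ : ℝ → ℝ}

theorem lam_pos (h : PickNorm lam a φ) : 0 < lam := h.lam_mem.1

theorem lam_lt_one (h : PickNorm lam a φ) : lam < 1 := h.lam_mem.2

theorem one_lt_inv_lam (h : PickNorm lam a φ) : 1 < 1 / lam := by
  rw [lt_div_iff₀ h.lam_pos]; linarith [h.lam_lt_one]

theorem neg_inv_a_lt (h : PickNorm lam a φ) : -(1 / a) < -1 := by
  have : 1 < 1 / a := by rw [lt_div_iff₀ h.a_mem.1]; linarith [h.a_mem.2]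
  linarith

theorem strictMonoOn (h : PickNorm lam a φ) : StrictMonoOn φ (Ioo (-(1 / a)) (1 / lam)) := by
  obtain ⟨φ', hφ⟩ := h.exists_pickOn
  have h1 := h.one_lt_inv_lam
  have h2 := h.neg_inv_a_lt
  refine hφ.strictMonoOn_of_ne (x := -1) (y := 0) ⟨h2, by linarith⟩ ⟨by linarith, by linarith⟩ ?_
  rw [h.neg_one, h.zero]; norm_num

theorem continuousOn (h : PickNorm lam a φ) : ContinuousOn φ (Ioo (-(1 / a)) (1 / lam)) := by
  obtain ⟨φ', hφ⟩ := h.exists_pickOn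
  exact hφ.continuousOn

theorem Ioo_subset (h : PickNorm lam a φ) : Ioo (-1) (1 / lam) ⊆ Ioo (-(1 / a)) (1 / lam) :=
  Ioo_subset_Ioo_left h.neg_inv_a_lt.le

theorem lt_of_lt (h : PickNorm lam a φ) {x y : ℝ} (hx : -1 ≤ x) (hxy : x < y)
    (hy : y < 1 / lam) : φ x < φ y :=
  h.strictMonoOn ⟨by linarith [h.neg_inv_a_lt], by linarith⟩
    ⟨by linarith [h.neg_inv_a_lt], hy⟩ hxy

theorem pos (h : PickNorm lam a φ) {x : ℝ} (hx : -1 < x) (hx' : x < 1 / lam) : 0 < φ x := by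
  have := h.lt_of_lt le_rfl hx hx'
  rwa [h.neg_one] at this

theorem one_le (h : PickNorm lam a φ) {x : ℝ} (hx : 0 ≤ x) (hx' : x < 1 / lam) : 1 ≤ φ x := by
  rcases hx.eq_or_lt with rfl | hx
  · rw [h.zero]
  · have := h.lt_of_lt (by norm_num) hx hx'
    rw [h.zero] at this; exact this.le

theorem ratio_ge (h : PickNorm lam a φ) {x w : ℝ} (hx : -1 < x) (hxw : x < w)
    (hw : w < 1 / lam) : φ x * (1 + a * x) * (1 + w) ≤ φ w * (1 + x) * (1 + a * w) := by
  obtain ⟨φ', hφ⟩ := h.exists_pickOn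
  have := hφ.cross_ratio_left h.neg_inv_a_lt hx hxw hw
  rw [h.neg_one] at this
  have ha := h.a_mem.1
  have h1 := mul_le_mul_of_nonneg_left this ha.le
  have e1 : a * ((φ x - 0) * (x - -(1 / a)) * (w - -1)) = φ x * (1 + a * x) * (1 + w) := by
    field_simp; ring
  have e2 : a * ((φ w - 0) * (x - -1) * (w - -(1 / a))) = φ w * (1 + x) * (1 + a * w) := by
    field_simp; ring
  rwa [e1, e2] at h1

theorem ratio_le (h : PickNorm lam a φ) {x w : ℝ} (hx : -1 < x) (hxw : x < w)
    (hw : w < 1 / lam) : (φ w - φ x) * (1 - lam * x) * (1 + w) ≤ φ w * (w - x) * (1 + lam) := by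
  obtain ⟨φ', hφ⟩ := h.exists_pickOn
  have := hφ.cross_ratio_right h.neg_inv_a_lt hx hxw hw
  rw [h.neg_one] at this
  have ha := h.lam_pos
  have h1 := mul_le_mul_of_nonneg_left this ha.le
  have e1 : lam * ((φ w - φ x) * (1 / lam - x) * (w - -1)) =
      (φ w - φ x) * (1 - lam * x) * (1 + w) := by
    field_simp; ring
  have e2 : lam * ((φ w - 0) * (w - x) * (1 / lam - -1)) = φ w * (w - x) * (1 + lam) := by
    field_simp; ring
  rwa [e1, e2] at h1

theorem ratio_le_of_le (h : PickNorm lam a φ) {K : ℝ} (hK : ∀ x ∈ Ioo (-(1 / a)) (1 / lam), φ x ≤ K)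
    {x w : ℝ} (hx : -1 < x) (hxw : x < w) (hw : w < 1 / lam) :
    (φ w - φ x) * K * (1 - lam * x) * (1 + w) ≤ φ w * (K - φ x) * (w - x) * (1 + lam) := by
  obtain ⟨φ', hφ⟩ := h.exists_pickOn
  have := hφ.cross_ratio_right_of_le hK h.neg_inv_a_lt hx hxw hw
  rw [h.neg_one] at this
  have ha := h.lam_pos
  have h1 := mul_le_mul_of_nonneg_left this ha.le
  have e1 : lam * ((1 / lam - x) * (w - -1) * (φ w - φ x) * (K - 0)) =
      (φ w - φ x) * K * (1 - lam * x) * (1 + w) := by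
    field_simp; ring
  have e2 : lam * ((K - φ x) * (φ w - 0) * (w - x) * (1 / lam - -1)) =
      φ w * (K - φ x) * (w - x) * (1 + lam) := by
    field_simp; ring
  rwa [e1, e2] at h1

theorem one_le_mul (h : PickNorm lam a φ) : φ 1 * (1 - lam) ≤ 2 := by
  have := h.ratio_le (x := 0) (w := 1) (by norm_num) (by norm_num) h.one_lt_inv_lam
  rw [h.zero] at this
  linarith

theorem neg_ge (h : PickNorm lam a φ) {z : ℝ} (hz : z ∈ Ioo (0 : ℝ) 1) :
    1 - z ≤ φ (-z) * (1 + lam * z) := by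
  have := h.ratio_le (x := -z) (w := 0) (by linarith [hz.2]) (by linarith [hz.1])
    (by linarith [h.one_lt_inv_lam])
  rw [h.zero] at this
  linarith

theorem neg_le (h : PickNorm lam a φ) {z : ℝ} (hz : z ∈ Ioo (0 : ℝ) 1) :
    φ (-z) * (1 - a * z) ≤ 1 - z := by
  have := h.ratio_ge (x := -z) (w := 0) (by linarith [hz.2]) (by linarith [hz.1])
    (by linarith [h.one_lt_inv_lam])
  rw [h.zero] at this
  linarith

end PickNorm

end PickNorm

section Chain

open Filter Topology

/-- The orbit of `lam` under `x ↦ y * H x`. -/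
def chain (H : ℝ → ℝ) (lam y : ℝ) (n : ℕ) : ℝ := (fun x => y * H x)^[n] lam

@[simp] theorem chain_zero (H : ℝ → ℝ) (lam y : ℝ) : chain H lam y 0 = lam := rfl

theorem chain_succ (H : ℝ → ℝ) (lam y : ℝ) (n : ℕ) :
    chain H lam y (n + 1) = y * H (chain H lam y n) :=
  Function.iterate_succ_apply' _ _ _

/-- Hypotheses on the function generating a chain. -/
structure ChainFun (L : ℝ) (H : ℝ → ℝ) : Prop where
  continuousOn : ContinuousOn H (Ioo 0 L)
  lt_of_lt : ∀ x y, 0 ≤ x → x < y → y < L → H x < H y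
  one_le : ∀ x, 0 ≤ x → x < L → 1 ≤ H x

namespace ChainFun

variable {L T lam : ℝ} {H : ℝ → ℝ}

theorem le_of_le (h : ChainFun L H) {x y : ℝ} (hx : 0 ≤ x) (hxy : x ≤ y) (hy : y < L) :
    H x ≤ H y := by
  rcases hxy.eq_or_lt with rfl | hxy
  · rfl
  · exact (h.lt_of_lt x y hx hxy hy).le

theorem chain_pos (h : ChainFun L H) (hlam : 0 < lam) (hTL : T ≤ L) {y : ℝ} (hy : 0 < y) {n : ℕ}
    (hn : ∀ j < n, chain H lam y j < T) : ∀ j ≤ n, 0 < chain H lam y j := by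
  intro j
  induction j with
  | zero => intro _; simpa
  | succ j ih =>
    intro hj
    rw [chain_succ]
    have h1 := h.one_le _ (ih (by omega)).le ((hn j (by omega)).trans_le hTL)
    positivity

theorem chain_mono (h : ChainFun L H) (hlam : 0 < lam) (hTL : T ≤ L) {y y' : ℝ} (hy : 0 < y)
    (hyy : y ≤ y') {n : ℕ} (hn : ∀ j < n, chain H lam y' j < T) :
    ∀ j ≤ n, 0 < chain H lam y j ∧ chain H lam y j ≤ chain H lam y' j := by
  intro j
  induction j with
  | zero => intro _; simpa
  | succ j ih =>
    intro hj
    obtain ⟨h0, h1⟩ := ih (by omega)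
    have h2 := (hn j (by omega)).trans_le hTL
    rw [chain_succ, chain_succ]
    have h3 := h.one_le _ h0.le (h1.trans_lt h2)
    have h4 := h.le_of_le h0.le h1 h2
    exact ⟨by positivity, mul_le_mul hyy h4 (by linarith) (hy.le.trans hyy)⟩

theorem chain_strictMono (h : ChainFun L H) (hlam : 0 < lam) (hTL : T ≤ L) {y y' : ℝ} (hy : 0 < y)
    (hyy : y < y') {n : ℕ} (hn : ∀ j < n + 1, chain H lam y' j < T) :
    chain H lam y (n + 1) < chain H lam y' (n + 1) := by
  obtain ⟨h0, h1⟩ := h.chain_mono hlam hTL hy hyy.le hn n (by omega)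
  have h2 := (hn n (by omega)).trans_le hTL
  have h3 := h.one_le _ h0.le (h1.trans_lt h2)
  have h4 := h.le_of_le h0.le h1 h2
  rw [chain_succ, chain_succ]
  nlinarith

theorem chain_lt_succ (h : ChainFun L H) (hlam : 0 < lam) (hT : lam < T) (hTL : T ≤ L) {y : ℝ}
    (hy : 0 < y) {n : ℕ} (hn : ∀ j < n, chain H lam y j < T) (hnT : T ≤ chain H lam y n) :
    ∀ j < n, chain H lam y j < chain H lam y (j + 1) := by
  have hpos := h.chain_pos hlam hTL hy hn
  have h0 : lam < chain H lam y 1 := by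
    by_contra! hle
    have key : ∀ j ≤ n, chain H lam y j ≤ lam := by
      intro j
      induction j with
      | zero => simp
      | succ j ih =>
        intro hj
        have h1 := ih (by omega)
        refine le_trans ?_ hle
        rw [chain_succ, chain_succ, chain_zero]
        have := h.le_of_le (hpos j (by omega)).le h1 (hT.trans_le hTL)
        gcongr
    linarith [key n le_rfl]
  intro j
  induction j with
  | zero => intro _; simpa
  | succ j ih =>
    intro hj
    have h1 := ih (by omega)
    have := h.lt_of_lt _ _ (hpos j (by omega)).le h1 ((hn (j + 1) hj).trans_le hTL)
    rw [chain_succ, chain_succ H lam y (j + 1)]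
    gcongr

end ChainFun

theorem tendsto_chain {ι : Type*} {l : Filter ι} {Hi : ι → ℝ → ℝ} {lami yi : ι → ℝ} {L lam y : ℝ}
    {H : ℝ → ℝ} (hH : ∀ x ∈ Ioo 0 L, ∀ X : ι → ℝ, Tendsto X l (𝓝 x) →
      Tendsto (fun i => Hi i (X i)) l (𝓝 (H x)))
    (hlam : Tendsto lami l (𝓝 lam)) (hy : Tendsto yi l (𝓝 y)) {n : ℕ}
    (hn : ∀ j < n, chain H lam y j ∈ Ioo 0 L) :
    Tendsto (fun i => chain (Hi i) (lami i) (yi i) n) l (𝓝 (chain H lam y n)) := by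
  induction n with
  | zero => simpa
  | succ n ih =>
    simp only [chain_succ]
    exact hy.mul (hH _ (hn n (by omega)) _ (ih fun j hj => hn j (by omega)))

namespace ChainFun

variable {L T lam : ℝ} {H : ℝ → ℝ}

theorem continuousAt_chain (h : ChainFun L H) {y : ℝ} {n : ℕ}
    (hn : ∀ j < n, chain H lam y j ∈ Ioo 0 L) : ContinuousAt (fun y => chain H lam y n) y := by
  refine tendsto_chain (Hi := fun _ => H) (fun x hx X hX => ?_) tendsto_const_nhds tendsto_id hn
  exact ((h.continuousOn.continuousAt (isOpen_Ioo.mem_nhds hx)).tendsto).comp hX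

theorem exists_chain_eq (h : ChainFun L H) (hlam : 0 < lam) (hT : lam < T) (hTL : T ≤ L) (n : ℕ) :
    ∃ y > 0, (∀ j < n + 1, chain H lam y j < T) ∧ chain H lam y (n + 1) = T := by
  induction n with
  | zero =>
    have h1 := h.one_le lam hlam.le (hT.trans_le hTL)
    refine ⟨T / H lam, div_pos (by linarith) (by linarith), ?_, ?_⟩
    · intro j hj
      obtain rfl : j = 0 := by omega
      simpa
    · rw [chain_succ, chain_zero]; field_simp
  | succ n ih =>
    obtain ⟨z, hz, hzj, hzT⟩ := ih
    have hpos := h.chain_pos hlam hTL hz hzj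
    set a := chain H lam z n with ha
    have haT : a < T := hzj n (by omega)
    have ha0 : 0 < a := hpos n (by omega)
    set q := (a + T) / 2 with hq
    have haq : H a < H q := h.lt_of_lt _ _ ha0.le (by linarith) (by linarith)
    have h1a := h.one_le a ha0.le (by linarith)
    have hc : ContinuousAt (fun y => chain H lam y (n + 1)) z :=
      h.continuousAt_chain fun j hj => ⟨hpos j hj.le, (hzj j hj).trans_le hTL⟩
    have hev : ∀ᶠ y in 𝓝 z, q < chain H lam y (n + 1) ∧
        T * H a < chain H lam y (n + 1) * H q := by
      refine (hc.eventually (lt_mem_nhds ?_)).and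
        ((hc.mul_const (H q)).eventually (lt_mem_nhds ?_))
      · simp only [hzT]; linarith
      · simp only [hzT]; nlinarith
    obtain ⟨y', hy', hy'0, hy'z⟩ := ((hev.filter_mono nhdsWithin_le_nhds).and
      (Ioo_mem_nhdsLT hz)).exists
    have hmono := h.chain_mono hlam hTL hy'0 hy'z.le hzj
    have hlt := h.chain_strictMono hlam hTL hy'0 hy'z hzj
    rw [hzT] at hlt
    have hy'j : ∀ j < n + 1 + 1, chain H lam y' j < T := by
      intro j hj
      rcases Nat.lt_succ_iff_lt_or_eq.1 hj with hj | rfl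
      · exact (hmono j hj.le).2.trans_lt (hzj j hj)
      · exact hlt
    set c := chain H lam y' (n + 1) with hc'
    have hc0 : 0 < c := (hmono (n + 1) le_rfl).1
    have hcH := h.one_le c hc0.le (by linarith)
    have hbig : T < chain H lam y' (n + 1 + 1) := by
      rw [chain_succ, ← hc']
      have h1 : c = y' * H (chain H lam y' n) := chain_succ _ _ _ _
      have h2 := (hmono n (by omega))
      have h3 := h.le_of_le h2.1.le h2.2 (haT.trans_le hTL)
      have h4 := h.one_le _ h2.1.le (h2.2.trans_lt (haT.trans_le hTL))
      have h5 := h.le_of_le (x := q) (by linarith) hy'.1.le (hlt.trans_le hTL)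
      have h6 : T * H a < y' * H c * H a := by
        calc T * H a < c * H q := hy'.2
          _ = y' * H q * H (chain H lam y' n) := by rw [h1]; ring
          _ ≤ y' * H c * H a := by
            have : 0 < H q := by linarith
            gcongr
      exact lt_of_mul_lt_mul_right h6 (by linarith)
    have hT0 : 0 < T := by linarith
    have hy0 : 0 < T / H c := div_pos hT0 (by linarith)
    have hy0y' : T / H c < y' := by
      rw [div_lt_iff₀ (by linarith)]; rwa [chain_succ, ← hc'] at hbig
    have hsmall : chain H lam (T / H c) (n + 1 + 1) ≤ T := by
      rw [chain_succ]
      have h1 := h.chain_mono hlam hTL hy0 hy0y'.le hy'j (n + 1) (by omega)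
      have h2 := h.le_of_le h1.1.le h1.2 (hlt.trans_le hTL)
      calc T / H c * H (chain H lam (T / H c) (n + 1)) ≤ T / H c * H c := by gcongr
        _ = T := by field_simp
    have hcont : ContinuousOn (fun y => chain H lam y (n + 1 + 1)) (Icc (T / H c) y') := by
      intro y hy
      have h1 := h.chain_mono hlam hTL (hy0.trans_le hy.1) hy.2 hy'j
      exact (h.continuousAt_chain fun j hj => ⟨(h1 j hj.le).1,
        ((h1 j hj.le).2.trans_lt (hy'j j hj)).trans_le hTL⟩).continuousWithinAt
    obtain ⟨y, hy, hyT⟩ := intermediate_value_Icc hy0y'.le hcont ⟨hsmall, hbig.le⟩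
    have h1 := h.chain_mono hlam hTL (hy0.trans_le hy.1) hy.2 hy'j
    exact ⟨y, hy0.trans_le hy.1, fun j hj => (h1 j hj.le).2.trans_lt (hy'j j hj), hyT⟩

/-- Convergence of the parameters `y` of chains ending at prescribed values. -/
theorem tendsto_param (h : ChainFun L H) (hlam : 0 < lam) (hTL : T ≤ L) {n : ℕ}
    {y : ℝ} (hy : 0 < y) (hj : ∀ j < n + 1, chain H lam y j < T)
    (hyT : chain H lam y (n + 1) = T) {ι : Type*} {l : Filter ι} {Hi : ι → ℝ → ℝ}
    {lami Li Ti yi : ι → ℝ}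
    (hH : ∀ x ∈ Ioo 0 L, ∀ X : ι → ℝ, Tendsto X l (𝓝 x) →
      Tendsto (fun i => Hi i (X i)) l (𝓝 (H x)))
    (hlami : Tendsto lami l (𝓝 lam)) (hTi : Tendsto Ti l (𝓝 T))
    (hi : ∀ᶠ i in l, ChainFun (Li i) (Hi i) ∧ 0 < lami i ∧ Ti i ≤ Li i ∧ 0 < yi i ∧
      (∀ j < n + 1, chain (Hi i) (lami i) (yi i) j < Ti i) ∧
      chain (Hi i) (lami i) (yi i) (n + 1) = Ti i) :
    Tendsto yi l (𝓝 y) := by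
  have hpos := h.chain_pos hlam hTL hy hj
  rw [tendsto_order]
  constructor
  · intro z hz
    by_cases hz0 : z ≤ 0
    · filter_upwards [hi] with i hi
      linarith [hi.2.2.2.1]
    push Not at hz0
    have hm := h.chain_mono hlam hTL hz0 hz.le hj
    have hlt := h.chain_strictMono hlam hTL hz0 hz hj
    rw [hyT] at hlt
    have hc : ∀ m ≤ n + 1, Tendsto (fun i => chain (Hi i) (lami i) z m) l (𝓝 (chain H lam z m)) :=
      fun m hm' => tendsto_chain hH hlami tendsto_const_nhds fun j hjm =>
        ⟨(hm j (by omega)).1,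
          ((hm j (by omega)).2.trans_lt (hj j (by omega))).trans_le hTL⟩
    have hev : ∀ᶠ i in l, ∀ j ∈ Finset.range (n + 1), chain (Hi i) (lami i) z j < Ti i := by
      rw [Filter.eventually_all_finset]
      intro j hjn
      rw [Finset.mem_range] at hjn
      exact (hc j hjn.le).eventually_lt hTi ((hm j hjn.le).2.trans_lt (hj j hjn))
    filter_upwards [hi, hev, (hc _ le_rfl).eventually_lt hTi hlt] with i hi h0 h1
    obtain ⟨g, g1, g2, g3, g4, g5⟩ := hi
    by_contra! hle
    have := (g.chain_mono g1 g2 g3 hle (fun j hj => h0 j (Finset.mem_range.2 hj)) (n + 1) le_rfl).2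
    linarith
  · intro z hz
    have hev : ∀ᶠ z' in 𝓝[>] y, ∀ j ∈ Finset.range (n + 1), chain H lam z' j < T := by
      rw [Filter.eventually_all_finset]
      intro j hjn
      rw [Finset.mem_range] at hjn
      have hc := h.continuousAt_chain (lam := lam) (y := y) (n := j) fun k hk =>
        ⟨hpos k (by omega), (hj k (by omega)).trans_le hTL⟩
      exact (hc.eventually (gt_mem_nhds (hj j hjn))).filter_mono nhdsWithin_le_nhds
    obtain ⟨z', hz', hyz', hz'z⟩ := (hev.and (Ioo_mem_nhdsGT hz)).exists
    have hj' : ∀ j < n + 1, chain H lam z' j < T := fun j hj => hz' j (Finset.mem_range.2 hj)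
    have hlt := h.chain_strictMono hlam hTL hy hyz' hj'
    rw [hyT] at hlt
    have hpos' := h.chain_pos hlam hTL (hy.trans hyz') hj'
    have hc := tendsto_chain hH hlami (tendsto_const_nhds (x := z')) (n := n + 1)
      fun j hjn => ⟨hpos' j hjn.le, (hj' j hjn).trans_le hTL⟩
    filter_upwards [hi, hTi.eventually_lt hc hlt] with i hi h1
    obtain ⟨g, g1, g2, g3, g4, g5⟩ := hi
    refine lt_of_not_ge fun hle => ?_
    have := (g.chain_mono g1 g2 (hy.trans hyz') (hz'z.le.trans hle) g4 (n + 1) le_rfl).2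
    linarith

end ChainFun

end Chain

section ChainData

/-- A normalised Pick function bounded by `lam ^ (-(r * ν))` together with the parameter `y` for
which the orbit of `lam` under `x ↦ y * φ x ^ (1 / r)` hits `lam ^ (1 - ν)` at time `p`. -/
structure ChainData (ν r : ℝ) (p : ℕ) (lam a y : ℝ) (φ : ℝ → ℝ) : Prop where
  pickNorm : PickNorm lam a φ
  one_le_p : 1 ≤ p
  ν_mem : ν ∈ Icc (1 : ℝ) 2
  one_lt_r : 1 < r
  le_rpow : ∀ x ∈ Ioo (-(1 / a)) (1 / lam), φ x ≤ lam ^ (-(r * ν))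
  y_pos : 0 < y
  chain_lt : ∀ j < p, chain (fun x => φ x ^ (1 / r)) lam y j < lam ^ (1 - ν)
  chain_eq : chain (fun x => φ x ^ (1 / r)) lam y p = lam ^ (1 - ν)

theorem PickNorm.chainFun {lam a r : ℝ} {φ : ℝ → ℝ} (h : PickNorm lam a φ) (hr : 1 < r) :
    ChainFun (1 / lam) (fun x => φ x ^ (1 / r)) where
  continuousOn := by
    refine ContinuousOn.rpow_const (h.continuousOn.mono ?_) fun x hx => Or.inr (by positivity)
    exact (Ioo_subset_Ioo_left (by norm_num)).trans h.Ioo_subset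
  lt_of_lt x y hx hxy hy := Real.rpow_lt_rpow (h.pos (by linarith) (hxy.trans hy)).le
    (h.lt_of_lt (by linarith) hxy hy) (by positivity)
  one_le x hx hx' := Real.one_le_rpow (h.one_le hx hx') (by positivity)

theorem one_le_rpow_one_sub {lam ν : ℝ} (h : lam ∈ Ioo (0 : ℝ) 1) (hν : ν ∈ Icc (1 : ℝ) 2) :
    1 ≤ lam ^ (1 - ν) :=
  Real.one_le_rpow_of_pos_of_le_one_of_nonpos h.1 h.2.le (by linarith [hν.1])

theorem rpow_one_sub_le {lam ν : ℝ} (h : lam ∈ Ioo (0 : ℝ) 1) (hν : ν ∈ Icc (1 : ℝ) 2) :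
    lam ^ (1 - ν) ≤ 1 / lam := by
  rw [one_div, ← Real.rpow_neg_one]
  exact Real.rpow_le_rpow_of_exponent_ge h.1 h.2.le (by linarith [hν.2])

namespace ChainData

variable {ν r lam a y : ℝ} {p : ℕ} {φ : ℝ → ℝ}

/-- The generating function of the chain. -/
local notation "H" => fun x => φ x ^ (1 / r)

theorem chainFun (h : ChainData ν r p lam a y φ) : ChainFun (1 / lam) H :=
  h.pickNorm.chainFun h.one_lt_r

theorem lam_pos (h : ChainData ν r p lam a y φ) : 0 < lam := h.pickNorm.lam_pos

theorem lam_lt_one (h : ChainData ν r p lam a y φ) : lam < 1 := h.pickNorm.lam_lt_one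

theorem one_le_T (h : ChainData ν r p lam a y φ) : 1 ≤ lam ^ (1 - ν) :=
  one_le_rpow_one_sub h.pickNorm.lam_mem h.ν_mem

theorem T_le (h : ChainData ν r p lam a y φ) : lam ^ (1 - ν) ≤ 1 / lam :=
  rpow_one_sub_le h.pickNorm.lam_mem h.ν_mem

theorem chain_pos (h : ChainData ν r p lam a y φ) {j : ℕ} (hj : j ≤ p) : 0 < chain H lam y j :=
  h.chainFun.chain_pos h.lam_pos h.T_le h.y_pos h.chain_lt j hj

theorem chain_lt_succ (h : ChainData ν r p lam a y φ) {j : ℕ} (hj : j < p) :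
    chain H lam y j < chain H lam y (j + 1) :=
  h.chainFun.chain_lt_succ h.lam_pos (h.lam_lt_one.trans_le h.one_le_T) h.T_le h.y_pos h.chain_lt
    h.chain_eq.ge j hj

theorem chain_le (h : ChainData ν r p lam a y φ) {j : ℕ} (hj : j ≤ p) :
    chain H lam y j ≤ lam ^ (1 - ν) := by
  rcases hj.lt_or_eq with hj | rfl
  · exact (h.chain_lt j hj).le
  · exact h.chain_eq.le

theorem chain_lt_inv (h : ChainData ν r p lam a y φ) {j : ℕ} (hj : j < p) :
    chain H lam y j < 1 / lam := (h.chain_lt j hj).trans_le h.T_le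

theorem H_pos (h : ChainData ν r p lam a y φ) {x : ℝ} (hx : -1 < x) (hx' : x < 1 / lam) :
    0 < (H) x := Real.rpow_pos_of_pos (h.pickNorm.pos hx hx') _

theorem H_lt (h : ChainData ν r p lam a y φ) {x w : ℝ} (hx : -1 < x) (hxw : x < w)
    (hw : w < 1 / lam) : (H) x < (H) w :=
  Real.rpow_lt_rpow (h.pickNorm.pos hx (hxw.trans hw)).le
    (h.pickNorm.lt_of_lt hx.le hxw hw) (one_div_pos.2 (by linarith [h.one_lt_r]))

/-- Orbits starting between `-1` and the second point of the chain. -/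
theorem chain_of_mem (h : ChainData ν r p lam a y φ) {c : ℝ} (hc : c ∈ Ioo (-1) (chain H lam y 1))
    {j : ℕ} (hj : j < p) : chain H c y j ∈ Ioo (-1) (chain H lam y (j + 1)) := by
  induction j with
  | zero => exact hc
  | succ j ih =>
    have h1 := ih (by omega)
    have h2 := h.chain_lt_inv (j := j + 1) (by omega)
    rw [chain_succ H lam y (j + 1), chain_succ H c y j]
    have h3 := h.H_pos h1.1 (h1.2.trans h2)
    exact ⟨by linarith [mul_pos h.y_pos h3],
      mul_lt_mul_of_pos_left (h.H_lt h1.1 h1.2 h2) h.y_pos⟩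

theorem chain_of_mem_lt_inv (h : ChainData ν r p lam a y φ) {c : ℝ}
    (hc : c ∈ Ioo (-1) (chain H lam y 1)) {j : ℕ} (hj : j < p) :
    chain H c y j ∈ Ioo (-1) (1 / lam) :=
  ⟨(h.chain_of_mem hc hj).1, by
    refine (h.chain_of_mem hc hj).2.trans_le ((h.chain_le (by omega)).trans h.T_le)⟩

theorem chain_of_mem_pos (h : ChainData ν r p lam a y φ) {c : ℝ}
    (hc : c ∈ Ioo (-1) (chain H lam y 1)) {j : ℕ} (hj : j < p) : 0 < chain H c y (j + 1) := by
  have h1 := h.chain_of_mem_lt_inv hc hj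
  rw [chain_succ]
  exact mul_pos h.y_pos (h.H_pos h1.1 h1.2)

theorem chain_strictMono (h : ChainData ν r p lam a y φ) {c d : ℝ} (hc : -1 < c) (hcd : c < d)
    (hd : d < chain H lam y 1) {j : ℕ} (hj : j ≤ p) : chain H c y j < chain H d y j := by
  induction j with
  | zero => exact hcd
  | succ j ih =>
    have h1 := h.chain_of_mem_lt_inv ⟨hc, hcd.trans hd⟩ (j := j) (by omega)
    have h2 := h.chain_of_mem_lt_inv ⟨hc.trans hcd, hd⟩ (j := j) (by omega)
    rw [chain_succ, chain_succ]
    exact mul_lt_mul_of_pos_left (h.H_lt h1.1 (ih (by omega)) h2.2) h.y_pos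

theorem H_le_rpow (h : ChainData ν r p lam a y φ) {x : ℝ} (hx : -1 < x) (hx' : x < 1 / lam) :
    (H) x < lam ^ (-ν) := by
  have hr := h.one_lt_r
  obtain ⟨w, hxw, hw⟩ := exists_between hx'
  have h1 := h.le_rpow w (h.pickNorm.Ioo_subset ⟨hx.trans hxw, hw⟩)
  refine (h.H_lt hx hxw hw).trans_le ?_
  calc φ w ^ (1 / r) ≤ (lam ^ (-(r * ν))) ^ (1 / r) :=
        Real.rpow_le_rpow (h.pickNorm.pos (hx.trans hxw) hw).le h1 (by positivity)
    _ = lam ^ (-ν) := by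
        rw [← Real.rpow_mul h.lam_pos.le]; congr 1; field_simp

theorem lam_lt_chain_one (h : ChainData ν r p lam a y φ) : lam < chain H lam y 1 :=
  h.chain_lt_succ (j := 0) h.one_le_p

theorem lam_le_y (h : ChainData ν r p lam a y φ) : lam ≤ y := by
  obtain ⟨n, rfl⟩ : ∃ n, p = n + 1 := ⟨p - 1, by have := h.one_le_p; omega⟩
  have h1 := h.chain_eq
  rw [chain_succ] at h1
  have h2 := h.H_le_rpow (by linarith [h.chain_pos (j := n) (by omega)])
    (h.chain_lt_inv (j := n) (by omega))
  have h3 : lam * lam ^ (-ν) = lam ^ (1 - ν) := by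
    rw [sub_eq_add_neg, Real.rpow_add h.lam_pos, Real.rpow_one]
  have h4 := Real.rpow_pos_of_pos h.lam_pos (-ν)
  by_contra! hlt
  have := mul_lt_mul_of_pos_left h2 h.y_pos
  nlinarith

theorem zero_mem (h : ChainData ν r p lam a y φ) : (0 : ℝ) ∈ Ioo (-1) (chain H lam y 1) :=
  ⟨by norm_num, h.lam_pos.trans h.lam_lt_chain_one⟩

theorem y_le_chain (h : ChainData ν r p lam a y φ) {j : ℕ} (hj : j < p) :
    y ≤ chain H 0 y (j + 1) := by
  have h0 : 0 ≤ chain H 0 y j := by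
    cases j with
    | zero => simp
    | succ j => exact (h.chain_of_mem_pos h.zero_mem (j := j) (by omega)).le
  have h1 := h.chainFun.one_le _ h0 (h.chain_of_mem_lt_inv h.zero_mem hj).2
  rw [chain_succ]
  nlinarith [h.y_pos]

theorem chain_lt_chain (h : ChainData ν r p lam a y φ) {j : ℕ} (hj : j ≤ p) :
    chain H 0 y j < chain H lam y j :=
  h.chain_strictMono (by norm_num) h.lam_pos h.lam_lt_chain_one hj

theorem rpow_mul_T (h : ChainData ν r p lam a y φ) : lam ^ (ν - 1) * lam ^ (1 - ν) = 1 := by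
  rw [← Real.rpow_add h.lam_pos]; simp

theorem fixed_point_mem (h : ChainData ν r p lam a y φ) :
    lam ^ (ν - 1) * chain H 0 y p ∈ Ioo (0 : ℝ) 1 := by
  have h0 := Real.rpow_pos_of_pos h.lam_pos (ν - 1)
  have h1 := h.chain_lt_chain le_rfl
  rw [h.chain_eq] at h1
  obtain ⟨n, rfl⟩ : ∃ n, p = n + 1 := ⟨p - 1, by have := h.one_le_p; omega⟩
  have h2 := h.y_le_chain (j := n) (by omega)
  refine ⟨mul_pos h0 (h.y_pos.trans_le h2), ?_⟩
  calc _ < lam ^ (ν - 1) * lam ^ (1 - ν) := by gcongr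
    _ = 1 := h.rpow_mul_T

theorem y_mul_le (h : ChainData ν r p lam a y φ) :
    y * lam ^ (ν - 1) ≤ lam ^ (ν - 1) * chain H 0 y p := by
  obtain ⟨n, rfl⟩ : ∃ n, p = n + 1 := ⟨p - 1, by have := h.one_le_p; omega⟩
  have h2 := h.y_le_chain (j := n) (by omega)
  rw [mul_comm]
  have h0 := Real.rpow_pos_of_pos h.lam_pos (ν - 1)
  gcongr

theorem y_mul_mem (h : ChainData ν r p lam a y φ) : y * lam ^ (ν - 1) ∈ Ioo (0 : ℝ) 1 :=
  ⟨mul_pos h.y_pos (Real.rpow_pos_of_pos h.lam_pos _),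
    h.y_mul_le.trans_lt h.fixed_point_mem.2⟩

theorem rpow_le_fixed_point (h : ChainData ν r p lam a y φ) :
    lam ^ ν ≤ lam ^ (ν - 1) * chain H 0 y p := by
  refine le_trans ?_ h.y_mul_le
  have h0 := Real.rpow_pos_of_pos h.lam_pos (ν - 1)
  calc lam ^ ν = lam * lam ^ (ν - 1) := by
        rw [← Real.rpow_one_add' h.lam_pos.le (by linarith [h.ν_mem.1])]; congr 1; ring
    _ ≤ y * lam ^ (ν - 1) := by have := h.lam_le_y; gcongr

theorem quarter_le_y (h : ChainData ν r p lam a y φ) (hlam : lam ≤ 1 / 16) : 1 / 4 ≤ y := by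
  have hH1 : (H) 1 ≤ 4 := by
    have h1 := h.pickNorm.one_le_mul
    have h2 := h.pickNorm.one_le (x := 1) zero_le_one h.pickNorm.one_lt_inv_lam
    have hr := h.one_lt_r
    calc φ 1 ^ (1 / r) ≤ φ 1 ^ (1 : ℝ) :=
          Real.rpow_le_rpow_of_exponent_le h2 (by rw [div_le_one (by linarith)]; exact hr.le)
      _ = φ 1 := Real.rpow_one _
      _ ≤ 4 := by nlinarith
  by_contra! hy
  have hH0 := h.H_pos (x := 1) (by norm_num) h.pickNorm.one_lt_inv_lam
  have key : ∀ j ≤ p, chain H lam y j < 1 := by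
    intro j
    induction j with
    | zero => intro _; exact h.lam_lt_one
    | succ j ih =>
      intro hj
      have h1 := ih (by omega)
      rw [chain_succ]
      have h2 := h.H_lt (by linarith [h.chain_pos (j := j) (by omega)]) h1
        h.pickNorm.one_lt_inv_lam
      have h3 := mul_lt_mul_of_pos_left h2 h.y_pos
      simp only at hH1 h3 hH0 ⊢
      nlinarith
  have := key p le_rfl
  rw [h.chain_eq] at this
  linarith [h.one_le_T]

end ChainData

end ChainData

section ChainEstimates

namespace ChainData

variable {ν r lam a y : ℝ} {p : ℕ} {φ : ℝ → ℝ}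

/-- The generating function of the chain. -/
local notation "H" => fun x => φ x ^ (1 / r)

theorem one_sub_ratio_le (h : ChainData ν r p lam a y φ) {x w : ℝ} (hx : 0 < x) (hxw : x < w)
    (hw1 : w ≤ 1) : 1 - (H) x / (H) w ≤ 4 * r * (1 - x / w) := by
  have hr := h.one_lt_r
  have hl0 := h.lam_pos
  have hl1 := h.lam_lt_one
  have hw : w < 1 / lam := hw1.trans_lt h.pickNorm.one_lt_inv_lam
  have hφx := h.pickNorm.one_le hx.le (hxw.trans hw)
  have hφw := h.pickNorm.lt_of_lt (by linarith) hxw hw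
  have hφx0 : 0 < φ x := by linarith
  have hφw0 : 0 < φ w := by linarith
  have h1 : φ x / φ w ≤ (H) x / (H) w := by
    simp only
    rw [← Real.div_rpow hφx0.le hφw0.le]
    have : φ x / φ w ≤ 1 := by rw [div_le_one hφw0]; exact hφw.le
    conv_lhs => rw [← Real.rpow_one (φ x / φ w)]
    exact Real.rpow_le_rpow_of_exponent_ge (by positivity) this
      (by rw [div_le_one (by linarith)]; exact hr.le)
  set K := lam ^ (-(r * ν)) with hK
  have hK0 : 0 < K := Real.rpow_pos_of_pos hl0 _
  have h2 := h.pickNorm.ratio_le_of_le h.le_rpow (by linarith : -1 < x) hxw hw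
  have h3 : K - φ x ≤ r * ν * (1 - lam) * K := by
    have hb := one_add_mul_self_le_rpow_one_add (s := lam - 1) (by linarith) (p := r * ν)
      (by nlinarith [h.ν_mem.1])
    rw [add_sub_cancel] at hb
    have hKi : K * lam ^ (r * ν) = 1 := by
      rw [hK, ← Real.rpow_add hl0]; simp
    nlinarith
  have hν0 := h.ν_mem.1
  have hν2 := h.ν_mem.2
  have h4 : (φ w - φ x) * K * (1 - lam * x) * (1 + w) ≤
      φ w * (r * ν * (1 - lam) * K) * (w - x) * (1 + lam) := by
    refine h2.trans ?_
    have : 0 ≤ w - x := by linarith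
    gcongr
  have h5 : (φ w - φ x) * w ≤ 4 * r * φ w * (w - x) := by
    have e1 : (φ w - φ x) * w * ((1 - lam) * K) ≤ (φ w - φ x) * K * (1 - lam * x) * (1 + w) := by
      have i1 : 1 - lam ≤ 1 - lam * x := by nlinarith
      have i2 : w ≤ 1 + w := by linarith
      have i3 : 0 ≤ φ w - φ x := by linarith
      have i4 : 0 ≤ 1 - lam := by linarith
      have i5 : 0 < w := by linarith
      calc (φ w - φ x) * w * ((1 - lam) * K) = (φ w - φ x) * K * (1 - lam) * w := by ring
        _ ≤ (φ w - φ x) * K * (1 - lam * x) * (1 + w) := by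
          gcongr
          exact mul_nonneg (by positivity) (i4.trans i1)
    have e2 : φ w * (r * ν * (1 - lam) * K) * (w - x) * (1 + lam) ≤
        4 * r * φ w * (w - x) * ((1 - lam) * K) := by
      have i1 : ν * (1 + lam) ≤ 4 := by nlinarith
      have i2 : 0 ≤ r * φ w * (w - x) * ((1 - lam) * K) := by
        have : 0 ≤ w - x := by linarith
        have : 0 ≤ 1 - lam := by linarith
        positivity
      nlinarith
    have i6 : 0 < (1 - lam) * K := mul_pos (by linarith) hK0
    exact le_of_mul_le_mul_right (e1.trans (h4.trans e2)) i6
  have hw0 : 0 < w := by linarith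
  calc 1 - (H) x / (H) w ≤ 1 - φ x / φ w := by linarith
    _ ≤ 4 * r * (1 - x / w) := by
      rw [one_sub_div hφw0.ne', one_sub_div hw0.ne', mul_div_assoc', div_le_div_iff₀ hφw0 hw0]
      linarith

/-- A lower bound for the first relative increment of the chain. -/
theorem one_sub_lam_le (h : ChainData ν r p lam a y φ) :
    1 - lam ≤ p * (4 * r) ^ p * (1 - lam / chain H lam y 1) := by
  by_contra! hlt
  have hr := h.one_lt_r
  set C := 4 * r with hC
  have hC1 : 1 ≤ C := by linarith
  set δ := 1 - lam / chain H lam y 1 with hδ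
  have hδ0 : 0 < δ := by
    rw [hδ, sub_pos, div_lt_one (h.lam_pos.trans h.lam_lt_chain_one)]
    exact h.lam_lt_chain_one
  have key : ∀ j < p, 1 - chain H lam y j / chain H lam y (j + 1) ≤ C ^ j * δ ∧
      chain H lam y (j + 1) ≤ lam + (j + 1) * (C ^ p * δ) := by
    have step : ∀ j < p, 1 - chain H lam y j / chain H lam y (j + 1) ≤ C ^ j * δ →
        chain H lam y j ≤ lam + j * (C ^ p * δ) →
        chain H lam y (j + 1) ≤ lam + (j + 1) * (C ^ p * δ) := by
      intro j hj h1 h2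
      have h3 : C ^ j * δ ≤ C ^ p * δ := by gcongr
      have h5 := h.chain_pos (j := j + 1) (by omega)
      have h5' := h.chain_pos (j := j) (by omega)
      have hjp : ((j : ℝ) + 1) ≤ p := by exact_mod_cast hj
      have h6 : lam + (j + 1) * (C ^ p * δ) < 1 := by
        have : ((j : ℝ) + 1) * (C ^ p * δ) ≤ p * (C ^ p * δ) := by gcongr
        linarith
      by_cases hle : chain H lam y (j + 1) ≤ 1
      · have h4 : chain H lam y (j + 1) - chain H lam y j ≤ C ^ p * δ := by
          have e : chain H lam y (j + 1) - chain H lam y j =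
            (1 - chain H lam y j / chain H lam y (j + 1)) * chain H lam y (j + 1) := by
              field_simp
          rw [e]
          have : 0 ≤ C ^ p * δ := by positivity
          nlinarith
        linarith
      · push Not at hle
        exfalso
        have : chain H lam y j / chain H lam y (j + 1) ≤ chain H lam y j :=
          div_le_self h5'.le hle.le
        linarith
    intro j
    induction j with
    | zero =>
      intro hj
      have h0 : 1 - chain H lam y 0 / chain H lam y (0 + 1) ≤ C ^ 0 * δ := by simp [hδ]
      exact ⟨h0, by simpa using step 0 hj h0 (by simp)⟩
    | succ j ih =>
      intro hj
      obtain ⟨h1, h2⟩ := ih (by omega)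
      have hjp : ((j : ℝ) + 1) ≤ p := by exact_mod_cast (by omega : j + 1 ≤ p)
      have h6 : lam + (j + 1) * (C ^ p * δ) < 1 := by
        have : ((j : ℝ) + 1) * (C ^ p * δ) ≤ p * (C ^ p * δ) := by gcongr
        linarith
      have h0 : 1 - chain H lam y (j + 1) / chain H lam y (j + 1 + 1) ≤ C ^ (j + 1) * δ := by
        have h7 := h.one_sub_ratio_le (h.chain_pos (j := j) (by omega))
          (h.chain_lt_succ (j := j) (by omega)) (by linarith)
        have e : chain H lam y (j + 1) / chain H lam y (j + 1 + 1) =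
            (H) (chain H lam y j) / (H) (chain H lam y (j + 1)) := by
          rw [chain_succ H lam y (j + 1), chain_succ H lam y j, mul_div_mul_left _ _ h.y_pos.ne']
        rw [e]
        refine h7.trans ?_
        rw [pow_succ', mul_assoc C, ← hC]
        exact mul_le_mul_of_nonneg_left h1 (by positivity)
      exact ⟨h0, step _ hj h0 (by push_cast; exact h2)⟩
  obtain ⟨n, rfl⟩ : ∃ n, p = n + 1 := ⟨p - 1, by have := h.one_le_p; omega⟩
  have h1 := (key n (by omega)).2
  rw [h.chain_eq] at h1
  have := h.one_le_T
  push_cast at hlt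
  linarith

theorem one_add_rpow_ge {r u : ℝ} (hr : 1 < r) (hu0 : 0 ≤ u) (hu1 : u ≤ 1) :
    1 + ((2 : ℝ) ^ (1 / r) - 1) * u ≤ (1 + u) ^ (1 / r) := by
  have hc := Real.concaveOn_rpow (p := 1 / r) (by positivity)
    (by rw [div_le_one (by linarith)]; exact hr.le)
  have := hc.2 (show (1 : ℝ) ∈ Ici 0 by simp) (show (2 : ℝ) ∈ Ici 0 by simp)
    (show 0 ≤ 1 - u by linarith) hu0 (by ring)
  simp only [smul_eq_mul, Real.one_rpow, mul_one] at this
  have e : 1 - u + u * 2 = 1 + u := by ring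
  rw [e] at this
  linarith

/-- If `φ` extends as a Pick function to a large interval then the fixed point stays away
from `1`. -/
theorem fixed_point_le (h : ChainData ν r p lam a y φ) (hlam : lam ≤ 1 / 16)
    (hφ : ∀ x w, 0 ≤ x → x < w → w < 1 / lam →
      φ x * (1 + 8 * lam * x) * (1 + w) ≤ φ w * (1 + x) * (1 + 8 * lam * w)) :
    (((2 : ℝ) ^ (1 / r) - 1) / 90) ^ p * lam / 2 ≤ 1 - lam ^ (ν - 1) * chain H 0 y p := by
  have hr := h.one_lt_r
  have hl0 := h.lam_pos
  set κ := (2 : ℝ) ^ (1 / r) - 1 with hκ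
  have hκ0 : 0 < κ := by
    rw [hκ, sub_pos]; exact Real.one_lt_rpow (by norm_num) (by positivity)
  have hκ1 : κ ≤ 1 := by
    have : (2 : ℝ) ^ (1 / r) ≤ 2 ^ (1 : ℝ) := Real.rpow_le_rpow_of_exponent_le (by norm_num)
      (by rw [div_le_one (by linarith)]; exact hr.le)
    rw [Real.rpow_one] at this; linarith
  have hy := h.quarter_le_y hlam
  have hφr : ∀ x w u : ℝ, 0 ≤ x → x < w → w < 1 / lam → 0 ≤ u → u ≤ 1 →
      u * ((1 + x) * (1 + 8 * lam * w)) ≤ (1 - 8 * lam) * (w - x) →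
      1 + κ * u ≤ (H) w / (H) x := by
    intro x w u hx hxw hw hu0 hu1 hu
    have h1 := hφ x w hx hxw hw
    have hφx : 0 < φ x := h.pickNorm.pos (by linarith) (hxw.trans hw)
    have hφw : 0 < φ w := h.pickNorm.pos (by linarith) hw
    have h2 : 1 + u ≤ φ w / φ x := by
      rw [le_div_iff₀ hφx]
      have hD : 0 < (1 + x) * (1 + 8 * lam * w) := by
        have : 0 < w := by linarith
        positivity
      refine le_of_mul_le_mul_right ?_ hD
      have e : (1 + 8 * lam * x) * (1 + w) = (1 + x) * (1 + 8 * lam * w) +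
          (1 - 8 * lam) * (w - x) := by ring
      have h3 : (1 + u) * ((1 + x) * (1 + 8 * lam * w)) ≤ (1 + 8 * lam * x) * (1 + w) := by
        rw [e]; linarith
      nlinarith
    simp only
    rw [← Real.div_rpow hφw.le hφx.le]
    exact (one_add_rpow_ge hr hu0 hu1).trans
      (Real.rpow_le_rpow (by linarith) h2 (by positivity))
  have key : ∀ j < p, 1 + (κ / 90) ^ (j + 1) * lam ≤
      chain H lam y (j + 1) / chain H 0 y (j + 1) := by
    intro j
    induction j with
    | zero =>
      intro _
      have h1 := hφr 0 lam (lam / 90) le_rfl hl0 (h.lam_lt_one.trans h.pickNorm.one_lt_inv_lam)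
        (by positivity) (by linarith) (by
          have : lam * lam ≤ 1 := by nlinarith
          have : lam * (lam * lam) ≤ lam * 1 := by gcongr
          nlinarith)
      rw [chain_succ, chain_succ, mul_div_mul_left _ _ h.y_pos.ne', chain_zero, chain_zero]
      refine le_trans (le_of_eq ?_) h1
      ring
    | succ j ih =>
      intro hj
      have h1 := ih (by omega)
      set u := (κ / 90) ^ (j + 1) * lam with hu
      have hu0 : 0 ≤ u := by positivity
      have hu1 : u ≤ 1 := by
        have : (κ / 90) ^ (j + 1) ≤ 1 := pow_le_one₀ (by positivity) (by linarith)
        nlinarith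
      set X := chain H 0 y (j + 1) with hX
      set W := chain H lam y (j + 1) with hW
      have hX4 : 1 / 4 ≤ X := hy.trans (h.y_le_chain (j := j) (by omega))
      have hXW : X < W := h.chain_lt_chain (by omega)
      have hWl : W < 1 / lam := h.chain_lt_inv hj
      have hWl' : lam * W < 1 := by rwa [lt_div_iff₀ hl0, mul_comm] at hWl
      rw [le_div_iff₀ (by linarith)] at h1
      rw [chain_succ H lam y (j + 1), chain_succ H 0 y (j + 1), mul_div_mul_left _ _ h.y_pos.ne',
        ← hX, ← hW]
      refine le_trans (le_of_eq ?_) (hφr X W (u / 90) (by linarith) hXW hWl (by positivity)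
        (by linarith) ?_)
      · rw [hu]; ring
      · have e1 : (1 + X) * (1 + 8 * lam * W) ≤ 5 * X * 9 := by
          apply mul_le_mul <;> nlinarith
        have e2 : u / 90 * ((1 + X) * (1 + 8 * lam * W)) ≤ u / 90 * (5 * X * 9) := by gcongr
        have e3 : 1 / 2 * (u * X) ≤ (1 - 8 * lam) * (W - X) := by
          apply mul_le_mul <;> nlinarith
        linarith
  obtain ⟨n, rfl⟩ : ∃ n, p = n + 1 := ⟨p - 1, by have := h.one_le_p; omega⟩
  have h1 := key n (by omega)
  have hX := h.y_pos.trans_le (h.y_le_chain (j := n) (by omega))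
  have hT := h.rpow_mul_T
  rw [h.chain_eq] at h1
  set u := (κ / 90) ^ (n + 1) * lam with hu
  have hu0 : 0 ≤ u := by positivity
  have hu1 : u ≤ 1 := by
    have : (κ / 90) ^ (n + 1) ≤ 1 := pow_le_one₀ (by positivity) (by linarith)
    nlinarith [h.lam_lt_one]
  rw [le_div_iff₀ hX] at h1
  have h0 := Real.rpow_pos_of_pos h.lam_pos (ν - 1)
  have h2 := mul_le_mul_of_nonneg_left h1 h0.le
  rw [hT] at h2
  have h3 := h.fixed_point_mem
  set z := lam ^ (ν - 1) * chain H 0 y (n + 1) with hz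
  have h4 : (1 + u) * z ≤ 1 := by linarith
  nlinarith [h3.1]

end ChainData

end ChainEstimates

section HerglotzAlgebra

variable {s t s' t' : ℝ} {f g : ℂ → ℂ}

theorem Herglotzian.mono (hf : Herglotzian s' t' f) (hs : s' ≤ s) (ht : t ≤ t') :
    Herglotzian s t f :=
  ⟨hf.1.mono (Omega_mono hs ht), fun z hz => hf.2.1 z (Omega_mono hs ht hz),
    fun z hz => hf.2.2 z (Omega_mono hs ht hz)⟩

theorem AntiHerglotzian.mono (hf : AntiHerglotzian s' t' f) (hs : s' ≤ s) (ht : t ≤ t') :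
    AntiHerglotzian s t f :=
  ⟨hf.1.mono (Omega_mono hs ht), fun z hz => hf.2.1 z (Omega_mono hs ht hz),
    fun z hz => hf.2.2 z (Omega_mono hs ht hz)⟩

theorem AntiHerglotzian.congr (hf : AntiHerglotzian s t f) (h : ∀ z ∈ Omega s t, g z = f z) :
    AntiHerglotzian s t g :=
  ⟨hf.1.congr h, fun z hz => by rw [h _ (conj_mem_Omega hz), h _ hz, hf.2.1 z hz],
    fun z hz h0 => by rw [h z hz]; exact hf.2.2 z hz h0⟩

theorem AntiHerglotzian.im_ofReal (hf : AntiHerglotzian s t f) {x : ℝ}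
    (hx : x ∈ Ioo s t) : (f x).im = 0 := by
  simpa using hf.neg.im_ofReal hx

theorem AntiHerglotzian.eq_ofReal (hf : AntiHerglotzian s t f) {x : ℝ}
    (hx : x ∈ Ioo s t) : f x = ((f x).re : ℂ) :=
  Complex.ext rfl (by simp [hf.im_ofReal hx])

theorem neg_mem_Omega {z : ℂ} (hz : z ∈ Omega (-t) (-s)) : -z ∈ Omega s t := by
  rw [mem_Omega_iff] at *
  simp only [neg_im, neg_re, ne_eq, neg_eq_zero, mem_Ioo] at *
  exact hz.imp_right fun h => ⟨by linarith [h.2], by linarith [h.1]⟩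

theorem AntiHerglotzian.comp_neg (hf : AntiHerglotzian s t f) :
    Herglotzian (-t) (-s) (fun z => f (-z)) := by
  refine ⟨hf.1.comp (by fun_prop) fun z hz => neg_mem_Omega hz, fun z hz => ?_, fun z hz h => ?_⟩
  · beta_reduce
    rw [← map_neg]; exact hf.2.1 _ (neg_mem_Omega hz)
  · have h1 := hf.2.1 _ (neg_mem_Omega hz)
    have h2 := hf.2.2 _ (conj_mem_Omega (neg_mem_Omega hz)) (by simpa using h)
    rw [h1] at h2
    simpa using h2

theorem Herglotzian.comp_neg (hf : Herglotzian s t f) :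
    AntiHerglotzian (-t) (-s) (fun z => f (-z)) := by
  have := hf.neg.comp_neg.neg
  simpa using this

theorem Herglotzian.const_mul (hf : Herglotzian s t f) {c : ℝ} (hc : 0 ≤ c) :
    Herglotzian s t (fun z => c * f z) := by
  refine ⟨hf.1.const_mul _, fun z hz => ?_, fun z hz h => ?_⟩
  · beta_reduce
    rw [hf.2.1 z hz, map_mul, conj_ofReal]
  · simpa using mul_nonneg hc (hf.2.2 z hz h)

theorem AntiHerglotzian.const_mul (hf : AntiHerglotzian s t f) {c : ℝ} (hc : 0 ≤ c) :
    AntiHerglotzian s t (fun z => c * f z) := by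
  simpa using (hf.neg.const_mul hc).neg

theorem AntiHerglotzian.add (hf : AntiHerglotzian s t f) (hg : AntiHerglotzian s t g) :
    AntiHerglotzian s t (fun z => f z + g z) := by
  refine ⟨hf.1.add hg.1, fun z hz => ?_, fun z hz h => ?_⟩
  · beta_reduce
    rw [hf.2.1 z hz, hg.2.1 z hz, map_add]
  · beta_reduce
    rw [add_im]; exact add_nonpos (hf.2.2 z hz h) (hg.2.2 z hz h)

theorem antiHerglotzian_one_sub : AntiHerglotzian s t (fun z => 1 - z) :=
  ⟨by fun_prop, fun z _ => by simp, fun z _ h => by simpa using h.le⟩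

theorem herglotzian_const_mul_id {c : ℝ} (hc : 0 ≤ c) : Herglotzian s t (fun z => c * z) :=
  ⟨by fun_prop, fun z _ => by simp, fun z _ h => by simpa using mul_nonneg hc h.le⟩

theorem Herglotzian.mapsTo (hf : Herglotzian s t f) {x y : ℝ} (hx : x ∈ Ioo s t)
    (hy : y ∈ Ioo s t) (hxy : f x ≠ f y) (h : ∀ x ∈ Ioo s t, (f x).re ∈ Ioo s' t') :
    MapsTo f (Omega s t) (Omega s' t') := by
  intro z hz
  by_cases him : z.im = 0
  · have hzr : z = (z.re : ℂ) := Complex.ext rfl (by simp [him])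
    rw [hzr] at hz ⊢
    have h1 := ofReal_mem_Omega.1 hz
    rw [hf.eq_ofReal h1]
    exact ofReal_mem_Omega.2 (h _ h1)
  · refine mem_Omega_of_im_ne ?_
    rcases lt_or_gt_of_ne him with h0 | h0
    · have h1 := hf.im_pos hx hy hxy (z := (starRingEnd ℂ) z) (by simpa using h0)
      rw [hf.2.1 z hz] at h1
      intro h2
      simp [h2] at h1
    · exact (hf.im_pos hx hy hxy h0).ne'

theorem Herglotzian.comp (hg : Herglotzian s' t' g) (hf : Herglotzian s t f)
    (hm : MapsTo f (Omega s t) (Omega s' t')) : Herglotzian s t (fun z => g (f z)) := by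
  refine ⟨hg.1.comp hf.1 hm, fun z hz => ?_, fun z hz h => ?_⟩
  · beta_reduce
    rw [hf.2.1 z hz, hg.2.1 _ (hm hz)]
  · rcases (hf.2.2 z hz h).lt_or_eq with h0 | h0
    · exact hg.2.2 _ (hm hz) h0
    · have hzr : f z = ((f z).re : ℂ) := Complex.ext rfl (by simp [← h0])
      have h1 := hm hz
      beta_reduce
      rw [hzr] at h1 ⊢
      exact (hg.im_ofReal (ofReal_mem_Omega.1 h1)).ge

theorem AntiHerglotzian.comp (hg : AntiHerglotzian s' t' g) (hf : Herglotzian s t f)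
    (hm : MapsTo f (Omega s t) (Omega s' t')) : AntiHerglotzian s t (fun z => g (f z)) := by
  simpa using (hg.neg.comp hf hm).neg

theorem Herglotzian.cpow (hf : Herglotzian s t f) (hm : MapsTo f (Omega s t) slitPlane) {q : ℝ}
    (hq0 : 0 ≤ q) (hq1 : q ≤ 1) : Herglotzian s t (fun z => f z ^ (q : ℂ)) := by
  refine ⟨hf.1.cpow_const hm, fun z hz => ?_, fun z hz h => ?_⟩
  · beta_reduce
    have h1 : (f z).arg ≠ Real.pi := (mem_slitPlane_iff_arg.1 (hm hz)).1
    rw [hf.2.1 z hz, conj_cpow _ _ h1, conj_ofReal]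
  · beta_reduce
    have h1 : f z ≠ 0 := slitPlane_ne_zero (hm hz)
    rw [cpow_def_of_ne_zero h1, exp_im]
    refine mul_nonneg (Real.exp_pos _).le (Real.sin_nonneg_of_nonneg_of_le_pi ?_ ?_)
    · have := arg_nonneg_iff.2 (hf.2.2 z hz h)
      simp only [mul_im, log_im, ofReal_re, ofReal_im, mul_zero, zero_add]
      positivity
    · have h2 := arg_nonneg_iff.2 (hf.2.2 z hz h)
      have h3 := arg_le_pi (f z)
      simp only [mul_im, log_im, ofReal_re, ofReal_im, mul_zero, zero_add]
      nlinarith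

end HerglotzAlgebra

section NormPsi

/-- Anti-Herglotz functions on `Omega (-1/lam) (1/a)` normalised by `ψ 0 = 1`, `ψ 1 = 0`. -/
structure NormPsi (lam a : ℝ) (ψ : ℂ → ℂ) : Prop where
  lam_mem : lam ∈ Ioo (0 : ℝ) 1
  a_mem : a ∈ Ioo (0 : ℝ) 1
  anti : AntiHerglotzian (-1 / lam) (1 / a) ψ
  zero : ψ 0 = 1
  one : ψ 1 = 0

/-- The real function `x ↦ ψ (-x)`. -/
def reflRe (ψ : ℂ → ℂ) (x : ℝ) : ℝ := (ψ (-(x : ℂ))).re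

/-- The function `ǔ`. -/
def uCheck (ψ : ℂ → ℂ) (r y : ℝ) (w : ℂ) : ℂ := y * ψ (-w) ^ ((1 / r : ℝ) : ℂ)

namespace NormPsi

variable {lam a r y : ℝ} {ψ : ℂ → ℂ}

theorem herglotzian (h : NormPsi lam a ψ) :
    Herglotzian (-(1 / a)) (1 / lam) (fun z => ψ (-z)) := by
  have := h.anti.comp_neg
  rwa [neg_div, neg_neg] at this

theorem pickNorm (h : NormPsi lam a ψ) : PickNorm lam a (reflRe ψ) where
  lam_mem := h.lam_mem
  a_mem := h.a_mem
  exists_pickOn := ⟨_, h.herglotzian.pickOn⟩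
  neg_one := by simp [reflRe, h.one]
  zero := by simp [reflRe, h.zero]

theorem eq_reflRe (h : NormPsi lam a ψ) {x : ℝ} (hx : x ∈ Ioo (-(1 / a)) (1 / lam)) :
    ψ (-(x : ℂ)) = (reflRe ψ x : ℂ) := h.herglotzian.eq_ofReal hx

theorem refl_zero_ne (h : NormPsi lam a ψ) :
    (fun z => ψ (-z)) ((0 : ℝ) : ℂ) ≠ (fun z => ψ (-z)) ((-1 : ℝ) : ℂ) := by
  simp [h.zero, h.one]

theorem mapsTo_slitPlane (h : NormPsi lam a ψ) :
    MapsTo (fun z => ψ (-z)) (Omega (-1) (1 / lam)) slitPlane := by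
  have h1 := h.pickNorm.one_lt_inv_lam
  have h2 := h.pickNorm.neg_inv_a_lt
  intro z hz
  by_cases him : z.im = 0
  · have hzr : z = (z.re : ℂ) := Complex.ext rfl (by simp [him])
    rw [hzr] at hz ⊢
    have h3 := ofReal_mem_Omega.1 hz
    beta_reduce
    rw [h.eq_reflRe (h.pickNorm.Ioo_subset h3)]
    exact ofReal_mem_slitPlane.2 (h.pickNorm.pos h3.1 h3.2)
  · refine mem_slitPlane_iff.2 (Or.inr ?_)
    have h4 : (0 : ℝ) ∈ Ioo (-(1 / a)) (1 / lam) := ⟨by linarith, by linarith⟩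
    have h5 : (-1 : ℝ) ∈ Ioo (-(1 / a)) (1 / lam) := ⟨by linarith, by linarith⟩
    rcases lt_or_gt_of_ne him with h0 | h0
    · have h6 := h.herglotzian.im_pos h4 h5 h.refl_zero_ne (z := (starRingEnd ℂ) z)
        (by simpa using h0)
      have h7 := h.herglotzian.2.1 z (mem_Omega_of_im_ne him)
      beta_reduce at h6 h7 ⊢
      rw [h7] at h6
      intro h8
      simp [h8] at h6
    · exact (h.herglotzian.im_pos h4 h5 h.refl_zero_ne h0).ne'

theorem herglotzian_uCheck (h : NormPsi lam a ψ) (hr : 1 < r) (hy : 0 ≤ y) :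
    Herglotzian (-1) (1 / lam) (uCheck ψ r y) :=
  ((h.herglotzian.mono h.pickNorm.neg_inv_a_lt.le le_rfl).cpow h.mapsTo_slitPlane
    (by positivity) (by rw [div_le_one (by linarith)]; exact hr.le)).const_mul hy

theorem uCheck_ofReal (h : NormPsi lam a ψ) {x : ℝ} (hx : x ∈ Ioo (-1) (1 / lam)) :
    uCheck ψ r y x = ((y * reflRe ψ x ^ (1 / r) : ℝ) : ℂ) := by
  rw [uCheck, h.eq_reflRe (h.pickNorm.Ioo_subset hx),
    ← ofReal_cpow (h.pickNorm.pos hx.1 hx.2).le]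
  push_cast
  ring

end NormPsi

end NormPsi

section Renormalization

/-- The map `z ↦ λ^(ν-1) ǔ^p (λ z)`. -/
def qMap (ν r : ℝ) (p : ℕ) (lam y : ℝ) (ψ : ℂ → ℂ) (z : ℂ) : ℂ :=
  ((lam ^ (ν - 1) : ℝ) : ℂ) * (uCheck ψ r y)^[p] (lam * z)

/-- The restriction of `qMap` to the real line. -/
def qRe (ν r : ℝ) (p : ℕ) (lam y : ℝ) (φ : ℝ → ℝ) (x : ℝ) : ℝ :=
  lam ^ (ν - 1) * chain (fun x => φ x ^ (1 / r)) (lam * x) y p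

/-- The end point `W / λ` of the domain of `qMap`, where `W` is the second point of the chain. -/
def qEnd (r lam y : ℝ) (φ : ℝ → ℝ) : ℝ := chain (fun x => φ x ^ (1 / r)) lam y 1 / lam

variable {ν r lam a y : ℝ} {p : ℕ} {ψ : ℂ → ℂ} {φ : ℝ → ℝ}

/-- The generating function of the chain. -/
local notation "H" => fun x => φ x ^ (1 / r)

/-- The generating function of the chain. -/
local notation "K" => fun x => reflRe ψ x ^ (1 / r)

namespace ChainData

theorem mul_mem (h : ChainData ν r p lam a y φ) {x : ℝ}
    (hx : x ∈ Ioo (-1 / lam) (qEnd r lam y φ)) :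
    lam * x ∈ Ioo (-1) (chain H lam y 1) := by
  have h1 := hx.1
  have h2 := hx.2
  rw [div_lt_iff₀ h.lam_pos] at h1
  rw [qEnd, lt_div_iff₀ h.lam_pos] at h2
  exact ⟨by linarith, by linarith⟩

theorem one_lt_qEnd (h : ChainData ν r p lam a y φ) : 1 < qEnd r lam y φ := by
  rw [qEnd, lt_div_iff₀ h.lam_pos, one_mul]
  exact h.lam_lt_chain_one

theorem neg_one_div_lt (h : ChainData ν r p lam a y φ) : -1 / lam < -1 := by
  rw [div_lt_iff₀ h.lam_pos]; linarith [h.lam_lt_one]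

theorem qRe_pos (h : ChainData ν r p lam a y φ) {x : ℝ}
    (hx : x ∈ Ioo (-1 / lam) (qEnd r lam y φ)) : 0 < qRe ν r p lam y φ x := by
  obtain ⟨n, rfl⟩ : ∃ n, p = n + 1 := ⟨p - 1, by have := h.one_le_p; omega⟩
  exact mul_pos (Real.rpow_pos_of_pos h.lam_pos _)
    (h.chain_of_mem_pos (h.mul_mem hx) (by omega))

theorem qRe_one (h : ChainData ν r p lam a y φ) : qRe ν r p lam y φ 1 = 1 := by
  rw [qRe, mul_one, h.chain_eq, h.rpow_mul_T]

theorem qRe_zero_mem (h : ChainData ν r p lam a y φ) : qRe ν r p lam y φ 0 ∈ Ioo (0 : ℝ) 1 := by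
  rw [qRe, mul_zero]; exact h.fixed_point_mem

theorem qRe_lt (h : ChainData ν r p lam a y φ) {x w : ℝ} (hx : -1 / lam < x) (hxw : x < w)
    (hw : w < qEnd r lam y φ) : qRe ν r p lam y φ x < qRe ν r p lam y φ w := by
  refine mul_lt_mul_of_pos_left ?_ (Real.rpow_pos_of_pos h.lam_pos _)
  exact h.chain_strictMono (h.mul_mem ⟨hx, hxw.trans hw⟩).1
    (mul_lt_mul_of_pos_left hxw h.lam_pos) (h.mul_mem ⟨hx.trans hxw, hw⟩).2 le_rfl

/-- The bound `Q x < y / λ`. -/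
theorem qRe_lt_div (h : ChainData ν r p lam a y φ) {x : ℝ}
    (hx : x ∈ Ioo (-1 / lam) (qEnd r lam y φ)) : qRe ν r p lam y φ x < y / lam := by
  obtain ⟨n, rfl⟩ : ∃ n, p = n + 1 := ⟨p - 1, by have := h.one_le_p; omega⟩
  have h1 := h.chain_of_mem_lt_inv (h.mul_mem hx) (j := n) (by omega)
  have h2 := h.H_le_rpow h1.1 h1.2
  have h3 : lam ^ (ν - 1) * lam ^ (-ν) = 1 / lam := by
    rw [← Real.rpow_add h.lam_pos, one_div, ← Real.rpow_neg_one]; congr 1; ring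
  rw [qRe, chain_succ]
  calc _ < lam ^ (ν - 1) * (y * lam ^ (-ν)) :=
        mul_lt_mul_of_pos_left (mul_lt_mul_of_pos_left h2 h.y_pos)
          (Real.rpow_pos_of_pos h.lam_pos _)
    _ = y * (lam ^ (ν - 1) * lam ^ (-ν)) := by ring
    _ = y / lam := by rw [h3]; ring

theorem y_div_lt_qEnd (h : ChainData ν r p lam a y φ) : y / lam < qEnd r lam y φ := by
  have h1 := h.H_lt (x := 0) (w := lam) (by norm_num) h.lam_pos
    (h.lam_lt_one.trans h.pickNorm.one_lt_inv_lam)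
  simp only [h.pickNorm.zero, Real.one_rpow] at h1
  rw [qEnd, chain_succ, chain_zero]
  have := h.lam_pos
  have := h.y_pos
  gcongr
  nlinarith

end ChainData

theorem ChainData.iterate_ofReal (h : ChainData ν r p lam a y (reflRe ψ)) (hψ : NormPsi lam a ψ)
    {c : ℝ} (hc : c ∈ Ioo (-1) (chain K lam y 1)) {n : ℕ} (hn : n ≤ p) :
    (uCheck ψ r y)^[n] c = (chain K c y n : ℝ) := by
  induction n with
  | zero => rfl
  | succ n ih =>
    rw [Function.iterate_succ_apply', ih (by omega), chain_succ,
      hψ.uCheck_ofReal (h.chain_of_mem_lt_inv hc (by omega))]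

theorem ChainData.herglotzian_iterate (h : ChainData ν r p lam a y (reflRe ψ))
    (hψ : NormPsi lam a ψ) {n : ℕ} (hn : n ≤ p) :
    Herglotzian (-1) (chain K lam y 1) (uCheck ψ r y)^[n] ∧
      (n < p → MapsTo (uCheck ψ r y)^[n] (Omega (-1) (chain K lam y 1)) (Omega (-1) (1 / lam))) := by
  have maps : ∀ n ≤ p, Herglotzian (-1) (chain K lam y 1) (uCheck ψ r y)^[n] → n < p →
      MapsTo (uCheck ψ r y)^[n] (Omega (-1) (chain K lam y 1)) (Omega (-1) (1 / lam)) := by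
    intro n hn hH hlt
    obtain ⟨d, hd, hd'⟩ := exists_between h.lam_lt_chain_one
    have h0 : (0 : ℝ) ∈ Ioo (-1) (chain K lam y 1) := h.zero_mem
    have h1 : lam ∈ Ioo (-1) (chain K lam y 1) := ⟨by linarith [h.lam_pos], h.lam_lt_chain_one⟩
    refine hH.mapsTo h0 h1 ?_ fun x hx => ?_
    · rw [h.iterate_ofReal hψ h0 hn, h.iterate_ofReal hψ h1 hn]
      exact fun hc => (h.chain_lt_chain hn).ne (by exact_mod_cast hc)
    · rw [h.iterate_ofReal hψ hx hn, ofReal_re]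
      exact h.chain_of_mem_lt_inv hx hlt
  induction n with
  | zero =>
    have h1 : Herglotzian (-1) (chain K lam y 1) (uCheck ψ r y)^[0] := by
      have := herglotzian_const_mul_id (s := -1) (t := chain K lam y 1) zero_le_one
      simp only [ofReal_one, one_mul] at this
      exact this
    exact ⟨h1, maps 0 hn h1⟩
  | succ n ih =>
    obtain ⟨h1, h2⟩ := ih (by omega)
    have h3 : Herglotzian (-1) (chain K lam y 1) (uCheck ψ r y)^[n + 1] := by
      have := (hψ.herglotzian_uCheck h.one_lt_r h.y_pos.le).comp h1 (h2 (by omega))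
      rw [Function.iterate_succ']
      exact this
    exact ⟨h3, maps _ hn h3⟩

theorem ChainData.mapsTo_mul (h : ChainData ν r p lam a y φ) :
    MapsTo (fun z : ℂ => (lam : ℂ) * z) (Omega (-1 / lam) (qEnd r lam y φ))
      (Omega (-1) (chain H lam y 1)) := by
  intro z hz
  rw [mem_Omega_iff] at *
  refine hz.imp (fun h0 => ?_) fun h0 => ?_
  · simpa [h.lam_pos.ne'] using h0
  · simpa using h.mul_mem h0

theorem ChainData.herglotzian_qMap (h : ChainData ν r p lam a y (reflRe ψ))
    (hψ : NormPsi lam a ψ) :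
    Herglotzian (-1 / lam) (qEnd r lam y (reflRe ψ)) (qMap ν r p lam y ψ) :=
  ((h.herglotzian_iterate hψ le_rfl).1.comp (herglotzian_const_mul_id h.lam_pos.le)
    h.mapsTo_mul).const_mul (Real.rpow_pos_of_pos h.lam_pos _).le

theorem ChainData.qMap_ofReal (h : ChainData ν r p lam a y (reflRe ψ)) (hψ : NormPsi lam a ψ)
    {x : ℝ} (hx : x ∈ Ioo (-1 / lam) (qEnd r lam y (reflRe ψ))) :
    qMap ν r p lam y ψ x = (qRe ν r p lam y (reflRe ψ) x : ℝ) := by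
  have := h.iterate_ofReal hψ (h.mul_mem hx) le_rfl
  rw [qMap, ← ofReal_mul, this, ← ofReal_mul]
  rfl

theorem ChainData.qRe_lt_self (h : ChainData ν r p lam a y (reflRe ψ)) (hψ : NormPsi lam a ψ)
    {x : ℝ} (hx : 1 < x) (hx' : x < qEnd r lam y (reflRe ψ)) :
    qRe ν r p lam y (reflRe ψ) x < x := by
  have hn1 := h.neg_one_div_lt
  rcases le_or_gt (y / lam) x with h1 | h1
  · exact (h.qRe_lt_div ⟨by linarith, hx'⟩).trans_le h1
  by_contra! hB
  set X := y / lam with hX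
  have hXe : X < qEnd r lam y (reflRe ψ) := h.y_div_lt_qEnd
  have hA := h.qRe_lt_div (x := X) ⟨by linarith, hXe⟩
  have hA1 := h.qRe_lt (x := 1) (w := X) (by linarith) (by linarith) hXe
  have hq := h.qRe_zero_mem
  have cr := (h.herglotzian_qMap hψ).pickOn.cross_ratio (a := 0) (b := 1) (c := x) (d := X)
    (by linarith) (by norm_num) hx h1 hXe
  simp only [h.qMap_ofReal hψ (x := 0) ⟨by linarith, by linarith⟩,
    h.qMap_ofReal hψ (x := 1) ⟨by linarith, by linarith⟩,
    h.qMap_ofReal hψ (x := x) ⟨by linarith, by linarith⟩,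
    h.qMap_ofReal hψ (x := X) ⟨by linarith, by linarith⟩, ofReal_re, h.qRe_one] at cr
  rw [h.qRe_one] at hA1
  rw [← hX] at hA
  generalize qRe ν r p lam y (reflRe ψ) 0 = q at *
  generalize qRe ν r p lam y (reflRe ψ) x = B at *
  generalize qRe ν r p lam y (reflRe ψ) X = A at *
  obtain ⟨hq0, hq1⟩ := hq
  have e1 : (x - 1) * (B - q) ≤ (B - 1) * (x - q) := by nlinarith
  have e2 : (A - 1) * (X - q) ≤ (X - 1) * (A - q) := by nlinarith
  have e3 : (X - 1) * x * (A - q) ≤ (A - 1) * X * (x - q) := by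
    refine le_of_mul_le_mul_right ?_ (show 0 < B - 1 by linarith)
    have := mul_le_mul_of_nonneg_left e1 (show 0 ≤ (A - 1) * X by nlinarith)
    nlinarith
  have e4 : x * (X - q) ≤ X * (x - q) := by
    refine le_of_mul_le_mul_right ?_
      (mul_pos (show 0 < X - 1 by linarith) (show 0 < A - q by linarith))
    have f1 := mul_le_mul_of_nonneg_right e3 (show 0 ≤ X - q by linarith)
    have f2 := mul_le_mul_of_nonneg_left e2
      (mul_nonneg (show 0 ≤ X by linarith) (show 0 ≤ x - q by linarith))
    nlinarith
  nlinarith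

theorem ChainData.qRe_mem (h : ChainData ν r p lam a y (reflRe ψ)) (hψ : NormPsi lam a ψ)
    {x t : ℝ} (ht : 1 ≤ t) (ht' : t ≤ qEnd r lam y (reflRe ψ)) (hx : x ∈ Ioo (-1 / lam) t) :
    qRe ν r p lam y (reflRe ψ) x ∈ Ioo 0 t := by
  have hn1 := h.neg_one_div_lt
  refine ⟨h.qRe_pos ⟨hx.1, hx.2.trans_le ht'⟩, ?_⟩
  rcases lt_trichotomy x 1 with h1 | rfl | h1
  · have := h.qRe_lt hx.1 h1 h.one_lt_qEnd
    rw [h.qRe_one] at this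
    linarith
  · rw [h.qRe_one]; exact hx.2
  · exact (h.qRe_lt_self hψ h1 (hx.2.trans_le ht')).trans hx.2

theorem ChainData.mapsTo_qMap_of_lt (h : ChainData ν r p lam a y (reflRe ψ))
    (hψ : NormPsi lam a ψ) {t t' : ℝ} (ht : 1 ≤ t) (ht' : t ≤ qEnd r lam y (reflRe ψ))
    (htt' : ∀ x ∈ Ioo (-1 / lam) t, qRe ν r p lam y (reflRe ψ) x < t') :
    MapsTo (qMap ν r p lam y ψ) (Omega (-1 / lam) t) (Omega (-1 / lam) t') := by
  have hn1 := h.neg_one_div_lt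
  have hx0 : (0 : ℝ) ∈ Ioo (-1 / lam) t := ⟨by linarith, by linarith⟩
  have hx1 : (-1 : ℝ) ∈ Ioo (-1 / lam) t := ⟨by linarith, by linarith⟩
  have hs : Ioo (-1 / lam) t ⊆ Ioo (-1 / lam) (qEnd r lam y (reflRe ψ)) :=
    Ioo_subset_Ioo_right ht'
  refine ((h.herglotzian_qMap hψ).mono le_rfl ht').mapsTo hx1 hx0 ?_ fun x hx => ?_
  · rw [h.qMap_ofReal hψ (hs hx0), h.qMap_ofReal hψ (hs hx1)]
    refine fun hc => (h.qRe_lt hx1.1 (by norm_num : (-1 : ℝ) < 0) (hs hx0).2).ne ?_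
    exact_mod_cast hc
  · rw [h.qMap_ofReal hψ (hs hx), ofReal_re]
    exact ⟨by linarith [(h.qRe_mem hψ ht ht' hx).1], htt' x hx⟩

theorem ChainData.mapsTo_qMap (h : ChainData ν r p lam a y (reflRe ψ))
    (hψ : NormPsi lam a ψ) {t : ℝ} (ht : 1 ≤ t) (ht' : t ≤ qEnd r lam y (reflRe ψ)) :
    MapsTo (qMap ν r p lam y ψ) (Omega (-1 / lam) t) (Omega (-1 / lam) t) :=
  h.mapsTo_qMap_of_lt hψ ht ht' fun _ hx => (h.qRe_mem hψ ht ht' hx).2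

end Renormalization

section StepMap

/-- The renormalised function `(f (Q z) + δ (1 - z)) / (m + δ)`. -/
def stepMap (m δ : ℝ) (f Q : ℂ → ℂ) (z : ℂ) : ℂ :=
  (((m + δ)⁻¹ : ℝ) : ℂ) * (f (Q z) + (δ : ℂ) * (1 - z))

variable {ν r lam a y : ℝ} {p : ℕ} {ψ : ℂ → ℂ}

theorem AntiHerglotzian.stepMap {m δ s t t' : ℝ} {f Q : ℂ → ℂ} (hf : AntiHerglotzian s t' f)
    (hQ : Herglotzian s t Q) (hm : MapsTo Q (Omega s t) (Omega s t')) (hmδ : 0 ≤ m + δ)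
    (hδ : 0 ≤ δ) : AntiHerglotzian s t (stepMap m δ f Q) :=
  ((hf.comp hQ hm).add (antiHerglotzian_one_sub.const_mul hδ)).const_mul (inv_nonneg.2 hmδ)

/-- The value `ψ (Q 0)`. -/
def qVal (ν r : ℝ) (p : ℕ) (lam y : ℝ) (ψ : ℂ → ℂ) : ℝ := (ψ (qMap ν r p lam y ψ 0)).re

theorem NormPsi.neg_one_div_lt (hψ : NormPsi lam a ψ) : -1 / lam < -1 := by
  have := hψ.lam_mem.1
  rw [div_lt_iff₀ this]; linarith [hψ.lam_mem.2]

theorem NormPsi.one_lt_inv (hψ : NormPsi lam a ψ) : 1 < 1 / a := by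
  rw [lt_div_iff₀ hψ.a_mem.1]; linarith [hψ.a_mem.2]

theorem ChainData.qMap_zero (h : ChainData ν r p lam a y (reflRe ψ)) (hψ : NormPsi lam a ψ) :
    qMap ν r p lam y ψ 0 = (qRe ν r p lam y (reflRe ψ) 0 : ℝ) := by
  have h1 := h.neg_one_div_lt
  have h2 := h.one_lt_qEnd
  exact_mod_cast h.qMap_ofReal hψ (x := 0) ⟨by linarith, by linarith⟩

theorem ChainData.qMap_one (h : ChainData ν r p lam a y (reflRe ψ)) (hψ : NormPsi lam a ψ) :
    qMap ν r p lam y ψ 1 = 1 := by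
  have h1 := h.neg_one_div_lt
  have h2 := h.one_lt_qEnd
  have := h.qMap_ofReal hψ (x := 1) ⟨by linarith, by linarith⟩
  rw [h.qRe_one] at this
  exact_mod_cast this

theorem ChainData.qVal_eq (h : ChainData ν r p lam a y (reflRe ψ)) (hψ : NormPsi lam a ψ) :
    qVal ν r p lam y ψ = reflRe ψ (-qRe ν r p lam y (reflRe ψ) 0) := by
  rw [qVal, h.qMap_zero hψ, reflRe]
  simp

theorem ChainData.qVal_pos (h : ChainData ν r p lam a y (reflRe ψ)) (hψ : NormPsi lam a ψ) :
    0 < qVal ν r p lam y ψ := by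
  have h1 := h.qRe_zero_mem
  rw [h.qVal_eq hψ]
  exact hψ.pickNorm.pos (by linarith [h1.2]) (by linarith [h1.1, hψ.pickNorm.one_lt_inv_lam])

theorem ChainData.apply_qMap_zero (h : ChainData ν r p lam a y (reflRe ψ))
    (hψ : NormPsi lam a ψ) :
    ψ (qMap ν r p lam y ψ 0) = (qVal ν r p lam y ψ : ℝ) := by
  have h1 := h.qRe_zero_mem
  have h2 := hψ.neg_one_div_lt
  have h3 := hψ.one_lt_inv
  rw [qVal, h.qMap_zero hψ]
  exact hψ.anti.eq_ofReal ⟨by linarith [h1.1], by linarith [h1.2]⟩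

theorem ChainData.normPsi_stepMap (h : ChainData ν r p lam a y (reflRe ψ))
    (hψ : NormPsi lam a ψ) (ha : 1 / a ≤ qEnd r lam y (reflRe ψ)) {δ : ℝ} (hδ : 0 ≤ δ) :
    NormPsi lam a (stepMap (qVal ν r p lam y ψ) δ ψ (qMap ν r p lam y ψ)) where
  lam_mem := hψ.lam_mem
  a_mem := hψ.a_mem
  anti := hψ.anti.stepMap ((h.herglotzian_qMap hψ).mono le_rfl ha)
    (h.mapsTo_qMap hψ hψ.one_lt_inv.le ha) (by linarith [h.qVal_pos hψ]) hδ
  zero := by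
    have h1 := h.qVal_pos hψ
    have h2 : (qVal ν r p lam y ψ + δ : ℂ) ≠ 0 := by
      exact_mod_cast (by linarith : (0 : ℝ) < qVal ν r p lam y ψ + δ).ne'
    rw [stepMap, h.apply_qMap_zero hψ]
    push_cast
    field_simp
    ring
  one := by
    rw [stepMap, h.qMap_one hψ, hψ.one]
    simp

theorem ChainData.stepMap_le (h : ChainData ν r p lam a y (reflRe ψ))
    (hψ : NormPsi lam a ψ) (ha : 1 / a ≤ qEnd r lam y (reflRe ψ)) {s₀ s₁ k : ℝ}
    (hk : 1 + 1 / lam ≤ k) (hks : k < s₀) (hs : s₁ ≤ s₀) {x : ℝ} (hx : x ∈ Ioo (-1 / lam) (1 / a)) :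
    (stepMap (qVal ν r p lam y ψ) (max 0 ((1 - s₀ * qVal ν r p lam y ψ) / (s₀ - k))) ψ
      (qMap ν r p lam y ψ) x).re ≤ max s₁ (min s₀ (1 / qVal ν r p lam y ψ)) := by
  have hm := h.qVal_pos hψ
  have h1 : (ψ (qMap ν r p lam y ψ x)).re ≤ 1 := by
    rw [h.qMap_ofReal hψ ⟨hx.1, hx.2.trans_le ha⟩]
    have h2 := h.qRe_mem hψ hψ.one_lt_inv.le ha hx
    set q := qRe ν r p lam y (reflRe ψ) x
    have h3 := hψ.pickNorm.strictMonoOn (show -q ∈ Ioo (-(1 / a)) (1 / lam) from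
      ⟨by linarith [h2.2], by linarith [h2.1, hψ.pickNorm.one_lt_inv_lam]⟩)
      (show (0 : ℝ) ∈ Ioo (-(1 / a)) (1 / lam) from
      ⟨by linarith [hψ.one_lt_inv], by linarith [hψ.pickNorm.one_lt_inv_lam]⟩) (by linarith [h2.1])
    rw [hψ.pickNorm.zero, reflRe] at h3
    simpa using h3.le
  have hxk : 1 - x ≤ k := by
    have := hx.1
    rw [neg_div] at this
    linarith
  set m := qVal ν r p lam y ψ
  set δ := max 0 ((1 - s₀ * m) / (s₀ - k)) with hδ
  have hδ0 : 0 ≤ δ := le_max_left _ _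
  have h4 : (stepMap m δ ψ (qMap ν r p lam y ψ) x).re =
      (m + δ)⁻¹ * ((ψ (qMap ν r p lam y ψ x)).re + δ * (1 - x)) := by
    rw [stepMap, re_ofReal_mul, add_re, re_ofReal_mul, sub_re, ofReal_re, one_re]
  rw [h4, inv_mul_le_iff₀ (by linarith)]
  have h5 : δ * (1 - x) ≤ δ * k := by gcongr
  have hsk : 0 < s₀ - k := by linarith
  rcases le_or_gt 1 (s₀ * m) with h6 | h6
  · have h7 : δ = 0 := max_eq_left (div_nonpos_of_nonpos_of_nonneg (by linarith) hsk.le)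
    have h8 : 1 / m ≤ s₀ := by rwa [div_le_iff₀ hm]
    rw [min_eq_right h8]
    have h9 : m * (1 / m) ≤ m * max s₁ (1 / m) := by gcongr; exact le_max_right _ _
    rw [mul_one_div_cancel hm.ne'] at h9
    rw [h7] at h5 ⊢
    simp only [add_zero, zero_mul] at *
    linarith
  · have h7 : δ = (1 - s₀ * m) / (s₀ - k) :=
      max_eq_right (div_nonneg (by linarith) hsk.le)
    have h8 : s₀ ≤ 1 / m := by rw [le_div_iff₀ hm]; exact h6.le
    rw [min_eq_left h8, max_eq_right hs]
    have h9 : δ * (s₀ - k) = 1 - s₀ * m := by rw [h7]; field_simp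
    linarith

section Continuity

open Filter Topology

variable {ι : Type*} {l : Filter ι} {ψi : ι → ℂ → ℂ} {lami ai yi : ι → ℝ}

theorem ChainData.tendsto_param (h : ChainData ν r p lam a y (reflRe ψ)) (hψ : NormPsi lam a ψ)
    (hconv : ∀ z ∈ Omega (-1 / lam) (1 / a), ∀ Z : ι → ℂ, Tendsto Z l (𝓝 z) →
      Tendsto (fun i => ψi i (Z i)) l (𝓝 (ψ z)))
    (hlam : Tendsto lami l (𝓝 lam))
    (hi : ∀ᶠ i in l, ChainData ν r p (lami i) (ai i) (yi i) (reflRe (ψi i))) :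
    Tendsto yi l (𝓝 y) := by
  obtain ⟨n, rfl⟩ : ∃ n, p = n + 1 := ⟨p - 1, by have := h.one_le_p; omega⟩
  refine h.chainFun.tendsto_param h.lam_pos h.T_le h.y_pos h.chain_lt h.chain_eq
    (Hi := fun i x => reflRe (ψi i) x ^ (1 / r)) (lami := lami) (Li := fun i => 1 / lami i)
    (Ti := fun i => lami i ^ (1 - ν)) (fun x hx X hX => ?_) hlam
    (hlam.rpow_const (Or.inl h.lam_pos.ne')) ?_
  · refine Tendsto.rpow_const ?_ (Or.inr (by have := h.one_lt_r; positivity))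
    refine (continuous_re.tendsto _).comp (hconv _ ?_ (fun i => -(X i : ℂ)) ?_)
    · rw [← ofReal_neg, ofReal_mem_Omega, neg_div]
      exact ⟨by linarith [hx.2], by linarith [hx.1, hψ.one_lt_inv]⟩
    · exact ((continuous_ofReal.tendsto _).comp hX).neg
  · filter_upwards [hi] with i hi
    exact ⟨hi.chainFun, hi.lam_pos, hi.T_le, hi.y_pos, hi.chain_lt, hi.chain_eq⟩

theorem ChainData.tendsto_qMap (h : ChainData ν r p lam a y (reflRe ψ)) (hψ : NormPsi lam a ψ)
    (hconv : ∀ z ∈ Omega (-1 / lam) (1 / a), ∀ Z : ι → ℂ, Tendsto Z l (𝓝 z) →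
      Tendsto (fun i => ψi i (Z i)) l (𝓝 (ψ z)))
    (hlam : Tendsto lami l (𝓝 lam)) (hy : Tendsto yi l (𝓝 y))
    {z : ℂ} (hz : z ∈ Omega (-1 / lam) (qEnd r lam y (reflRe ψ))) {Z : ι → ℂ}
    (hZ : Tendsto Z l (𝓝 z)) :
    Tendsto (fun i => qMap ν r p (lami i) (yi i) (ψi i) (Z i)) l
      (𝓝 (qMap ν r p lam y ψ z)) := by
  have hc : Tendsto (fun i => (lami i : ℂ)) l (𝓝 (lam : ℂ)) :=
    (continuous_ofReal.tendsto _).comp hlam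
  have hw := h.mapsTo_mul hz
  have hW := hc.mul hZ
  have iter : ∀ n ≤ p, Tendsto (fun i => (uCheck (ψi i) r (yi i))^[n] (lami i * Z i)) l
      (𝓝 ((uCheck ψ r y)^[n] (lam * z))) := by
    intro n hn
    induction n with
    | zero => exact hW
    | succ n ih =>
      have h1 := ih (by omega)
      have h2 := (h.herglotzian_iterate hψ (n := n) (by omega)).2 (by omega) hw
      simp only [Function.iterate_succ_apply']
      set v := (uCheck ψ r y)^[n] (lam * z)
      refine ((continuous_ofReal.tendsto _).comp hy).mul ?_
      have h3 := hψ.mapsTo_slitPlane h2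
      refine Tendsto.cpow (hconv _ ?_ _ h1.neg) tendsto_const_nhds h3
      refine neg_mem_Omega (Omega_mono hψ.pickNorm.neg_inv_a_lt.le ?_ h2)
      rw [neg_div, neg_neg]
  refine Tendsto.mul ((continuous_ofReal.tendsto _).comp ?_) (iter p le_rfl)
  exact hlam.rpow_const (Or.inl h.lam_pos.ne')

end Continuity

end StepMap

section Mobius

/-- The Möbius transformation `z ↦ z / (b + c z)`. -/
def mob (b c : ℝ) (z : ℂ) : ℂ := z / (b + c * z)

variable {b c s t s' t' : ℝ}

theorem mob_ofReal (x : ℝ) : mob b c x = ((x / (b + c * x) : ℝ) : ℂ) := by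
  simp [mob]

theorem mob_denom_ne (hb : 0 < b) (h : ∀ x ∈ Ioo s t, 0 < b + c * x) {z : ℂ}
    (hz : z ∈ Omega s t) : (b + c * z : ℂ) ≠ 0 := by
  intro h0
  have hre := congrArg re h0
  have him := congrArg im h0
  simp only [add_re, ofReal_re, re_ofReal_mul, zero_re, add_im, ofReal_im, im_ofReal_mul,
    zero_im, zero_add, mul_eq_zero] at hre him
  rcases him with hc | hz0
  · rw [hc] at hre; linarith
  · rcases (mem_Omega_iff).1 hz with h1 | h1
    · exact h1 hz0
    · linarith [h _ h1]

theorem mob_im (z : ℂ) : (mob b c z).im = b * z.im / normSq (b + c * z) := by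
  rw [mob, div_im]
  simp only [add_re, ofReal_re, re_ofReal_mul, add_im, ofReal_im, im_ofReal_mul, zero_add]
  ring

theorem herglotzian_mob (hb : 0 < b) (h : ∀ x ∈ Ioo s t, 0 < b + c * x) :
    Herglotzian s t (mob b c) := by
  refine ⟨?_, fun z _ => ?_, fun z hz h0 => ?_⟩
  · exact DifferentiableOn.div (by fun_prop) (by fun_prop) fun z hz => mob_denom_ne hb h hz
  · simp [mob]
  · rw [mob_im]
    exact div_nonneg (mul_nonneg hb.le h0.le) (normSq_nonneg _)

theorem mapsTo_mob (hb : 0 < b) (h : ∀ x ∈ Ioo s t, 0 < b + c * x)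
    (hm : ∀ x ∈ Ioo s t, x / (b + c * x) ∈ Ioo s' t') :
    MapsTo (mob b c) (Omega s t) (Omega s' t') := by
  intro z hz
  have hd := mob_denom_ne hb h hz
  by_cases him : z.im = 0
  · have hzr : z = (z.re : ℂ) := Complex.ext rfl (by simp [him])
    rw [hzr] at hz ⊢
    rw [mob_ofReal, ofReal_mem_Omega]
    exact hm _ (ofReal_mem_Omega.1 hz)
  · refine mem_Omega_of_im_ne ?_
    rw [mob_im]
    exact div_ne_zero (mul_ne_zero hb.ne' him) ((normSq_pos.2 hd).ne')

theorem mob_mob (hb : b ≠ 0) {z : ℂ} (hz : (1 / b + -((1 - b) / b) * z : ℂ) ≠ 0) :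
    mob b (1 - b) (mob (1 / b) (-((1 - b) / b)) z) = z := by
  have hb' : (b : ℂ) ≠ 0 := by exact_mod_cast hb
  have h1 : (1 / b + -((1 - b) / b) * z : ℂ) = (1 - (1 - b) * z) / b := by field_simp; ring
  rw [h1] at hz
  have h2 : (1 - (1 - b) * z : ℂ) ≠ 0 := fun h => hz (by rw [h, zero_div])
  simp only [mob]
  push_cast
  rw [h1]
  have h3 : (b + (1 - b) * (z / ((1 - (1 - b) * z) / b)) : ℂ) = b / (1 - (1 - b) * z) := by
    field_simp
    ring
  rw [h3]
  generalize (1 - (1 - b) * z : ℂ) = w at h2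
  field_simp

end Mobius

section StateSpace

/-- Admissible choices of the constants entering the fixed point argument. -/
structure StepParams (ν r : ℝ) (p : ℕ) (l₀ l₁ ε : ℝ) : Prop where
  ν_mem : ν ∈ Icc (1 : ℝ) 2
  one_lt_r : 1 < r
  one_le_p : 1 ≤ p
  l₀_pos : 0 < l₀
  l₀_lt : l₀ < l₁
  l₁_lt : l₁ < 1
  ε_pos : 0 < ε
  ε_lt : 2 * ε < 1
  ε_mul_lt : 2 * ε * (p * (4 * r) ^ p) < 1 - l₁
  one_add_lt : 1 + 1 / l₀ < l₀ ^ (-(r * ν))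

/-- The scaling parameter `s ^ (-1 / (r ν))`. -/
def lamOf (ν r s : ℝ) : ℝ := s ^ (-(1 / (r * ν)))

/-- The right end point parameter. -/
def aOf (ν r ε s : ℝ) : ℝ := 1 - ε * (1 + lamOf ν r s)

/-- The Möbius parameter. -/
def bOf (ν r s : ℝ) : ℝ := (1 + lamOf ν r s) / 2

/-- Transport of a function on the standard domain `Omega (-1) (1 / (1 - 2 ε))` to
`Omega (-1 / lam) (1 / a)`. -/
def psiOf (ν r s : ℝ) (f : ℂ → ℂ) (z : ℂ) : ℂ :=
  f (mob (1 / bOf ν r s) (-((1 - bOf ν r s) / bOf ν r s)) z)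

/-- The set on which the renormalisation operator acts. -/
def stateSet (ν r l₀ l₁ ε : ℝ) : Set (ℝ × (ℂ → ℂ)) :=
  {x | x.1 ∈ Icc (l₁ ^ (-(r * ν))) (l₀ ^ (-(r * ν))) ∧ x.2 ∈ NormClass (-1) (1 / (1 - 2 * ε)) ∧
    ∀ t ∈ Ioo (-1) (1 / (1 - 2 * ε)), (x.2 (t : ℂ)).re ≤ x.1}

open Classical in
/-- The chain parameter of a state. -/
def yOf (ν r : ℝ) (p : ℕ) (ε : ℝ) (x : ℝ × (ℂ → ℂ)) : ℝ :=
  if h : ∃ y, ChainData ν r p (lamOf ν r x.1) (aOf ν r ε x.1) y (reflRe (psiOf ν r x.1 x.2))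
  then h.choose else 0

/-- The value `ψ (Q 0)` of a state. -/
def mOf (ν r : ℝ) (p : ℕ) (ε : ℝ) (x : ℝ × (ℂ → ℂ)) : ℝ :=
  qVal ν r p (lamOf ν r x.1) (yOf ν r p ε x) (psiOf ν r x.1 x.2)

/-- The correction parameter. -/
def deltaOf (ν r l₀ m : ℝ) : ℝ :=
  max 0 ((1 - l₀ ^ (-(r * ν)) * m) / (l₀ ^ (-(r * ν)) - (1 + 1 / l₀)))

/-- The renormalised function attached to a state. -/
def stepOf (ν r : ℝ) (p : ℕ) (l₀ ε : ℝ) (x : ℝ × (ℂ → ℂ)) : ℂ → ℂ :=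
  stepMap (mOf ν r p ε x) (deltaOf ν r l₀ (mOf ν r p ε x)) (psiOf ν r x.1 x.2)
    (qMap ν r p (lamOf ν r x.1) (yOf ν r p ε x) (psiOf ν r x.1 x.2))

/-- The renormalisation operator. -/
def stateMap (ν r : ℝ) (p : ℕ) (l₀ l₁ ε : ℝ) (x : ℝ × (ℂ → ℂ)) : ℝ × (ℂ → ℂ) :=
  (max (l₁ ^ (-(r * ν))) (min (l₀ ^ (-(r * ν))) (1 / mOf ν r p ε x)),
    (Omega (-1) (1 / (1 - 2 * ε))).indicator
      fun z => stepOf ν r p l₀ ε x (mob (bOf ν r x.1) (1 - bOf ν r x.1) z))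

variable {ν r l₀ l₁ ε : ℝ} {p : ℕ} {x : ℝ × (ℂ → ℂ)}

namespace StepParams

theorem ν_pos (P : StepParams ν r p l₀ l₁ ε) : 0 < ν := by linarith [P.ν_mem.1]

theorem mul_pos (P : StepParams ν r p l₀ l₁ ε) : 0 < r * ν :=
  _root_.mul_pos (by linarith [P.one_lt_r]) P.ν_pos

theorem l₁_pos (P : StepParams ν r p l₀ l₁ ε) : 0 < l₁ := P.l₀_pos.trans P.l₀_lt

theorem rpow_lt (P : StepParams ν r p l₀ l₁ ε) : l₁ ^ (-(r * ν)) < l₀ ^ (-(r * ν)) :=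
  Real.rpow_lt_rpow_of_neg P.l₀_pos P.l₀_lt (by linarith [P.mul_pos])

theorem one_lt_end (P : StepParams ν r p l₀ l₁ ε) : 1 < 1 / (1 - 2 * ε) := by
  rw [lt_div_iff₀ (by linarith [P.ε_lt])]; linarith [P.ε_pos]

theorem pos_of_mem (P : StepParams ν r p l₀ l₁ ε) (hx : x ∈ stateSet ν r l₀ l₁ ε) : 0 < x.1 :=
  (Real.rpow_pos_of_pos P.l₁_pos _).trans_le hx.1.1

theorem lamOf_rpow (P : StepParams ν r p l₀ l₁ ε) {s : ℝ} (hs : 0 < s) :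
    lamOf ν r s ^ (-(r * ν)) = s := by
  have := P.mul_pos
  rw [lamOf, ← Real.rpow_mul hs.le]
  have : -(1 / (r * ν)) * -(r * ν) = 1 := by rw [neg_mul_neg, one_div_mul_cancel this.ne']
  rw [this, Real.rpow_one]

theorem lamOf_rpow_neg (P : StepParams ν r p l₀ l₁ ε) {l : ℝ} (hl : 0 < l) :
    lamOf ν r (l ^ (-(r * ν))) = l := by
  rw [lamOf, ← Real.rpow_mul hl.le]
  have : -(r * ν) * -(1 / (r * ν)) = 1 := by rw [neg_mul_neg, mul_one_div_cancel P.mul_pos.ne']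
  rw [this, Real.rpow_one]

theorem lamOf_mem (P : StepParams ν r p l₀ l₁ ε) (hx : x ∈ stateSet ν r l₀ l₁ ε) :
    lamOf ν r x.1 ∈ Icc l₀ l₁ := by
  have hq := P.mul_pos
  have hneg : -(1 / (r * ν)) ≤ 0 := by rw [neg_nonpos]; positivity
  constructor
  · rw [← P.lamOf_rpow_neg P.l₀_pos]
    exact Real.rpow_le_rpow_of_nonpos (P.pos_of_mem hx) hx.1.2 hneg
  · rw [← P.lamOf_rpow_neg P.l₁_pos]
    exact Real.rpow_le_rpow_of_nonpos (Real.rpow_pos_of_pos P.l₁_pos _) hx.1.1 hneg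

end StepParams

/-- Elementary bounds for the scaling parameters. -/
structure ScaleBounds (lam ε : ℝ) : Prop where
  lam_pos : 0 < lam
  lam_lt : lam < 1
  ε_pos : 0 < ε
  ε_lt : 2 * ε < 1

theorem StepParams.scaleBounds (P : StepParams ν r p l₀ l₁ ε) (hx : x ∈ stateSet ν r l₀ l₁ ε) :
    ScaleBounds (lamOf ν r x.1) ε :=
  ⟨P.l₀_pos.trans_le (P.lamOf_mem hx).1, (P.lamOf_mem hx).2.trans_lt P.l₁_lt, P.ε_pos, P.ε_lt⟩

namespace ScaleBounds

variable {lam b a : ℝ}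

theorem denom_pos (h : ScaleBounds lam ε) (hb : b = (1 + lam) / 2) {x : ℝ}
    (hx : x ∈ Ioo (-1) (1 / (1 - 2 * ε))) : 0 < b + (1 - b) * x := by
  subst hb
  nlinarith [hx.1, h.lam_pos, h.lam_lt]

theorem mob_mem (h : ScaleBounds lam ε) (hb : b = (1 + lam) / 2) (ha : a = 1 - ε * (1 + lam))
    {x : ℝ} (hx : x ∈ Ioo (-1) (1 / (1 - 2 * ε))) :
    x / (b + (1 - b) * x) ∈ Ioo (-1 / lam) (1 / a) := by
  have hd := h.denom_pos hb hx
  have h1 := hx.1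
  have h2 := hx.2
  rw [lt_div_iff₀ (by linarith [h.ε_lt])] at h2
  have h3 := h.lam_pos
  have h4 := h.lam_lt
  have h5 := h.ε_pos
  have h6 := h.ε_lt
  have ha0 : 0 < a := by rw [ha]; nlinarith
  constructor
  · rw [div_lt_div_iff₀ h3 hd, hb]; nlinarith
  · rw [div_lt_div_iff₀ hd ha0, hb, ha]; nlinarith

theorem inv_denom_pos (h : ScaleBounds lam ε) (hb : b = (1 + lam) / 2)
    (ha : a = 1 - ε * (1 + lam)) {x : ℝ} (hx : x ∈ Ioo (-1 / lam) (1 / a)) :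
    0 < 1 / b + -((1 - b) / b) * x := by
  have h1 := hx.2
  have h3 := h.lam_pos
  have h4 := h.lam_lt
  have h5 := h.ε_pos
  have h6 := h.ε_lt
  have ha0 : 0 < a := by rw [ha]; nlinarith
  have hb0 : 0 < b := by rw [hb]; linarith
  rw [lt_div_iff₀ ha0] at h1
  have h7 : 1 / b + -((1 - b) / b) * x = (1 - (1 - b) * x) / b := by field_simp; ring
  rw [h7]
  refine div_pos ?_ hb0
  rcases le_or_gt x 0 with h8 | h8
  · rw [hb]; nlinarith
  · rw [ha] at h1; rw [hb]; nlinarith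

theorem inv_mob_mem (h : ScaleBounds lam ε) (hb : b = (1 + lam) / 2)
    (ha : a = 1 - ε * (1 + lam)) {x : ℝ} (hx : x ∈ Ioo (-1 / lam) (1 / a)) :
    x / (1 / b + -((1 - b) / b) * x) ∈ Ioo (-1) (1 / (1 - 2 * ε)) := by
  have hd := h.inv_denom_pos hb ha hx
  have h0 := hx.1
  have h1 := hx.2
  have h3 := h.lam_pos
  have h4 := h.lam_lt
  have h5 := h.ε_pos
  have h6 := h.ε_lt
  have ha0 : 0 < a := by rw [ha]; nlinarith
  have hb0 : 0 < b := by rw [hb]; linarith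
  rw [lt_div_iff₀ ha0] at h1
  rw [div_lt_iff₀ h3] at h0
  have h7 : 1 / b + -((1 - b) / b) * x = (1 - (1 - b) * x) / b := by field_simp; ring
  rw [h7] at hd ⊢
  have hd' : 0 < 1 - (1 - b) * x := by
    have := mul_pos hd hb0
    rwa [div_mul_cancel₀ _ hb0.ne'] at this
  rw [div_div_eq_mul_div]
  constructor
  · rw [lt_div_iff₀ hd', hb]; nlinarith
  · rw [div_lt_div_iff₀ hd' (by linarith), hb]
    rw [ha] at h1
    nlinarith

end ScaleBounds

namespace StepParams

theorem herglotzian_mob (P : StepParams ν r p l₀ l₁ ε) (hx : x ∈ stateSet ν r l₀ l₁ ε) :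
    Herglotzian (-1) (1 / (1 - 2 * ε)) (mob (bOf ν r x.1) (1 - bOf ν r x.1)) :=
  _root_.herglotzian_mob (by have := (P.scaleBounds hx).lam_pos; rw [bOf]; linarith)
    fun _ ht => (P.scaleBounds hx).denom_pos rfl ht

theorem mapsTo_mob (P : StepParams ν r p l₀ l₁ ε) (hx : x ∈ stateSet ν r l₀ l₁ ε) :
    MapsTo (mob (bOf ν r x.1) (1 - bOf ν r x.1)) (Omega (-1) (1 / (1 - 2 * ε)))
      (Omega (-1 / lamOf ν r x.1) (1 / aOf ν r ε x.1)) :=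
  _root_.mapsTo_mob (by have := (P.scaleBounds hx).lam_pos; rw [bOf]; linarith)
    (fun _ ht => (P.scaleBounds hx).denom_pos rfl ht)
    fun _ ht => (P.scaleBounds hx).mob_mem rfl rfl ht

theorem bOf_pos (P : StepParams ν r p l₀ l₁ ε) (hx : x ∈ stateSet ν r l₀ l₁ ε) :
    0 < bOf ν r x.1 := by
  have := (P.scaleBounds hx).lam_pos
  rw [bOf]; linarith

theorem herglotzian_inv_mob (P : StepParams ν r p l₀ l₁ ε) (hx : x ∈ stateSet ν r l₀ l₁ ε) :
    Herglotzian (-1 / lamOf ν r x.1) (1 / aOf ν r ε x.1)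
      (mob (1 / bOf ν r x.1) (-((1 - bOf ν r x.1) / bOf ν r x.1))) :=
  _root_.herglotzian_mob (one_div_pos.2 (P.bOf_pos hx))
    fun _ ht => (P.scaleBounds hx).inv_denom_pos rfl rfl ht

theorem mapsTo_inv_mob (P : StepParams ν r p l₀ l₁ ε) (hx : x ∈ stateSet ν r l₀ l₁ ε) :
    MapsTo (mob (1 / bOf ν r x.1) (-((1 - bOf ν r x.1) / bOf ν r x.1)))
      (Omega (-1 / lamOf ν r x.1) (1 / aOf ν r ε x.1)) (Omega (-1) (1 / (1 - 2 * ε))) :=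
  _root_.mapsTo_mob (one_div_pos.2 (P.bOf_pos hx))
    (fun _ ht => (P.scaleBounds hx).inv_denom_pos rfl rfl ht)
    fun _ ht => (P.scaleBounds hx).inv_mob_mem rfl rfl ht

theorem inv_denom_ne (P : StepParams ν r p l₀ l₁ ε) (hx : x ∈ stateSet ν r l₀ l₁ ε) {z : ℂ}
    (hz : z ∈ Omega (-1 / lamOf ν r x.1) (1 / aOf ν r ε x.1)) :
    (((1 / bOf ν r x.1 : ℝ) : ℂ) + ((-((1 - bOf ν r x.1) / bOf ν r x.1) : ℝ) : ℂ) * z) ≠ 0 :=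
  mob_denom_ne (one_div_pos.2 (P.bOf_pos hx))
    (fun _ ht => (P.scaleBounds hx).inv_denom_pos rfl rfl ht) hz

theorem mob_mob (P : StepParams ν r p l₀ l₁ ε) (hx : x ∈ stateSet ν r l₀ l₁ ε) {z : ℂ}
    (hz : z ∈ Omega (-1 / lamOf ν r x.1) (1 / aOf ν r ε x.1)) :
    mob (bOf ν r x.1) (1 - bOf ν r x.1)
      (mob (1 / bOf ν r x.1) (-((1 - bOf ν r x.1) / bOf ν r x.1)) z) = z := by
  refine _root_.mob_mob (P.bOf_pos hx).ne' ?_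
  have := P.inv_denom_ne hx hz
  push_cast at this
  exact this

theorem normPsi (P : StepParams ν r p l₀ l₁ ε) (hx : x ∈ stateSet ν r l₀ l₁ ε) :
    NormPsi (lamOf ν r x.1) (aOf ν r ε x.1) (psiOf ν r x.1 x.2) where
  lam_mem := ⟨(P.scaleBounds hx).lam_pos, (P.scaleBounds hx).lam_lt⟩
  a_mem := by
    have h1 := (P.scaleBounds hx).lam_pos
    have h2 := (P.scaleBounds hx).lam_lt
    have h3 := P.ε_pos
    have h4 := P.ε_lt
    rw [aOf]
    constructor <;> nlinarith
  anti := hx.2.1.1.comp (P.herglotzian_inv_mob hx) (P.mapsTo_inv_mob hx)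
  zero := by
    simp only [psiOf, mob, zero_div]
    exact hx.2.1.2.1
  one := by
    have hb := P.bOf_pos hx
    have : (1 / bOf ν r x.1 + -((1 - bOf ν r x.1) / bOf ν r x.1) * 1 : ℝ) = 1 := by
      field_simp; ring
    have h1 : mob (1 / bOf ν r x.1) (-((1 - bOf ν r x.1) / bOf ν r x.1)) ((1 : ℝ) : ℂ) = 1 := by
      rw [mob_ofReal, this]; simp
    rw [ofReal_one] at h1
    rw [psiOf, h1]
    exact hx.2.1.2.2.1

theorem reflRe_le (P : StepParams ν r p l₀ l₁ ε) (hx : x ∈ stateSet ν r l₀ l₁ ε) {t : ℝ}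
    (ht : t ∈ Ioo (-(1 / aOf ν r ε x.1)) (1 / lamOf ν r x.1)) :
    reflRe (psiOf ν r x.1 x.2) t ≤ lamOf ν r x.1 ^ (-(r * ν)) := by
  rw [P.lamOf_rpow (P.pos_of_mem hx), reflRe, ← ofReal_neg, psiOf, mob_ofReal]
  refine hx.2.2 _ ((P.scaleBounds hx).inv_mob_mem (a := aOf ν r ε x.1) rfl rfl ⟨?_, ?_⟩)
  · rw [neg_div]; linarith [ht.2]
  · linarith [ht.1]

theorem chainData (P : StepParams ν r p l₀ l₁ ε) (hx : x ∈ stateSet ν r l₀ l₁ ε) :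
    ChainData ν r p (lamOf ν r x.1) (aOf ν r ε x.1) (yOf ν r p ε x)
      (reflRe (psiOf ν r x.1 x.2)) := by
  have hN := P.normPsi hx
  have hex : ∃ y, ChainData ν r p (lamOf ν r x.1) (aOf ν r ε x.1) y
      (reflRe (psiOf ν r x.1 x.2)) := by
    obtain ⟨n, rfl⟩ : ∃ n, p = n + 1 := ⟨p - 1, by have := P.one_le_p; omega⟩
    obtain ⟨y, hy0, hy1, hy2⟩ := (hN.pickNorm.chainFun P.one_lt_r).exists_chain_eq hN.lam_mem.1
      (hN.lam_mem.2.trans_le (one_le_rpow_one_sub hN.lam_mem P.ν_mem))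
      (rpow_one_sub_le hN.lam_mem P.ν_mem) n
    exact ⟨y, hN.pickNorm, P.one_le_p, P.ν_mem, P.one_lt_r, fun t ht => P.reflRe_le hx ht,
      hy0, hy1, hy2⟩
  rw [yOf, dif_pos hex]
  exact hex.choose_spec

theorem inv_aOf_le (P : StepParams ν r p l₀ l₁ ε) (hx : x ∈ stateSet ν r l₀ l₁ ε) :
    1 / aOf ν r ε x.1 ≤
      qEnd r (lamOf ν r x.1) (yOf ν r p ε x) (reflRe (psiOf ν r x.1 x.2)) := by
  have h := P.chainData hx
  have hN := P.normPsi hx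
  have h1 := h.one_sub_lam_le
  have h2 := (P.lamOf_mem hx).2
  have h3 := P.ε_mul_lt
  have h4 := h.lam_lt_chain_one
  set W := chain (fun t => reflRe (psiOf ν r x.1 x.2) t ^ (1 / r)) (lamOf ν r x.1)
    (yOf ν r p ε x) 1 with hW
  have hW0 := h.lam_pos.trans h4
  have hC : 0 < (p : ℝ) * (4 * r) ^ p := by
    have := P.one_lt_r
    have : (0 : ℝ) < p := by exact_mod_cast P.one_le_p
    positivity
  have h5 : 2 * ε < 1 - lamOf ν r x.1 / W := by
    refine lt_of_mul_lt_mul_right ?_ hC.le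
    linarith [mul_comm ((p : ℝ) * (4 * r) ^ p) (1 - lamOf ν r x.1 / W)]
  have h6 : lamOf ν r x.1 / W ≤ aOf ν r ε x.1 := by
    rw [aOf]; nlinarith [P.ε_pos, P.l₁_lt]
  rw [qEnd, ← hW, div_le_div_iff₀ hN.a_mem.1 h.lam_pos]
  rw [div_le_iff₀ hW0] at h6
  linarith

theorem mOf_pos (P : StepParams ν r p l₀ l₁ ε) (hx : x ∈ stateSet ν r l₀ l₁ ε) :
    0 < mOf ν r p ε x := (P.chainData hx).qVal_pos (P.normPsi hx)

theorem deltaOf_nonneg (m : ℝ) : 0 ≤ deltaOf ν r l₀ m := le_max_left _ _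

theorem normPsi_stepOf (P : StepParams ν r p l₀ l₁ ε) (hx : x ∈ stateSet ν r l₀ l₁ ε) :
    NormPsi (lamOf ν r x.1) (aOf ν r ε x.1) (stepOf ν r p l₀ ε x) :=
  (P.chainData hx).normPsi_stepMap (P.normPsi hx) (P.inv_aOf_le hx) (deltaOf_nonneg _)

theorem _root_.stateMap_snd_of_mem {z : ℂ} (hz : z ∈ Omega (-1) (1 / (1 - 2 * ε))) :
    (stateMap ν r p l₀ l₁ ε x).2 z =
      stepOf ν r p l₀ ε x (mob (bOf ν r x.1) (1 - bOf ν r x.1) z) := by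
  simp only [stateMap, indicator_of_mem hz]

theorem _root_.stateMap_snd_of_notMem {z : ℂ} (hz : z ∉ Omega (-1) (1 / (1 - 2 * ε))) :
    (stateMap ν r p l₀ l₁ ε x).2 z = 0 := by
  simp only [stateMap, indicator_of_notMem hz]

theorem mapsTo_stateMap (P : StepParams ν r p l₀ l₁ ε) :
    MapsTo (stateMap ν r p l₀ l₁ ε) (stateSet ν r l₀ l₁ ε) (stateSet ν r l₀ l₁ ε) := by
  intro x hx
  have hN := P.normPsi_stepOf hx
  have hE := P.one_lt_end
  have h0 : (0 : ℂ) ∈ Omega (-1) (1 / (1 - 2 * ε)) := by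
    have : ((0 : ℝ) : ℂ) ∈ Omega (-1) (1 / (1 - 2 * ε)) :=
      ofReal_mem_Omega.2 ⟨by norm_num, by linarith⟩
    simpa using this
  have h1 : (1 : ℂ) ∈ Omega (-1) (1 / (1 - 2 * ε)) := by
    have : ((1 : ℝ) : ℂ) ∈ Omega (-1) (1 / (1 - 2 * ε)) :=
      ofReal_mem_Omega.2 ⟨by norm_num, by linarith⟩
    simpa using this
  refine ⟨⟨le_max_left _ _, max_le P.rpow_lt.le (min_le_left _ _)⟩,
    ⟨?_, ?_, ?_, fun z hz => stateMap_snd_of_notMem hz⟩, fun t ht => ?_⟩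
  · refine (hN.anti.comp (P.herglotzian_mob hx) (P.mapsTo_mob hx)).congr fun z hz => ?_
    exact stateMap_snd_of_mem hz
  · rw [stateMap_snd_of_mem h0]
    simp only [mob, zero_div]
    exact hN.zero
  · rw [stateMap_snd_of_mem h1]
    simp only [mob]
    norm_num
    exact hN.one
  · rw [stateMap_snd_of_mem (ofReal_mem_Omega.2 ht)]
    rw [mob_ofReal]
    refine (P.chainData hx).stepMap_le (P.normPsi hx) (P.inv_aOf_le hx) (k := 1 + 1 / l₀) ?_
      P.one_add_lt P.rpow_lt.le ((P.scaleBounds hx).mob_mem rfl rfl ht)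
    have := one_div_le_one_div_of_le P.l₀_pos (P.lamOf_mem hx).1
    linarith

end StepParams

end StateSpace

section StateContinuity

open Filter Topology

variable {ν r l₀ l₁ ε : ℝ} {p : ℕ} {x : ℝ × (ℂ → ℂ)}

theorem tendsto_mob {ι : Type*} {l : Filter ι} {b c : ℝ} {bi ci : ι → ℝ} {z : ℂ} {Z : ι → ℂ}
    (hb : Tendsto bi l (𝓝 b)) (hc : Tendsto ci l (𝓝 c)) (hZ : Tendsto Z l (𝓝 z))
    (hne : (b + c * z : ℂ) ≠ 0) :
    Tendsto (fun i => mob (bi i) (ci i) (Z i)) l (𝓝 (mob b c z)) :=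
  hZ.div (((continuous_ofReal.tendsto _).comp hb).add
    (((continuous_ofReal.tendsto _).comp hc).mul hZ)) hne

namespace StepParams

theorem tendsto_lamOf (P : StepParams ν r p l₀ l₁ ε) (hx : x ∈ stateSet ν r l₀ l₁ ε) :
    Tendsto (fun i : ℝ × (ℂ → ℂ) => lamOf ν r i.1) (𝓝[stateSet ν r l₀ l₁ ε] x)
      (𝓝 (lamOf ν r x.1)) :=
  ((continuous_fst.tendsto x).mono_left nhdsWithin_le_nhds).rpow_const
    (Or.inl (P.pos_of_mem hx).ne')

theorem tendsto_bOf (P : StepParams ν r p l₀ l₁ ε) (hx : x ∈ stateSet ν r l₀ l₁ ε) :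
    Tendsto (fun i : ℝ × (ℂ → ℂ) => bOf ν r i.1) (𝓝[stateSet ν r l₀ l₁ ε] x)
      (𝓝 (bOf ν r x.1)) :=
  ((P.tendsto_lamOf hx).const_add 1).div_const 2

theorem tendsto_psiOf (P : StepParams ν r p l₀ l₁ ε) (hx : x ∈ stateSet ν r l₀ l₁ ε) {z : ℂ}
    (hz : z ∈ Omega (-1 / lamOf ν r x.1) (1 / aOf ν r ε x.1)) {Z : ℝ × (ℂ → ℂ) → ℂ}
    (hZ : Tendsto Z (𝓝[stateSet ν r l₀ l₁ ε] x) (𝓝 z)) :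
    Tendsto (fun i => psiOf ν r i.1 i.2 (Z i)) (𝓝[stateSet ν r l₀ l₁ ε] x)
      (𝓝 (psiOf ν r x.1 x.2 z)) := by
  have hb := P.tendsto_bOf hx
  have hb0 := (P.bOf_pos hx).ne'
  refine NormClass.tendsto_eval (Ψ := fun i : ℝ × (ℂ → ℂ) => i.2) (by norm_num) P.one_lt_end (P.mapsTo_inv_mob hx hz) ?_ ?_
    (tendsto_mob (tendsto_const_nhds.div hb hb0) ((hb.const_sub 1).div hb hb0).neg hZ (P.inv_denom_ne hx hz))
  · filter_upwards [self_mem_nhdsWithin] with i hi using hi.2.1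
  · exact (((continuous_apply (mob (1 / bOf ν r x.1) (-((1 - bOf ν r x.1) / bOf ν r x.1)) z)).comp continuous_snd).tendsto x).mono_left nhdsWithin_le_nhds

theorem tendsto_qMap (P : StepParams ν r p l₀ l₁ ε) (hx : x ∈ stateSet ν r l₀ l₁ ε) {z : ℂ}
    (hz : z ∈ Omega (-1 / lamOf ν r x.1) (1 / aOf ν r ε x.1)) {Z : ℝ × (ℂ → ℂ) → ℂ}
    (hZ : Tendsto Z (𝓝[stateSet ν r l₀ l₁ ε] x) (𝓝 z)) :
    Tendsto (fun i => qMap ν r p (lamOf ν r i.1) (yOf ν r p ε i) (psiOf ν r i.1 i.2) (Z i))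
      (𝓝[stateSet ν r l₀ l₁ ε] x)
      (𝓝 (qMap ν r p (lamOf ν r x.1) (yOf ν r p ε x) (psiOf ν r x.1 x.2) z)) := by
  have h := P.chainData hx
  have hN := P.normPsi hx
  have hlam := P.tendsto_lamOf hx
  have hconv : ∀ z ∈ Omega (-1 / lamOf ν r x.1) (1 / aOf ν r ε x.1), ∀ Z : ℝ × (ℂ → ℂ) → ℂ,
      Tendsto Z (𝓝[stateSet ν r l₀ l₁ ε] x) (𝓝 z) →
      Tendsto (fun i => psiOf ν r i.1 i.2 (Z i)) (𝓝[stateSet ν r l₀ l₁ ε] x)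
        (𝓝 (psiOf ν r x.1 x.2 z)) := fun z hz Z hZ => P.tendsto_psiOf hx hz hZ
  have hy : Tendsto (yOf ν r p ε) (𝓝[stateSet ν r l₀ l₁ ε] x) (𝓝 (yOf ν r p ε x)) := by
    refine h.tendsto_param hN hconv hlam (ai := fun i => aOf ν r ε i.1) ?_
    filter_upwards [self_mem_nhdsWithin] with i hi using P.chainData hi
  exact h.tendsto_qMap hN hconv hlam hy (Omega_mono le_rfl (P.inv_aOf_le hx) hz) hZ

theorem qMap_mem (P : StepParams ν r p l₀ l₁ ε) (hx : x ∈ stateSet ν r l₀ l₁ ε) {z : ℂ}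
    (hz : z ∈ Omega (-1 / lamOf ν r x.1) (1 / aOf ν r ε x.1)) :
    qMap ν r p (lamOf ν r x.1) (yOf ν r p ε x) (psiOf ν r x.1 x.2) z ∈
      Omega (-1 / lamOf ν r x.1) (1 / aOf ν r ε x.1) :=
  (P.chainData hx).mapsTo_qMap (P.normPsi hx) (P.normPsi hx).one_lt_inv.le (P.inv_aOf_le hx) hz

theorem tendsto_mOf (P : StepParams ν r p l₀ l₁ ε) (hx : x ∈ stateSet ν r l₀ l₁ ε) :
    Tendsto (mOf ν r p ε) (𝓝[stateSet ν r l₀ l₁ ε] x) (𝓝 (mOf ν r p ε x)) := by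
  have h0 : (0 : ℂ) ∈ Omega (-1 / lamOf ν r x.1) (1 / aOf ν r ε x.1) := by
    have h1 := (P.normPsi hx).neg_one_div_lt
    have h2 := (P.normPsi hx).one_lt_inv
    have : ((0 : ℝ) : ℂ) ∈ Omega (-1 / lamOf ν r x.1) (1 / aOf ν r ε x.1) :=
      ofReal_mem_Omega.2 ⟨by linarith, by linarith⟩
    simpa using this
  exact (continuous_re.tendsto _).comp
    (P.tendsto_psiOf hx (P.qMap_mem hx h0) (P.tendsto_qMap hx h0 tendsto_const_nhds))

theorem tendsto_stepOf (P : StepParams ν r p l₀ l₁ ε) (hx : x ∈ stateSet ν r l₀ l₁ ε) {z : ℂ}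
    (hz : z ∈ Omega (-1 / lamOf ν r x.1) (1 / aOf ν r ε x.1)) {Z : ℝ × (ℂ → ℂ) → ℂ}
    (hZ : Tendsto Z (𝓝[stateSet ν r l₀ l₁ ε] x) (𝓝 z)) :
    Tendsto (fun i => stepOf ν r p l₀ ε i (Z i)) (𝓝[stateSet ν r l₀ l₁ ε] x)
      (𝓝 (stepOf ν r p l₀ ε x z)) := by
  have hm := P.tendsto_mOf hx
  have hδ : Tendsto (fun i => deltaOf ν r l₀ (mOf ν r p ε i)) (𝓝[stateSet ν r l₀ l₁ ε] x)
      (𝓝 (deltaOf ν r l₀ (mOf ν r p ε x))) :=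
    tendsto_const_nhds.max (((hm.const_mul _).const_sub 1).div_const _)
  have hne : mOf ν r p ε x + deltaOf ν r l₀ (mOf ν r p ε x) ≠ 0 :=
    (add_pos_of_pos_of_nonneg (P.mOf_pos hx) (deltaOf_nonneg _)).ne'
  refine ((continuous_ofReal.tendsto _).comp ((hm.add hδ).inv₀ hne)).mul ?_
  exact (P.tendsto_psiOf hx (P.qMap_mem hx hz) (P.tendsto_qMap hx hz hZ)).add
    (((continuous_ofReal.tendsto _).comp hδ).mul (hZ.const_sub 1))

theorem continuousOn_stateMap (P : StepParams ν r p l₀ l₁ ε) :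
    ContinuousOn (stateMap ν r p l₀ l₁ ε) (stateSet ν r l₀ l₁ ε) := by
  intro x hx
  have hm := P.tendsto_mOf hx
  have h1 : Tendsto (fun i => (stateMap ν r p l₀ l₁ ε i).1) (𝓝[stateSet ν r l₀ l₁ ε] x)
      (𝓝 (stateMap ν r p l₀ l₁ ε x).1) :=
    tendsto_const_nhds.max (tendsto_const_nhds.min (tendsto_const_nhds.div hm (P.mOf_pos hx).ne'))
  have h2 : Tendsto (fun i => (stateMap ν r p l₀ l₁ ε i).2) (𝓝[stateSet ν r l₀ l₁ ε] x)
      (𝓝 (stateMap ν r p l₀ l₁ ε x).2) := by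
    refine tendsto_pi_nhds.2 fun z => ?_
    by_cases hz : z ∈ Omega (-1) (1 / (1 - 2 * ε))
    · simp only [stateMap_snd_of_mem hz]
      refine P.tendsto_stepOf hx (P.mapsTo_mob hx hz) ?_
      refine tendsto_mob (P.tendsto_bOf hx) ((P.tendsto_bOf hx).const_sub 1) tendsto_const_nhds ?_
      exact mob_denom_ne (P.bOf_pos hx) (fun _ ht => (P.scaleBounds hx).denom_pos rfl ht) hz
    · simp only [stateMap_snd_of_notMem hz]
      exact tendsto_const_nhds
  exact h1.prodMk_nhds h2

theorem convex_stateSet : Convex ℝ (stateSet ν r l₀ l₁ ε) := by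
  intro x hx y hy a b ha hb hab
  refine ⟨(convex_Icc _ _) hx.1 hy.1 ha hb hab, NormClass.convex hx.2.1 hy.2.1 ha hb hab,
    fun t ht => ?_⟩
  have h1 := hx.2.2 t ht
  have h2 := hy.2.2 t ht
  have h3 : ((a • x + b • y).2 (t : ℂ)).re = a * (x.2 t).re + b * (y.2 t).re := by simp
  have h4 : (a • x + b • y).1 = a * x.1 + b * y.1 := by simp
  rw [h3, h4]
  gcongr

theorem isCompact_stateSet (P : StepParams ν r p l₀ l₁ ε) :
    IsCompact (stateSet ν r l₀ l₁ ε) := by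
  have h1 : stateSet ν r l₀ l₁ ε =
      (Icc (l₁ ^ (-(r * ν))) (l₀ ^ (-(r * ν))) ×ˢ NormClass (-1) (1 / (1 - 2 * ε))) ∩
        ⋂ t ∈ Ioo (-1) (1 / (1 - 2 * ε)),
          {x : ℝ × (ℂ → ℂ) | (x.2 ((t : ℝ) : ℂ)).re ≤ x.1} := by
    ext x
    simp only [stateSet, mem_ofPred_eq, mem_inter_iff, mem_prod, mem_iInter₂, and_assoc]
  rw [h1]
  refine (isCompact_Icc.prod (NormClass.isCompact (by norm_num) P.one_lt_end)).inter_right ?_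
  refine isClosed_biInter fun t _ => isClosed_le ?_ continuous_fst
  exact continuous_re.comp ((continuous_apply _).comp continuous_snd)

theorem nonempty_stateSet (P : StepParams ν r p l₀ l₁ ε) :
    (stateSet ν r l₀ l₁ ε).Nonempty := by
  have hE := P.one_lt_end
  have h0 : (0 : ℂ) ∈ Omega (-1) (1 / (1 - 2 * ε)) := by
    have : ((0 : ℝ) : ℂ) ∈ Omega (-1) (1 / (1 - 2 * ε)) :=
      ofReal_mem_Omega.2 ⟨by norm_num, by linarith⟩
    simpa using this
  have h1 : (1 : ℂ) ∈ Omega (-1) (1 / (1 - 2 * ε)) := by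
    have : ((1 : ℝ) : ℂ) ∈ Omega (-1) (1 / (1 - 2 * ε)) :=
      ofReal_mem_Omega.2 ⟨by norm_num, by linarith⟩
    simpa using this
  refine ⟨(l₀ ^ (-(r * ν)), (Omega (-1) (1 / (1 - 2 * ε))).indicator fun z => 1 - z),
    ⟨P.rpow_lt.le, le_rfl⟩,
    ⟨antiHerglotzian_one_sub.congr fun z hz => indicator_of_mem hz _, ?_, ?_,
      fun z hz => indicator_of_notMem hz _⟩, fun t ht => ?_⟩
  · simp only [indicator_of_mem h0, sub_zero]
  · simp only [indicator_of_mem h1, sub_self]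
  · have h2 : (1 : ℝ) ≤ 1 / l₀ := by
      rw [le_div_iff₀ P.l₀_pos]; linarith [P.l₀_lt, P.l₁_lt]
    have h3 := P.one_add_lt
    simp only [indicator_of_mem (ofReal_mem_Omega.2 ht), sub_re, one_re, ofReal_re]
    linarith [ht.1]

theorem exists_isFixedPt (P : StepParams ν r p l₀ l₁ ε) :
    ∃ x ∈ stateSet ν r l₀ l₁ ε, stateMap ν r p l₀ l₁ ε x = x :=
  schauder_tychonoff P.isCompact_stateSet convex_stateSet P.nonempty_stateSet
    P.continuousOn_stateMap P.mapsTo_stateMap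

end StepParams

end StateContinuity

section Extension

open Filter Topology

variable {ν r lam a y : ℝ} {p : ℕ} {ψ : ℂ → ℂ}

theorem ChainData.exists_iterate_lt (h : ChainData ν r p lam a y (reflRe ψ))
    (hψ : NormPsi lam a ψ) {t : ℝ} (ht : 1 < t) (ht' : t < qEnd r lam y (reflRe ψ)) :
    ∃ n, (qRe ν r p lam y (reflRe ψ))^[n] t < 1 / a := by
  have hn1 := h.neg_one_div_lt
  set q := qRe ν r p lam y (reflRe ψ) with hq
  have step : ∀ x, 1 < x → x < qEnd r lam y (reflRe ψ) → 1 < q x ∧ q x < x := fun x hx hx' => by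
    have h1 := h.qRe_lt (x := 1) (by linarith) hx hx'
    rw [h.qRe_one] at h1
    exact ⟨h1, h.qRe_lt_self hψ hx hx'⟩
  have hmem : ∀ n, 1 < q^[n] t ∧ q^[n] t ≤ t := by
    intro n
    induction n with
    | zero => exact ⟨ht, le_rfl⟩
    | succ n ih =>
      rw [Function.iterate_succ_apply']
      have := step _ ih.1 (ih.2.trans_lt ht')
      exact ⟨this.1, this.2.le.trans ih.2⟩
  have hanti : Antitone fun n => q^[n] t := antitone_nat_of_succ_le fun n => by
    rw [Function.iterate_succ_apply']
    exact (step _ (hmem n).1 ((hmem n).2.trans_lt ht')).2.le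
  have hlim := tendsto_atTop_ciInf hanti ⟨1, by rintro _ ⟨n, rfl⟩; exact (hmem n).1.le⟩
  set c := ⨅ n, q^[n] t
  have hc1 : 1 ≤ c := ge_of_tendsto' hlim fun n => (hmem n).1.le
  have hct : c ≤ t := le_of_tendsto' hlim fun n => (hmem n).2
  have hcont : ContinuousOn q (Ioo (-1 / lam) (qEnd r lam y (reflRe ψ))) := by
    refine (h.herglotzian_qMap hψ).pickOn.continuousOn.congr fun x hx => ?_
    beta_reduce
    rw [h.qMap_ofReal hψ hx, ofReal_re]
  have hfix : q c = c := by
    have hca := hcont.continuousAt (Ioo_mem_nhds (show -1 / lam < c by linarith)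
      (hct.trans_lt ht'))
    refine tendsto_nhds_unique (hca.tendsto.comp hlim) ?_
    have h2 := hlim.comp (tendsto_add_atTop_nat 1)
    refine h2.congr fun n => ?_
    simp only [Function.comp_apply, Function.iterate_succ_apply']
  have hc : c = 1 := by
    by_contra hne
    exact (step c (lt_of_le_of_ne hc1 (Ne.symm hne)) (hct.trans_lt ht')).2.ne hfix
  rw [hc] at hlim
  exact (hlim.eventually (gt_mem_nhds hψ.one_lt_inv)).exists

/-- Solutions of the affine functional equation extend to larger domains. -/
theorem ChainData.exists_extension (h : ChainData ν r p lam a y (reflRe ψ))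
    (hψ : NormPsi lam a ψ) {m δ : ℝ} (hm : 0 < m) (hδ : 0 ≤ δ)
    (heq : ∀ z ∈ Omega (-1 / lam) 1, ψ z = stepMap m δ ψ (qMap ν r p lam y ψ) z) {n : ℕ} {t : ℝ}
    (ht : 1 < t) (ht' : t < qEnd r lam y (reflRe ψ))
    (hn : (qRe ν r p lam y (reflRe ψ))^[n] t < 1 / a) :
    ∃ f : ℂ → ℂ, AntiHerglotzian (-1 / lam) t f ∧ f 1 = 0 ∧
      ∀ z ∈ Omega (-1 / lam) 1, f z = ψ z := by
  have hn1 := h.neg_one_div_lt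
  induction n generalizing t with
  | zero => exact ⟨ψ, hψ.anti.mono le_rfl hn.le, hψ.one, fun _ _ => rfl⟩
  | succ n ih =>
    have h1 := h.qRe_lt (x := 1) (by linarith) ht ht'
    rw [h.qRe_one] at h1
    obtain ⟨f, hf, hf1, hfψ⟩ := ih h1 ((h.qRe_lt_self hψ ht ht').trans ht') hn
    refine ⟨stepMap m δ f (qMap ν r p lam y ψ), ?_, ?_, fun z hz => ?_⟩
    · exact hf.stepMap ((h.herglotzian_qMap hψ).mono le_rfl ht'.le)
        (h.mapsTo_qMap_of_lt hψ ht.le ht'.le fun x hx => h.qRe_lt hx.1 hx.2 ht') (by linarith) hδ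
    · rw [stepMap, h.qMap_one hψ, hf1]; simp
    · rw [heq z hz, stepMap, stepMap, hfψ _ (h.mapsTo_qMap hψ le_rfl h.one_lt_qEnd.le hz)]

theorem ChainData.qVal_ge (h : ChainData ν r p lam a y (reflRe ψ))
    (hψ : NormPsi lam a ψ) (hlam : lam ≤ 1 / 16) {m δ : ℝ} (hm : 0 < m) (hδ : 0 ≤ δ)
    (heq : ∀ z ∈ Omega (-1 / lam) 1, ψ z = stepMap m δ ψ (qMap ν r p lam y ψ) z) :
    (((2 : ℝ) ^ (1 / r) - 1) / 90) ^ p * lam / 4 ≤ qVal ν r p lam y ψ := by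
  have hl0 := h.lam_pos
  have hn1 := h.neg_one_div_lt
  have ht : 1 < 1 / (8 * lam) := by rw [lt_div_iff₀ (by linarith)]; linarith
  have ht' : 1 / (8 * lam) < qEnd r lam y (reflRe ψ) := by
    refine lt_trans ?_ h.y_div_lt_qEnd
    rw [div_lt_div_iff₀ (by linarith) hl0]
    nlinarith [h.quarter_le_y hlam]
  obtain ⟨n, hn⟩ := h.exists_iterate_lt hψ ht ht'
  obtain ⟨f, hf, hf1, hfψ⟩ := h.exists_extension hψ hm hδ heq ht ht' hn
  have h0 : (0 : ℂ) ∈ Omega (-1 / lam) 1 := by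
    have : ((0 : ℝ) : ℂ) ∈ Omega (-1 / lam) 1 := ofReal_mem_Omega.2 ⟨by linarith, by linarith⟩
    simpa using this
  have hN : NormPsi lam (8 * lam) f :=
    ⟨h.pickNorm.lam_mem, ⟨by linarith, by linarith⟩, hf, by rw [hfψ 0 h0, hψ.zero], hf1⟩
  have hre : ∀ x : ℝ, 0 ≤ x → x < 1 / lam → reflRe f x = reflRe ψ x := fun x hx hx' => by
    rw [reflRe, reflRe, hfψ]
    rw [← ofReal_neg, ofReal_mem_Omega, neg_div]
    exact ⟨by linarith, by linarith⟩
  have h1 := h.fixed_point_le hlam fun x w hx hxw hw => by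
    rw [← hre x hx (hxw.trans hw), ← hre w (hx.trans hxw.le) hw]
    exact hN.pickNorm.ratio_ge (by linarith) hxw hw
  have h2 := h.qRe_zero_mem
  have h3 : qRe ν r p lam y (reflRe ψ) 0 =
    lam ^ (ν - 1) * chain (fun x => reflRe ψ x ^ (1 / r)) 0 y p := by rw [qRe, mul_zero]
  rw [← h3] at h1
  have h4 := hψ.pickNorm.neg_ge h2
  rw [← h.qVal_eq hψ] at h4
  have h5 := h.qVal_pos hψ
  have h6 : lam * qRe ν r p lam y (reflRe ψ) 0 ≤ 1 := by nlinarith [h2.1, h2.2]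
  nlinarith

/-- An upper bound for `ψ (Q 0)` when `λ` is close to one. -/
theorem ChainData.qVal_mul_le (h : ChainData ν r p lam a y (reflRe ψ))
    (hψ : NormPsi lam a ψ) {ε : ℝ} (hε : 0 < ε) (ha : a = 1 - ε * (1 + lam)) :
    qVal ν r p lam y ψ * (1 + ε * lam ^ 2 / (2 * (1 - lam))) ≤ 1 := by
  have hl0 := h.lam_pos
  have hl1 := h.lam_lt_one
  have h2 := h.qRe_zero_mem
  have h3 : qRe ν r p lam y (reflRe ψ) 0 =
    lam ^ (ν - 1) * chain (fun x => reflRe ψ x ^ (1 / r)) 0 y p := by rw [qRe, mul_zero]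
  have h4 := h.rpow_le_fixed_point
  rw [← h3] at h4
  have h5 : lam ^ 2 ≤ lam ^ ν := by
    rw [← Real.rpow_two]
    exact Real.rpow_le_rpow_of_exponent_ge hl0 hl1.le h.ν_mem.2
  have h6 := hψ.pickNorm.neg_le h2
  have h7 := h.qVal_pos hψ
  rw [← h.qVal_eq hψ] at h6
  set m := qVal ν r p lam y ψ
  set q := qRe ν r p lam y (reflRe ψ) 0
  have hq1 : 0 < 1 - q := by linarith [h2.2]
  have hd : 0 < 2 * (1 - lam) := by linarith
  have h8 : 1 - q ≤ 2 * (1 - lam) := by nlinarith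
  have h9 : ε * lam ^ 2 ≤ (1 - a) * q := by
    have : ε * lam ^ 2 ≤ ε * q := by gcongr; linarith
    rw [ha]
    nlinarith [mul_pos (mul_pos hε hl0) h2.1]
  have h10 : ε * lam ^ 2 / (2 * (1 - lam)) * (1 - q) ≤ ε * lam ^ 2 := by
    rw [div_mul_eq_mul_div, div_le_iff₀ hd]
    have : 0 ≤ ε * lam ^ 2 := by positivity
    gcongr
  refine le_of_mul_le_mul_right ?_ hq1
  have h11 : m * (ε * lam ^ 2 / (2 * (1 - lam)) * (1 - q)) ≤ m * ((1 - a) * q) :=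
    mul_le_mul_of_nonneg_left (h10.trans h9) h7.le
  linarith

end Extension

section FixedPoint

variable {ν r l₀ l₁ ε : ℝ} {p : ℕ} {x : ℝ × (ℂ → ℂ)}

namespace StepParams

theorem psiOf_eq_stepOf (P : StepParams ν r p l₀ l₁ ε) (hx : x ∈ stateSet ν r l₀ l₁ ε)
    (hfix : stateMap ν r p l₀ l₁ ε x = x) {z : ℂ}
    (hz : z ∈ Omega (-1 / lamOf ν r x.1) (1 / aOf ν r ε x.1)) :
    psiOf ν r x.1 x.2 z = stepOf ν r p l₀ ε x z := by
  have h1 := congrFun (congrArg Prod.snd hfix)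
    (mob (1 / bOf ν r x.1) (-((1 - bOf ν r x.1) / bOf ν r x.1)) z)
  rw [stateMap_snd_of_mem (P.mapsTo_inv_mob hx hz), P.mob_mob hx hz] at h1
  exact h1.symm

theorem rpow_le_inv_mOf (P : StepParams ν r p l₀ l₁ ε) (hx : x ∈ stateSet ν r l₀ l₁ ε)
    (hfix : stateMap ν r p l₀ l₁ ε x = x)
    (hl₁ : l₁ ^ (-(2 * r)) ≤ 1 + ε * l₁ ^ 2 / (2 * (1 - l₁))) :
    l₁ ^ (-(r * ν)) ≤ 1 / mOf ν r p ε x := by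
  by_contra! hlt
  have h1 : x.1 = l₁ ^ (-(r * ν)) := by
    rw [← congrArg Prod.fst hfix]
    exact max_eq_left ((min_le_right _ _).trans hlt.le)
  have hlam : lamOf ν r x.1 = l₁ := by rw [h1, P.lamOf_rpow_neg P.l₁_pos]
  have hm := P.mOf_pos hx
  have h2 := (P.chainData hx).qVal_mul_le (P.normPsi hx) P.ε_pos rfl
  rw [hlam] at h2
  have h3 : mOf ν r p ε x = qVal ν r p l₁ (yOf ν r p ε x) (psiOf ν r x.1 x.2) := by
    rw [mOf, hlam]
  rw [← h3] at h2
  have h4 : l₁ ^ (-(r * ν)) ≤ l₁ ^ (-(2 * r)) :=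
    Real.rpow_le_rpow_of_exponent_ge P.l₁_pos P.l₁_lt.le
      (by nlinarith [P.ν_mem.2, P.one_lt_r])
  rw [div_lt_iff₀ hm] at hlt
  have h5 := mul_le_mul_of_nonneg_left (h4.trans hl₁) hm.le
  linarith

theorem inv_mOf_le_rpow (P : StepParams ν r p l₀ l₁ ε) (hx : x ∈ stateSet ν r l₀ l₁ ε)
    (hfix : stateMap ν r p l₀ l₁ ε x = x) (hl₀ : l₀ ≤ 1 / 16)
    (hl₀' : l₀ ^ (r - 1) ≤ (((2 : ℝ) ^ (1 / r) - 1) / 90) ^ p / 4) :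
    1 / mOf ν r p ε x ≤ l₀ ^ (-(r * ν)) := by
  by_contra! hlt
  have h1 : x.1 = l₀ ^ (-(r * ν)) := by
    rw [← congrArg Prod.fst hfix]
    simp only [stateMap]
    rw [min_eq_left hlt.le, max_eq_right P.rpow_lt.le]
  have hlam : lamOf ν r x.1 = l₀ := by rw [h1, P.lamOf_rpow_neg P.l₀_pos]
  have hm := P.mOf_pos hx
  have h2 := (P.chainData hx).qVal_ge (P.normPsi hx) (hlam.le.trans hl₀) hm (deltaOf_nonneg _)
    fun z hz => P.psiOf_eq_stepOf hx hfix (Omega_mono le_rfl (P.normPsi hx).one_lt_inv.le hz)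
  change _ ≤ mOf ν r p ε x at h2
  rw [hlam] at h2
  have h3 : l₀ ^ (r * ν) ≤ l₀ * l₀ ^ (r - 1) := by
    rw [← Real.rpow_one_add' P.l₀_pos.le (by linarith [P.one_lt_r])]
    exact Real.rpow_le_rpow_of_exponent_ge P.l₀_pos (by linarith)
      (by nlinarith [P.ν_mem.1, P.one_lt_r])
  have h4 := mul_le_mul_of_nonneg_left hl₀' P.l₀_pos.le
  rw [Real.rpow_neg P.l₀_pos.le, ← one_div,
    one_div_lt_one_div (Real.rpow_pos_of_pos P.l₀_pos _) hm] at hlt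
  linarith

theorem exists_isSolution (P : StepParams ν r p l₀ l₁ ε) (hl₀ : l₀ ≤ 1 / 16)
    (hl₀' : l₀ ^ (r - 1) ≤ (((2 : ℝ) ^ (1 / r) - 1) / 90) ^ p / 4)
    (hl₁ : l₁ ^ (-(2 * r)) ≤ 1 + ε * l₁ ^ 2 / (2 * (1 - l₁))) :
    ∃ ψ u : ℂ → ℂ, ∃ lam z₁ : ℝ, IsSolution ν r p ψ u lam z₁ := by
  obtain ⟨x, hx, hfix⟩ := P.exists_isFixedPt
  have h := P.chainData hx
  have hψ := P.normPsi hx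
  have hm := P.mOf_pos hx
  have hle := P.inv_mOf_le_rpow hx hfix hl₀ hl₀'
  have hge := P.rpow_le_inv_mOf hx hfix hl₁
  have hδ : deltaOf ν r l₀ (mOf ν r p ε x) = 0 := by
    refine max_eq_left (div_nonpos_of_nonpos_of_nonneg ?_ (by linarith [P.one_add_lt]))
    rw [div_le_iff₀ hm] at hle
    linarith
  have hx1 : x.1 = 1 / mOf ν r p ε x := by
    rw [← congrArg Prod.fst hfix]
    simp only [stateMap]
    rw [min_eq_right hle, max_eq_right hge]
  have hlamm : (lamOf ν r x.1 ^ (r * ν))⁻¹ = (mOf ν r p ε x)⁻¹ := by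
    rw [← Real.rpow_neg h.lam_pos.le, P.lamOf_rpow (P.pos_of_mem hx), hx1, one_div]
  have heq : ∀ z ∈ Omega (-1 / lamOf ν r x.1) (1 / aOf ν r ε x.1), psiOf ν r x.1 x.2 z =
      (((lamOf ν r x.1 ^ (r * ν))⁻¹ : ℝ) : ℂ) * psiOf ν r x.1 x.2
        (qMap ν r p (lamOf ν r x.1) (yOf ν r p ε x) (psiOf ν r x.1 x.2) z) := fun z hz => by
    rw [hlamm]
    refine (P.psiOf_eq_stepOf hx hfix hz).trans ?_
    rw [stepOf, hδ, stepMap, add_zero, ofReal_zero, zero_mul, add_zero]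
  generalize lamOf ν r x.1 = lam at *
  generalize aOf ν r ε x.1 = a at *
  generalize psiOf ν r x.1 x.2 = ψ at *
  generalize yOf ν r p ε x = y at *
  have hc := Real.rpow_pos_of_pos h.lam_pos (ν - 1)
  have hy : y * lam ^ (ν - 1) / lam ^ (ν - 1) = y := mul_div_cancel_right₀ _ hc.ne'
  refine ⟨ψ, fun z => uCheck ψ r y (-z), lam, y * lam ^ (ν - 1), hψ.lam_mem, h.y_mul_mem,
    ⟨a, hψ.a_mem, hψ.anti, hψ.one, hψ.zero, fun z hz => ?_⟩, ?_, fun t ht => ?_, fun z _ => ?_⟩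
  · simp only [neg_neg]
    rw [← ofReal_inv]
    exact heq z hz
  · have := (hψ.herglotzian_uCheck h.one_lt_r h.y_pos.le).comp_neg
    rwa [neg_neg, ← neg_div] at this
  · have h1 := hψ.one_lt_inv
    refine ⟨hψ.anti.im_ofReal ⟨ht.1, ht.2.trans h1⟩, ?_⟩
    have h2 := ht.1
    rw [neg_div] at h2
    have := hψ.pickNorm.pos (x := -t) (by linarith [ht.2]) (by linarith)
    simpa [reflRe] using this
  · rw [hy]
    simp [uCheck]

end StepParams

end FixedPoint

section Parameters

open Filter Topology

theorem exists_stepParams {p : ℕ} (hp : 1 ≤ p) {ν r : ℝ} (hν : ν ∈ Icc (1 : ℝ) 2) (hr : 1 < r) :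
    ∃ l₀ l₁ ε : ℝ, StepParams ν r p l₀ l₁ ε ∧ l₀ ≤ 1 / 16 ∧
      l₀ ^ (r - 1) ≤ (((2 : ℝ) ^ (1 / r) - 1) / 90) ^ p / 4 ∧
      l₁ ^ (-(2 * r)) ≤ 1 + ε * l₁ ^ 2 / (2 * (1 - l₁)) := by
  have hp' : (1 : ℝ) ≤ p := by exact_mod_cast hp
  set D : ℝ := p * (4 * r) ^ p with hD
  have hD1 : 1 ≤ D := one_le_mul_of_one_le_of_one_le hp' (one_le_pow₀ (by linarith))
  have hθ : 0 < (((2 : ℝ) ^ (1 / r) - 1) / 90) ^ p / 4 := by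
    have : (1 : ℝ) < 2 ^ (1 / r) := Real.one_lt_rpow (by norm_num) (by positivity)
    have : 0 < ((2 : ℝ) ^ (1 / r) - 1) / 90 := by linarith
    positivity
  set θ := (((2 : ℝ) ^ (1 / r) - 1) / 90) ^ p / 4
  obtain ⟨l₀, hl0, hl1, hl2⟩ : ∃ l₀ : ℝ, 0 < l₀ ∧ l₀ ≤ 1 / 16 ∧ l₀ ^ (r - 1) < min θ (1 / 2) := by
    have h1 : Tendsto (fun l : ℝ => l ^ (r - 1)) (𝓝[>] 0) (𝓝 0) := by
      have := (Real.continuousAt_rpow_const 0 (r - 1) (Or.inr (by linarith))).tendsto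
      rw [Real.zero_rpow (by linarith)] at this
      exact this.mono_left nhdsWithin_le_nhds
    have h2 : ∀ᶠ l : ℝ in 𝓝[>] 0, l ∈ Ioo (0 : ℝ) (1 / 16) :=
      Ioo_mem_nhdsGT (by norm_num)
    obtain ⟨l, hl, hl'⟩ := (h2.and (h1.eventually (gt_mem_nhds
      (lt_min hθ (by norm_num : (0 : ℝ) < 1 / 2))))).exists
    exact ⟨l, hl.1, hl.2.le, hl'⟩
  obtain ⟨l₁, hl3, hl4, hl5⟩ : ∃ l₁ : ℝ, 1 / 2 < l₁ ∧ l₁ < 1 ∧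
      l₁ ^ (-(2 * r)) < 1 + l₁ ^ 2 / (8 * D) := by
    have h1 : Tendsto (fun l : ℝ => 1 + l ^ 2 / (8 * D) - l ^ (-(2 * r))) (𝓝[<] 1)
        (𝓝 (1 + 1 ^ 2 / (8 * D) - 1 ^ (-(2 * r)))) := by
      have h2 : ContinuousAt (fun l : ℝ => 1 + l ^ 2 / (8 * D) - l ^ (-(2 * r))) 1 := by
        have := Real.continuousAt_rpow_const 1 (-(2 * r)) (Or.inl one_ne_zero)
        fun_prop
      exact h2.tendsto.mono_left nhdsWithin_le_nhds
    have h3 : 0 < 1 + 1 ^ 2 / (8 * D) - (1 : ℝ) ^ (-(2 * r)) := by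
      rw [Real.one_rpow]
      have : 0 < 1 / (8 * D) := by positivity
      linarith
    have h2 : ∀ᶠ l : ℝ in 𝓝[<] 1, l ∈ Ioo (1 / 2 : ℝ) 1 := Ioo_mem_nhdsLT (by norm_num)
    obtain ⟨l, hl, hl'⟩ := (h2.and (h1.eventually (lt_mem_nhds h3))).exists
    exact ⟨l, hl.1, hl.2, by linarith⟩
  have hε : 2 * ((1 - l₁) / (4 * D)) * D = (1 - l₁) / 2 := by field_simp; ring
  have hε0 : 0 < (1 - l₁) / (4 * D) := div_pos (by linarith) (by linarith)
  refine ⟨l₀, l₁, (1 - l₁) / (4 * D), ⟨hν, hr, hp, hl0, by linarith, hl4, hε0, ?_, ?_, ?_⟩, hl1,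
    (hl2.trans_le (min_le_left _ _)).le, hl5.le.trans_eq ?_⟩
  · nlinarith
  · linarith
  · have h1 : l₀ ^ (-r) ≤ l₀ ^ (-(r * ν)) :=
      Real.rpow_le_rpow_of_exponent_ge hl0 (by linarith) (by nlinarith [hν.1])
    refine lt_of_lt_of_le ?_ h1
    have h2 := hl2.trans_le (min_le_right _ _)
    rw [Real.rpow_sub hl0, Real.rpow_one, div_lt_iff₀ hl0] at h2
    rw [Real.rpow_neg hl0.le, ← one_div, lt_div_iff₀ (Real.rpow_pos_of_pos hl0 _)]
    calc (1 + 1 / l₀) * l₀ ^ r < (1 + 1 / l₀) * (1 / 2 * l₀) := by gcongr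
      _ = (l₀ + 1) / 2 := by field_simp
      _ ≤ 1 := by linarith
  · have : 1 - l₁ ≠ 0 := by linarith
    field_simp
    ring

end Parameters

/-- For any integer `p ≥ 1`, any real `ν ∈ [1,2]` and any real `r > 1`, there
exists a solution for the parameters `(ν, r, p)`. -/
theorem existence_nu_ge_one (p : ℕ) (hp : 1 ≤ p) (ν r : ℝ)
    (hν : ν ∈ Set.Icc (1:ℝ) 2) (hr : 1 < r) :
    ∃ ψ u : ℂ → ℂ, ∃ lam z₁ : ℝ, IsSolution ν r p ψ u lam z₁ := by
  obtain ⟨l₀, l₁, ε, P, h₀, h₀', h₁⟩ := exists_stepParams hp hν hr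
  exact P.exists_isSolution h₀ h₀' h₁
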